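/- (Second link) Let X ⊂ ℙ³ be a smooth cubic surface and a an integer. Assume that the ideal I_{Z_{n(a−1)},X} ⊂ R_X of a general set of n(a−1) = (3/2)(a−2)(a−1) + 2a − 2 points on X has graded minimal free resolution over R given by 0 → R(−a−2)^{2a−3} → R(−a−1)^{3a−3} → R(−a+1)^{a} → I_{Z_{n(a−1)},X} → 0. Then the ideal I_{Z_{o(a)},X} of a general set of o(a) = (3/2)a(a−1) + a + 1 points on X has graded minimal free resolution over R given by 0 → R(−a−3)^{a} → R(−a−1)^{3a−3} ⊕ R(−a−2)^{3} → R(−a)^{2a} → I_{Z_{o(a)},X} → 0. -/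

import Mathlib

/-!
Common definitions for formalizing "The minimal resolution conjecture for points
on the cubic surface" (arXiv:math/0611137).

We work with `R = k[x₀,x₁,x₂,x₃]`, closed points of `ℙ³` modeled by
`Projectivization k (Fin 4 → k)`, saturated ideals of sets of points as vanishing
ideals, genericity expressed by a nonempty basic open subset of the configuration
space, and graded minimal free resolutions expressed by explicit homogeneous
matrices whose entries have zero constant term (no nonzero scalar entries).
-/

open MvPolynomial

noncomputable section

/-- The polynomial ring `R = k[x₀,x₁,x₂,x₃]` in four variables over `k`. -/
abbrev R4 (k : Type) [Field k] : Type := MvPolynomial (Fin 4) k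

/-- The (closed) points of the projective space `ℙ³` over `k`. -/
abbrev P3 (k : Type) [Field k] : Type := Projectivization k (Fin 4 → k)

variable (k : Type) [Field k]

/-- A polynomial vanishes at a projective point if it vanishes at every
representative vector of that point. -/
def VanishesAt (f : R4 k) (p : P3 k) : Prop :=
  ∀ (v : Fin 4 → k) (hv : v ≠ 0), Projectivization.mk k v hv = p → eval v f = 0

/-- The saturated homogeneous ideal `I_Z ⊆ R` of a set `Z` of (reduced) points of
`ℙ³`: all polynomials vanishing at every point of `Z`. -/
def pointsIdeal (Zs : Set (P3 k)) : Ideal (R4 k) where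
  carrier := {f | ∀ p ∈ Zs, VanishesAt k f p}
  zero_mem' := by
    intro p _ v hv _
    simp
  add_mem' := by
    intro a b ha hb p hp v hv hmk
    have h1 := ha p hp v hv hmk
    have h2 := hb p hp v hv hmk
    simp [h1, h2]
  smul_mem' := by
    intro c a ha p hp v hv hmk
    have h1 := ha p hp v hv hmk
    simp [smul_eq_mul, h1]

/-- An ideal of `R` is homogeneous if it is generated by homogeneous elements. -/
def IsHomogIdeal (I : Ideal (R4 k)) : Prop :=
  ∃ G : Set (R4 k), (∀ g ∈ G, ∃ d : ℕ, g.IsHomogeneous d) ∧ I = Ideal.span G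

/-- Saturation of an ideal with respect to the irrelevant maximal ideal
`(x₀,…,x₃)`. -/
def satIdeal (I : Ideal (R4 k)) : Ideal (R4 k) where
  carrier := {g | ∀ i : Fin 4, ∃ N : ℕ, (X i : R4 k) ^ N * g ∈ I}
  zero_mem' := by
    intro i
    exact ⟨0, by simp⟩
  add_mem' := by
    intro a b ha hb i
    obtain ⟨N, hN⟩ := ha i
    obtain ⟨M, hM⟩ := hb i
    refine ⟨N + M, ?_⟩
    have h1 : (X i : R4 k) ^ (N + M) * (a + b)
        = X i ^ M * (X i ^ N * a) + X i ^ N * (X i ^ M * b) := by ring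
    rw [h1]
    exact Ideal.add_mem _ (Ideal.mul_mem_left _ _ hN) (Ideal.mul_mem_left _ _ hM)
  smul_mem' := by
    intro c a ha i
    obtain ⟨N, hN⟩ := ha i
    refine ⟨N, ?_⟩
    have h1 : (X i : R4 k) ^ N * (c • a) = c * (X i ^ N * a) := by
      rw [smul_eq_mul]; ring
    rw [h1]
    exact Ideal.mul_mem_left _ _ hN

/-- The colon ideal `(I : J) = {r | r·J ⊆ I}`. -/
def icolon (I J : Ideal (R4 k)) : Ideal (R4 k) where
  carrier := {r | ∀ x ∈ J, r * x ∈ I}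
  zero_mem' := by
    intro x hx
    rw [zero_mul]; exact I.zero_mem
  add_mem' := by
    intro a b ha hb x hx
    rw [add_mul]
    exact Ideal.add_mem _ (ha x hx) (hb x hx)
  smul_mem' := by
    intro c a ha x hx
    rw [smul_eq_mul, mul_assoc]
    exact Ideal.mul_mem_left _ _ (ha x hx)

/-- A smooth cubic surface `X ⊂ ℙ³`: an irreducible homogeneous cubic form with
no singular zero (Jacobian criterion). -/
structure SmoothCubicSurface (k : Type) [Field k] : Type where
  f : MvPolynomial (Fin 4) k
  homog : f.IsHomogeneous 3
  irred : Irreducible f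
  smooth : ∀ v : Fin 4 → k, v ≠ 0 → eval v f = 0 →
    ∃ i : Fin 4, eval v (pderiv i f) ≠ 0

/-- A configuration of `t` distinct points lying on `X`. -/
def ConfigOn (S : SmoothCubicSurface k) {t : ℕ} (Z : Fin t → P3 k) : Prop :=
  Function.Injective Z ∧ ∀ i, VanishesAt k S.f (Z i)

/-- A configuration avoids the (closed locus of the) polynomial `g` on the
product of the affine cones: some choice of representatives does not annihilate `g`. -/
def Avoids {t : ℕ} (g : MvPolynomial (Fin t × Fin 4) k) (Z : Fin t → P3 k) : Prop :=
  ∃ v : Fin t → Fin 4 → k,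
    (∀ i, ∃ hv : v i ≠ 0, Projectivization.mk k (v i) hv = Z i) ∧
    eval (fun q : Fin t × Fin 4 => v q.1 q.2) g ≠ 0

/-- `P` holds for a *general* set of `t` points on `X`: it holds on a nonempty
(basic) Zariski-open subset of the family of all sets of `t` points of `X`. -/
def GeneralPointsSatisfy (S : SmoothCubicSurface k) (t : ℕ)
    (P : (Fin t → P3 k) → Prop) : Prop :=
  ∃ g : MvPolynomial (Fin t × Fin 4) k,
    (∃ Z : Fin t → P3 k, ConfigOn k S Z ∧ Avoids k g Z) ∧
    (∀ Z : Fin t → P3 k, ConfigOn k S Z → Avoids k g Z → P Z)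

/-- An admissible entry of a matrix in a graded **minimal** free resolution,
mapping a generator of degree `d` into a generator of degree `e`: the entry is
homogeneous of degree `d - e`, and it is not a nonzero scalar (zero constant
coefficient). -/
def EntryOk (d e : ℕ) (q : R4 k) : Prop :=
  (q = 0 ∨ ∃ c : ℕ, d = e + c ∧ q.IsHomogeneous c) ∧ coeff 0 q = 0

/-- Integer-degree version of `EntryOk` (for modules with generators of
arbitrary integer degrees). -/
def EntryOkZ (d e : ℤ) (q : R4 k) : Prop :=
  (q = 0 ∨ ∃ c : ℕ, d = e + (c : ℤ) ∧ q.IsHomogeneous c) ∧ coeff 0 q = 0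

/-- The body of a graded minimal free resolution of length 2 over `R` of the
`R`-module `I/J`:
`0 → ⊕ R(-d2 i) --M2--> ⊕ R(-d1 j) --g--> I/J → 0`.
The generators `g j ∈ I` are homogeneous of degree `d1 j` and generate `I` mod `J`;
`M2` is a homogeneous matrix with no nonzero scalar entries whose rows generate the
kernel, and which is injective. -/
def Res2Body (J I : Ideal (R4 k)) {n1 n2 : ℕ}
    (d1 : Fin n1 → ℕ) (d2 : Fin n2 → ℕ)
    (g : Fin n1 → R4 k) (M2 : Fin n2 → Fin n1 → R4 k) : Prop :=
  (∀ j, g j ∈ I ∧ (g j).IsHomogeneous (d1 j)) ∧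
  (∀ x ∈ I, ∃ w : Fin n1 → R4 k, x - ∑ j, w j * g j ∈ J) ∧
  (∀ i j, EntryOk k (d2 i) (d1 j) (M2 i j)) ∧
  (∀ w : Fin n1 → R4 k,
    ((∑ j, w j * g j) ∈ J) ↔ ∃ u : Fin n2 → R4 k, ∀ j, w j = ∑ i, u i * M2 i j) ∧
  (∀ u : Fin n2 → R4 k, (∀ j, (∑ i, u i * M2 i j) = 0) → u = 0)

/-- `I/J` has a graded minimal free resolution
`0 → ⊕ R(-d2 i) → ⊕ R(-d1 j) → I/J → 0` over `R`. -/
def HasMinFreeRes2 (J I : Ideal (R4 k)) {n1 n2 : ℕ}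
    (d1 : Fin n1 → ℕ) (d2 : Fin n2 → ℕ) : Prop :=
  ∃ (g : Fin n1 → R4 k) (M2 : Fin n2 → Fin n1 → R4 k), Res2Body k J I d1 d2 g M2

/-- The body of a graded minimal free resolution of length 3 over `R` of the
`R`-module `I/J`:
`0 → ⊕ R(-d3 l) --M3--> ⊕ R(-d2 i) --M2--> ⊕ R(-d1 j) --g--> I/J → 0`. -/
def Res3Body (J I : Ideal (R4 k)) {n1 n2 n3 : ℕ}
    (d1 : Fin n1 → ℕ) (d2 : Fin n2 → ℕ) (d3 : Fin n3 → ℕ)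
    (g : Fin n1 → R4 k) (M2 : Fin n2 → Fin n1 → R4 k)
    (M3 : Fin n3 → Fin n2 → R4 k) : Prop :=
  (∀ j, g j ∈ I ∧ (g j).IsHomogeneous (d1 j)) ∧
  (∀ x ∈ I, ∃ w : Fin n1 → R4 k, x - ∑ j, w j * g j ∈ J) ∧
  (∀ i j, EntryOk k (d2 i) (d1 j) (M2 i j)) ∧
  (∀ i j, EntryOk k (d3 i) (d2 j) (M3 i j)) ∧
  (∀ w : Fin n1 → R4 k,
    ((∑ j, w j * g j) ∈ J) ↔ ∃ u : Fin n2 → R4 k, ∀ j, w j = ∑ i, u i * M2 i j) ∧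
  (∀ u : Fin n2 → R4 k,
    (∀ j, (∑ i, u i * M2 i j) = 0) ↔ ∃ t : Fin n3 → R4 k, ∀ i, u i = ∑ l, t l * M3 l i) ∧
  (∀ t : Fin n3 → R4 k, (∀ i, (∑ l, t l * M3 l i) = 0) → t = 0)

/-- `I/J` has a graded minimal free resolution
`0 → ⊕ R(-d3 l) → ⊕ R(-d2 i) → ⊕ R(-d1 j) → I/J → 0` over `R`.
Taking `J = ⊥` this is a resolution of the ideal `I ⊆ R`; taking `J = (f)` it is a
resolution of `I/(f) ⊆ R_X = R/(f)`; taking `J = I_C` a resolution of `I/I_C`. -/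
def HasMinFreeRes3 (J I : Ideal (R4 k)) {n1 n2 n3 : ℕ}
    (d1 : Fin n1 → ℕ) (d2 : Fin n2 → ℕ) (d3 : Fin n3 → ℕ) : Prop :=
  ∃ (g : Fin n1 → R4 k) (M2 : Fin n2 → Fin n1 → R4 k) (M3 : Fin n3 → Fin n2 → R4 k),
    Res3Body k J I d1 d2 d3 g M2 M3

/-- The Betti numbers read off from a minimal free resolution
`0 → F₃ → F₂ → F₁ → I_Z → 0` of the ideal of `Z` (so that
`F_i = ⊕_j R(-i-j)^{b_{i,j}}` in the resolution of `R/I_Z`, with `F₀ = R`). -/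
def bettiCount {n1 n2 n3 : ℕ} (d1 : Fin n1 → ℕ) (d2 : Fin n2 → ℕ) (d3 : Fin n3 → ℕ)
    (i j : ℕ) : ℕ :=
  if i = 0 then (if j = 0 then 1 else 0)
  else if i = 1 then (Finset.univ.filter fun l => d1 l = 1 + j).card
  else if i = 2 then (Finset.univ.filter fun l => d2 l = 2 + j).card
  else if i = 3 then (Finset.univ.filter fun l => d3 l = 3 + j).card
  else 0

/-- The Hilbert polynomial `P_X(t) = (3/2)t(t+1) + 1` of the cubic surface. -/
def PXcubic (t : ℕ) : ℕ := 3 * (t * (t + 1) / 2) + 1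

/-- The saturated homogeneous ideal of an integral curve lying on `X`. -/
def IsCurveIdealOn (S : SmoothCubicSurface k) (I : Ideal (R4 k)) : Prop :=
  IsHomogIdeal k I ∧ I.IsPrime ∧ S.f ∈ I ∧
    ringKrullDim (R4 k ⧸ I) = ((2 : ℕ∞) : WithBot ℕ∞)

/-- The Jacobian criterion at a point of the cone: some 2×2 minor of the Jacobian
matrix of elements of `I` is nonzero, i.e. the curve is smooth there. -/
def CurveSmoothAt (I : Ideal (R4 k)) (v : Fin 4 → k) : Prop :=
  ∃ g₁ ∈ I, ∃ g₂ ∈ I, ∃ i j : Fin 4,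
    eval v (pderiv i g₁) * eval v (pderiv j g₂)
      - eval v (pderiv j g₁) * eval v (pderiv i g₂) ≠ 0

/-- A smooth (integral) curve on `X`. -/
def IsSmoothCurveIdealOn (S : SmoothCubicSurface k) (I : Ideal (R4 k)) : Prop :=
  IsCurveIdealOn k S I ∧
  ∀ v : Fin 4 → k, v ≠ 0 → (∀ g ∈ I, eval v g = 0) → CurveSmoothAt k I v

/-- The coordinate ring `R/I` of a curve has depth 2 (a regular sequence of two
positive-degree homogeneous elements), i.e. the curve is arithmetically
Cohen–Macaulay. -/
def IsACMIdeal (I : Ideal (R4 k)) : Prop :=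
  ∃ r₁ r₂ : R4 k,
    (∃ d₁ : ℕ, 0 < d₁ ∧ r₁.IsHomogeneous d₁) ∧
    (∃ d₂ : ℕ, 0 < d₂ ∧ r₂.IsHomogeneous d₂) ∧
    (∀ x : R4 k, r₁ * x ∈ I → x ∈ I) ∧
    (∀ x : R4 k, r₂ * x ∈ I ⊔ Ideal.span {r₁} → x ∈ I ⊔ Ideal.span {r₁})

/-- The Hilbert function `t ↦ dim_k (R/I)_t`. -/
def hilbFn (I : Ideal (R4 k)) (t : ℕ) : ℕ :=
  Module.finrank k ↥(homogeneousSubmodule (Fin 4) k t) -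
    Module.finrank k ↥(homogeneousSubmodule (Fin 4) k t ⊓
      Submodule.restrictScalars k I)

/-- The subscheme with saturated ideal `I` has degree `d` and (arithmetic) genus `g`,
read off from the Hilbert polynomial `P(t) = d·t + 1 - g`. -/
def HasDegreeGenus (I : Ideal (R4 k)) (d : ℕ) (g : ℤ) : Prop :=
  ∃ N : ℕ, ∀ t : ℕ, N ≤ t → (hilbFn k I t : ℤ) = d * t + 1 - g

/-- Linear equivalence of divisors on `X`: the divisor with (divisorial) ideal `I`
is linearly equivalent to (divisor of `J`) + `a·H`, where `H` is the hyperplane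
class.  Concretely, there are homogeneous forms `q, p` with `deg p = deg q + a`,
nonzero on `X`, with `q·I = p·J` in `R_X = R/(f)`.  (Taking `J = ⊤` expresses
that the divisor of `I` is linearly equivalent to `aH`.) -/
def LinEquivOnX (S : SmoothCubicSurface k) (I J : Ideal (R4 k)) (a : ℤ) : Prop :=
  ∃ (mq mp : ℕ) (q p : R4 k), (mp : ℤ) = (mq : ℤ) + a ∧
    q.IsHomogeneous mq ∧ p.IsHomogeneous mp ∧
    q ∉ Ideal.span {S.f} ∧ p ∉ Ideal.span {S.f} ∧
    Ideal.span {q} * I ⊔ Ideal.span {S.f} = Ideal.span {p} * J ⊔ Ideal.span {S.f}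

/-- Linear equivalence, on the curve `C` with ideal `IC`, of the divisor with
ideal `IG` to `r·H_C` (`H_C` the hyperplane section of `C`): there are homogeneous
forms `q, p`, nonzero on `C`, with `deg p = deg q + r` and `q·I_{G,C} = (p)` in
`R/I_C`. -/
def DivOnCurveEquivH (IC IG : Ideal (R4 k)) (r : ℤ) : Prop :=
  ∃ (mq mp : ℕ) (q p : R4 k), (mp : ℤ) = (mq : ℤ) + r ∧
    q.IsHomogeneous mq ∧ p.IsHomogeneous mp ∧ q ∉ IC ∧ p ∉ IC ∧
    Ideal.span {q} * IG ⊔ IC = Ideal.span {p} ⊔ IC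

/-- The saturated homogeneous ideal of a zero-dimensional subscheme of `ℙ³`. -/
def IsZeroDimIdeal (I : Ideal (R4 k)) : Prop :=
  IsHomogIdeal k I ∧ satIdeal k I = I ∧
    ringKrullDim (R4 k ⧸ I) = ((1 : ℕ∞) : WithBot ℕ∞)

/-- An arithmetically Gorenstein zero-dimensional subscheme of `ℙ³`: its ideal has a
graded minimal free resolution of length 3 whose last free module has rank one. -/
def IsAGPointsIdeal (I : Ideal (R4 k)) : Prop :=
  IsZeroDimIdeal k I ∧
  ∃ (n1 n2 : ℕ) (d1 : Fin n1 → ℕ) (d2 : Fin n2 → ℕ) (s : ℕ),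
    HasMinFreeRes3 k ⊥ I d1 d2 (fun _ : Fin 1 => s)

/-- `V₁` and `V₂` are directly Gorenstein linked by the arithmetically Gorenstein
scheme with ideal `IG`: `I_G ⊆ I_{V₁} ∩ I_{V₂}`, `I_G : I_{V₁} = I_{V₂}` and
`I_G : I_{V₂} = I_{V₁}`. -/
def IsGLinked (IG I1 I2 : Ideal (R4 k)) : Prop :=
  IG ≤ I1 ⊓ I2 ∧ icolon k IG I1 = I2 ∧ icolon k IG I2 = I1

/-- The divisor `G` (with ideal `IG`) on the curve `C ⊂ X` (with ideal `IC`) is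
linearly equivalent to `m·H_C - K_C`.  By adjunction on the cubic surface
(`K_X = -H`) this says `G + C|_C ∼ (m+1)·H_C` on `C`, where `C|_C` is realized as
the scheme-theoretic intersection `C ∩ C'` with any curve `C' ∼ C`, `C' ≠ C`,
chosen disjoint from `G`. -/
def EquivHminusKC (S : SmoothCubicSurface k) (IC IG : Ideal (R4 k)) (m : ℤ) : Prop :=
  ∃ IC' : Ideal (R4 k), IsCurveIdealOn k S IC' ∧ IC' ≠ IC ∧
    LinEquivOnX k S IC' IC 0 ∧
    satIdeal k (satIdeal k (IC ⊔ IC') ⊔ IG) = ⊤ ∧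
    DivOnCurveEquivH k IC (IG ⊓ satIdeal k (IC ⊔ IC')) (m + 1)

/-- A line on `X`: a smooth integral curve of degree 1, genus 0 on `X`. -/
def IsLineOn (S : SmoothCubicSurface k) (I : Ideal (R4 k)) : Prop :=
  IsSmoothCurveIdealOn k S I ∧ HasDegreeGenus k I 1 0

/-- A smooth conic on `X`: a smooth integral curve of degree 2, genus 0 on `X`. -/
def IsConicOn (S : SmoothCubicSurface k) (I : Ideal (R4 k)) : Prop :=
  IsSmoothCurveIdealOn k S I ∧ HasDegreeGenus k I 2 0

/-- A twisted cubic on `X`: a smooth integral curve of degree 3, genus 0 on `X`. -/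
def IsTwistedCubicOn (S : SmoothCubicSurface k) (I : Ideal (R4 k)) : Prop :=
  IsSmoothCurveIdealOn k S I ∧ HasDegreeGenus k I 3 0

/-- The curve `C ⊂ X` moves in a linear system of (projective) dimension `dim`,
i.e. `h⁰(O_X(C)) = dim + 1`.  Global sections of `O_X(C)` are computed, for any
homogeneous `q ∈ I_C` of degree `s` not divisible by `f`, as the degree-`s` part of
the colon ideal `((q, f) : I_C)` modulo `(f)`. -/
def MovesInLinSysOfDim (S : SmoothCubicSurface k) (IC : Ideal (R4 k)) (dim : ℤ) : Prop :=
  ∀ (s : ℕ) (q : R4 k), q.IsHomogeneous s → q ∈ IC → q ∉ Ideal.span {S.f} →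
    (Module.finrank k ↥(homogeneousSubmodule (Fin 4) k s ⊓
        Submodule.restrictScalars k (icolon k (Ideal.span {q} ⊔ Ideal.span {S.f}) IC)) : ℤ)
      - (Module.finrank k ↥(homogeneousSubmodule (Fin 4) k s ⊓
        Submodule.restrictScalars k (icolon k (Ideal.span {q} ⊔ Ideal.span {S.f}) IC) ⊓
        Submodule.restrictScalars k (Ideal.span {S.f})) : ℤ) = dim + 1

/-- `I/(f₀)` is a maximal Cohen–Macaulay module over `R/(f₀)` (3-dimensional):
it admits a regular sequence of three positive-degree homogeneous elements. -/
def IsMCMQuotient (f0 : R4 k) (I : Ideal (R4 k)) : Prop :=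
  ∃ r₁ r₂ r₃ : R4 k,
    (∃ d : ℕ, 0 < d ∧ r₁.IsHomogeneous d) ∧
    (∃ d : ℕ, 0 < d ∧ r₂.IsHomogeneous d) ∧
    (∃ d : ℕ, 0 < d ∧ r₃.IsHomogeneous d) ∧
    (∀ x ∈ I, r₁ * x ∈ Ideal.span {f0} → x ∈ Ideal.span {f0}) ∧
    (∀ x ∈ I, r₂ * x ∈ Ideal.span {r₁} * I ⊔ Ideal.span {f0} →
      x ∈ Ideal.span {r₁} * I ⊔ Ideal.span {f0}) ∧
    (∀ x ∈ I, r₃ * x ∈ Ideal.span {r₁} * I ⊔ Ideal.span {r₂} * I ⊔ Ideal.span {f0} →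
      x ∈ Ideal.span {r₁} * I ⊔ Ideal.span {r₂} * I ⊔ Ideal.span {f0}) ∧
    (∃ x ∈ I, x ∉ Ideal.span {r₁} * I ⊔ Ideal.span {r₂} * I ⊔ Ideal.span {r₃} * I
      ⊔ Ideal.span {f0})

end

section GradedPieces

variable {k : Type} [Field k]

/-- The forms of degree `z`, for an integer `z`. -/
def HZ (k : Type) [Field k] (z : ℤ) : Submodule k (R4 k) where
  carrier := {p | ∀ m, coeff m p ≠ 0 → (m.degree : ℤ) = z}
  zero_mem' := by intro m hm; simp at hm
  add_mem' := by
    intro p q hp hq m hm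
    by_cases h : coeff m p = 0
    · exact hq m (by simpa [h] using hm)
    · exact hp m h
  smul_mem' := by
    intro c p hp m hm
    apply hp m
    intro h
    simp [h] at hm

theorem mem_HZ_nat {n : ℕ} {p : R4 k} : p ∈ HZ k n ↔ p.IsHomogeneous n := by
  constructor
  · intro h m hm
    have := h m hm
    rw [Pi.one_def, ← Finsupp.degree_eq_weight_one]
    exact_mod_cast this
  · intro h m hm
    have := h hm
    rw [Pi.one_def, ← Finsupp.degree_eq_weight_one] at this
    exact_mod_cast this

theorem HZ_eq_of_nat (n : ℕ) : HZ k n = homogeneousSubmodule (Fin 4) k n := by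
  ext p
  rw [mem_HZ_nat, mem_homogeneousSubmodule]

theorem eq_zero_of_mem_HZ_neg {z : ℤ} (hz : z < 0) {p : R4 k} (hp : p ∈ HZ k z) : p = 0 := by
  ext m
  by_contra h
  have := hp m (by simpa using h)
  omega

theorem HZ_neg {z : ℤ} (hz : z < 0) : HZ k z = ⊥ := by
  rw [eq_bot_iff]
  intro p hp
  simpa using eq_zero_of_mem_HZ_neg hz hp

theorem mul_mem_HZ {z w : ℤ} {p q : R4 k} (hp : p ∈ HZ k z) (hq : q ∈ HZ k w) :
    p * q ∈ HZ k (z + w) := by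
  rcases lt_or_ge z 0 with h | h
  · simp [eq_zero_of_mem_HZ_neg h hp]
  rcases lt_or_ge w 0 with h' | h'
  · simp [eq_zero_of_mem_HZ_neg h' hq]
  obtain ⟨n, rfl⟩ := Int.eq_ofNat_of_zero_le h
  obtain ⟨m, rfl⟩ := Int.eq_ofNat_of_zero_le h'
  rw [← Nat.cast_add]
  exact mem_HZ_nat.2 ((mem_HZ_nat.1 hp).mul (mem_HZ_nat.1 hq))

theorem X_mem_HZ (i : Fin 4) : (X i : R4 k) ∈ HZ k 1 := by
  have := isHomogeneous_X k i
  exact_mod_cast (mem_HZ_nat (k := k) (n := 1)).2 this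

theorem X_mul_mem_HZ {z : ℤ} {p : R4 k} (i : Fin 4) (hp : p ∈ HZ k z) :
    X i * p ∈ HZ k (z + 1) := by
  rw [add_comm]
  exact mul_mem_HZ (X_mem_HZ i) hp

theorem X_mul_mem_HZ' {z : ℤ} {p : R4 k} (i : Fin 4) (hp : p ∈ HZ k (z - 1)) :
    X i * p ∈ HZ k z := by
  have := X_mul_mem_HZ i hp
  simpa using this

theorem C_mem_HZ (c : k) : (C c : R4 k) ∈ HZ k 0 := by
  exact_mod_cast (mem_HZ_nat (k := k) (n := 0)).2 (isHomogeneous_C _ c)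

theorem C_mul_mem_HZ {z : ℤ} {p : R4 k} (c : k) (hp : p ∈ HZ k z) : C c * p ∈ HZ k z := by
  simpa using mul_mem_HZ (C_mem_HZ c) hp

theorem mem_HZ_zero {p : R4 k} (hp : p ∈ HZ k 0) : p = C (coeff 0 p) := by
  have h := (mem_HZ_nat (k := k) (n := 0)).1 (by exact_mod_cast hp)
  have := (totalDegree_eq_zero_iff_eq_C (p := p)).1 (Nat.le_zero.1 h.totalDegree_le)
  exact this

instance HZ_finiteDimensional (z : ℤ) : FiniteDimensional k (HZ k z) := by
  rcases lt_or_ge z 0 with h | h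
  · rw [HZ_neg h]; infer_instance
  · obtain ⟨n, rfl⟩ := Int.eq_ofNat_of_zero_le h
    rw [HZ_eq_of_nat]
    exact Module.Finite.iff_fg.2 (homogeneousSubmodule_fg (Fin 4) k n)

theorem finrank_HZ (n : ℕ) : Module.finrank k (HZ k n) = (n + 3).choose 3 := by
  have hs : {d : Fin 4 →₀ ℕ | d.degree = n} =
      ((Finset.univ : Finset (Fin 4)).finsuppAntidiag n : Set (Fin 4 →₀ ℕ)) := by
    ext d
    simp [Finset.mem_finsuppAntidiag, Finsupp.degree_eq_sum]
  rw [HZ_eq_of_nat, homogeneousSubmodule_eq_finsupp_supported]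
  have h := Module.finrank_eq_nat_card_basis
    (basisRestrictSupport k {d : Fin 4 →₀ ℕ | d.degree = n})
  rw [restrictSupport] at h
  rw [h, hs, Nat.card_coe_set_eq, Set.ncard_coe_finset,
    Finset.card_finsuppAntidiag_nat_eq_choose]
  simp only [Finset.card_univ, Fintype.card_fin]
  rw [show 4 + n - 1 = n + 3 by omega]
  exact Nat.choose_symm_of_eq_add (by omega)

/-- The homogeneous component of integer degree. -/
noncomputable def cZ (k : Type) [Field k] (z : ℤ) : R4 k →ₗ[k] R4 k :=
  if 0 ≤ z then homogeneousComponent z.toNat else 0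

theorem cZ_neg {z : ℤ} (hz : z < 0) (p : R4 k) : cZ k z p = 0 := by
  simp [cZ, not_le.2 hz]

theorem cZ_nat (n : ℕ) (p : R4 k) : cZ k n p = homogeneousComponent n p := by
  simp [cZ]

theorem cZ_mem (z : ℤ) (p : R4 k) : cZ k z p ∈ HZ k z := by
  rcases lt_or_ge z 0 with h | h
  · rw [cZ_neg h]; exact zero_mem _
  · obtain ⟨n, rfl⟩ := Int.eq_ofNat_of_zero_le h
    rw [cZ_nat, mem_HZ_nat]
    exact homogeneousComponent_isHomogeneous n p

theorem cZ_of_mem {z w : ℤ} {p : R4 k} (hp : p ∈ HZ k w) :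
    cZ k z p = if z = w then p else 0 := by
  rcases lt_or_ge w 0 with h | h
  · simp [eq_zero_of_mem_HZ_neg h hp]
  obtain ⟨m, rfl⟩ := Int.eq_ofNat_of_zero_le h
  rcases lt_or_ge z 0 with h' | h'
  · rw [cZ_neg h', if_neg (by omega)]
  · obtain ⟨n, rfl⟩ := Int.eq_ofNat_of_zero_le h'
    rw [cZ_nat, homogeneousComponent_of_mem ((mem_homogeneousSubmodule m p).2 (mem_HZ_nat.1 hp))]
    by_cases hh : m = n <;> simp [hh]

theorem cZ_self {z : ℤ} {p : R4 k} (hp : p ∈ HZ k z) : cZ k z p = p := by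
  rw [cZ_of_mem hp, if_pos rfl]

theorem exists_forall_sum_cZ (p : R4 k) (e : ℕ) :
    ∃ N : ℕ, ∀ M, N ≤ M → ∑ d ∈ Finset.range M, cZ k ((d : ℤ) - e) p = p := by
  refine ⟨e + (p.totalDegree + 1), fun M hM => ?_⟩
  obtain ⟨L, rfl⟩ := Nat.exists_eq_add_of_le hM
  rw [Finset.sum_range_add, Finset.sum_range_add]
  have h1 : ∑ x ∈ Finset.range e, cZ k ((x : ℤ) - e) p = 0 :=
    Finset.sum_eq_zero fun x hx => cZ_neg (by have := Finset.mem_range.1 hx; omega) p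
  have h2 : ∑ x ∈ Finset.range (p.totalDegree + 1), cZ k (((e + x : ℕ) : ℤ) - e) p = p := by
    conv_rhs => rw [← sum_homogeneousComponent p]
    refine Finset.sum_congr rfl fun x _ => ?_
    rw [← cZ_nat]; congr 2; push_cast; ring
  have h3 : ∑ x ∈ Finset.range L,
      cZ k (((e + (p.totalDegree + 1) + x : ℕ) : ℤ) - e) p = 0 := by
    refine Finset.sum_eq_zero fun x _ => ?_
    rw [show (((e + (p.totalDegree + 1) + x : ℕ) : ℤ) - e) = ((p.totalDegree + 1 + x : ℕ) : ℤ) by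
      push_cast; ring, cZ_nat]
    exact homogeneousComponent_eq_zero _ _ (by omega)
  rw [h1, h2, h3]; simp

theorem sum_cZ (p : R4 k) : ∑ n ∈ Finset.range (p.totalDegree + 1), cZ k (n : ℤ) p = p := by
  conv_rhs => rw [← sum_homogeneousComponent p]
  exact Finset.sum_congr rfl fun x _ => cZ_nat x p

theorem cZ_mul {z e : ℤ} (q : R4 k) {p : R4 k} (hp : p ∈ HZ k e) :
    cZ k (z + e) (q * p) = cZ k z q * p := by
  rw [← sum_cZ q, Finset.sum_mul, map_sum, map_sum, Finset.sum_mul]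
  refine Finset.sum_congr rfl fun n _ => ?_
  have h := cZ_mem (k := k) n q
  rw [cZ_of_mem (mul_mem_HZ h hp), cZ_of_mem (z := z) h]
  by_cases hh : z = n
  · simp [hh]
  · rw [if_neg (by omega), if_neg hh, zero_mul]

theorem cZ_X_mul (z : ℤ) (i : Fin 4) (q : R4 k) : cZ k z (X i * q) = X i * cZ k (z - 1) q := by
  have := cZ_mul (z := z - 1) q (X_mem_HZ (k := k) i)
  rw [mul_comm, mul_comm (X i)]
  simpa using this

theorem cZ_mul' {z e : ℤ} (q : R4 k) {p : R4 k} (hp : p ∈ HZ k e) :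
    cZ k z (q * p) = cZ k (z - e) q * p := by
  rw [← cZ_mul q hp]; simp

end GradedPieces

section Koszul

variable {k : Type} [Field k]
variable {E F : Type} [AddCommGroup E] [Module (R4 k) E] [AddCommGroup F] [Module (R4 k) F]

/-- The action of a matrix of polynomials on vectors with entries in a module. -/
noncomputable def act {m n : ℕ} (D : Matrix (Fin m) (Fin n) (R4 k)) (v : Fin n → E) : Fin m → E :=
  fun i => ∑ j, D i j • v j

theorem act_sub {m n : ℕ} (D : Matrix (Fin m) (Fin n) (R4 k)) (v w : Fin n → E) :
    act D (v - w) = act D v - act D w := by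
  ext i; simp [act, smul_sub, Finset.sum_sub_distrib]

theorem act_smul {m n : ℕ} (D : Matrix (Fin m) (Fin n) (R4 k)) (r : R4 k) (v : Fin n → E) :
    act D (r • v) = r • act D v := by
  ext i; simp [act, Finset.smul_sum, smul_smul, mul_comm]

theorem act_zero {m n : ℕ} (D : Matrix (Fin m) (Fin n) (R4 k)) :
    act D (0 : Fin n → E) = 0 := by
  ext i; simp [act]

theorem act_act {l m n : ℕ} (D' : Matrix (Fin l) (Fin m) (R4 k))
    (D : Matrix (Fin m) (Fin n) (R4 k)) (v : Fin n → E) :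
    act D' (act D v) = act (D' * D) v := by
  ext i
  simp only [act, Matrix.mul_apply, Finset.smul_sum, Finset.sum_smul, smul_smul]
  rw [Finset.sum_comm]

theorem act_act_zero {l m n : ℕ} {D' : Matrix (Fin l) (Fin m) (R4 k)}
    {D : Matrix (Fin m) (Fin n) (R4 k)} (h : D' * D = 0) (v : Fin n → E) :
    act D' (act D v) = 0 := by
  rw [act_act, h]; ext i; simp [act]

theorem map_act {m n : ℕ} (D : Matrix (Fin m) (Fin n) (R4 k)) (φ : F →ₗ[R4 k] E)
    (v : Fin n → F) : (fun i => φ (act D v i)) = act D (fun j => φ (v j)) := by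
  ext i; simp [act]

/-- The entries of the matrix are linear forms. -/
def IsLin {m n : ℕ} (D : Matrix (Fin m) (Fin n) (R4 k)) : Prop := ∀ i j, D i j ∈ HZ k 1

/-- The Koszul differentials on the four variables. -/
noncomputable def KD1 (k : Type) [Field k] : Matrix (Fin 1) (Fin 4) (R4 k) :=
  !![X 0, X 1, X 2, X 3]

noncomputable def KD2 (k : Type) [Field k] : Matrix (Fin 4) (Fin 6) (R4 k) :=
  !![-X 1, -X 2, -X 3, 0, 0, 0;
     X 0, 0, 0, -X 2, -X 3, 0;
     0, X 0, 0, X 1, 0, -X 3;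
     0, 0, X 0, 0, X 1, X 2]

noncomputable def KD3 (k : Type) [Field k] : Matrix (Fin 6) (Fin 4) (R4 k) :=
  !![0, 0, X 3, -X 2;
     0, -X 3, 0, X 1;
     0, X 2, -X 1, 0;
     X 3, 0, 0, -X 0;
     -X 2, 0, X 0, 0;
     X 1, -X 0, 0, 0]

noncomputable def KD4 (k : Type) [Field k] : Matrix (Fin 4) (Fin 1) (R4 k) :=
  !![X 0; X 1; X 2; X 3]

def KD0 (k : Type) [Field k] : Matrix (Fin 0) (Fin 1) (R4 k) := fun i => i.elim0

def KD5 (k : Type) [Field k] : Matrix (Fin 1) (Fin 0) (R4 k) := fun _ j => j.elim0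

theorem isLin_KD1 : IsLin (KD1 k) := by
  intro i j
  fin_cases i; fin_cases j <;> simp [KD1, X_mem_HZ]

theorem isLin_KD2 : IsLin (KD2 k) := by
  intro i j
  fin_cases i <;> fin_cases j <;> simp [KD2, X_mem_HZ]

theorem isLin_KD3 : IsLin (KD3 k) := by
  intro i j
  fin_cases i <;> fin_cases j <;> simp [KD3, X_mem_HZ]

theorem isLin_KD4 : IsLin (KD4 k) := by
  intro i j
  fin_cases i <;> fin_cases j <;> simp [KD4, X_mem_HZ]

theorem isLin_KD5 : IsLin (KD5 k) := fun _ j => j.elim0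

theorem KD01 : KD0 k * KD1 k = 0 := by
  ext i; exact i.elim0

theorem KD12 : KD1 k * KD2 k = 0 := by
  ext i j : 2
  fin_cases i; fin_cases j <;>
    simp [KD1, KD2, Matrix.mul_apply, Fin.sum_univ_four] <;> ring_nf

theorem KD23 : KD2 k * KD3 k = 0 := by
  ext i j : 2
  fin_cases i <;> fin_cases j <;>
    simp [KD2, KD3, Matrix.mul_apply, Fin.sum_univ_six] <;> ring_nf

theorem KD34 : KD3 k * KD4 k = 0 := by
  ext i j : 2
  fin_cases i <;> fin_cases j <;>
    simp [KD3, KD4, Matrix.mul_apply, Fin.sum_univ_four] <;> ring_nf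

theorem KD45 : KD4 k * KD5 k = 0 := by
  ext i j; exact j.elim0

theorem act_KD1 (v : Fin 4 → E) :
    act (KD1 k) v = ![(X 0 : R4 k) • v 0 + (X 1 : R4 k) • v 1 + (X 2 : R4 k) • v 2
      + (X 3 : R4 k) • v 3] := by
  ext i
  fin_cases i
  simp [act, KD1, Fin.sum_univ_four]

theorem act_KD1_apply (v : Fin 4 → E) (i : Fin 1) :
    act (KD1 k) v i = ∑ j, (X j : R4 k) • v j := by
  fin_cases i
  simp [act_KD1, Fin.sum_univ_four]

theorem act_KD2 (p : Fin 6 → E) :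
    act (KD2 k) p = ![-((X 1 : R4 k) • p 0 + (X 2 : R4 k) • p 1 + (X 3 : R4 k) • p 2),
      (X 0 : R4 k) • p 0 - (X 2 : R4 k) • p 3 - (X 3 : R4 k) • p 4,
      (X 0 : R4 k) • p 1 + (X 1 : R4 k) • p 3 - (X 3 : R4 k) • p 5,
      (X 0 : R4 k) • p 2 + (X 1 : R4 k) • p 4 + (X 2 : R4 k) • p 5] := by
  ext i
  fin_cases i <;> simp [act, KD2, Fin.sum_univ_six] <;> abel

theorem act_KD3 (h : Fin 4 → E) :
    act (KD3 k) h = ![(X 3 : R4 k) • h 2 - (X 2 : R4 k) • h 3,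
      (X 1 : R4 k) • h 3 - (X 3 : R4 k) • h 1,
      (X 2 : R4 k) • h 1 - (X 1 : R4 k) • h 2,
      (X 3 : R4 k) • h 0 - (X 0 : R4 k) • h 3,
      (X 0 : R4 k) • h 2 - (X 2 : R4 k) • h 0,
      (X 1 : R4 k) • h 0 - (X 0 : R4 k) • h 1] := by
  ext i
  fin_cases i <;> simp [act, KD3, Fin.sum_univ_four] <;> abel

theorem act_KD4_apply (e : Fin 1 → E) (i : Fin 4) :
    act (KD4 k) e i = (X i : R4 k) • e 0 := by
  fin_cases i <;> simp [act, KD4]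

theorem act_KD3_eq_zero_iff (h : Fin 4 → E) :
    act (KD3 k) h = 0 ↔ ∀ i j, (X i : R4 k) • h j = (X j : R4 k) • h i := by
  rw [act_KD3]
  constructor
  · intro H
    have H0 := congrFun H 0
    have H1 := congrFun H 1
    have H2 := congrFun H 2
    have H3 := congrFun H 3
    have H4 := congrFun H 4
    have H5 := congrFun H 5
    simp [sub_eq_zero] at H0 H1 H2 H3 H4 H5
    intro i j
    fin_cases i <;> fin_cases j <;> simp [H0, H1, H2, H3, H4, H5]
  · intro H
    ext i
    fin_cases i <;> simp [H 3 2, H 1 3, H 2 1, H 3 0, H 0 2, H 1 0]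

variable [Module k E] [Module k F]

/-- The graded pieces are compatible with multiplication by linear forms. -/
def IsGr (𝓜 : ℤ → Submodule k E) : Prop :=
  ∀ (d : ℤ) (r : R4 k) (x : E), r ∈ HZ k 1 → x ∈ 𝓜 d → r • x ∈ 𝓜 (d + 1)

theorem act_mem {m n : ℕ} {D : Matrix (Fin m) (Fin n) (R4 k)} (hD : IsLin D)
    {𝓜 : ℤ → Submodule k E} (h𝓜 : IsGr 𝓜) {d : ℤ} {v : Fin n → E} (hv : ∀ j, v j ∈ 𝓜 d)
    (i : Fin m) : act D v i ∈ 𝓜 (d + 1) :=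
  sum_mem fun j _ => h𝓜 d _ _ (hD i j) (hv j)

theorem act_mem' {m n : ℕ} {D : Matrix (Fin m) (Fin n) (R4 k)} (hD : IsLin D)
    {𝓜 : ℤ → Submodule k E} (h𝓜 : IsGr 𝓜) {d : ℤ} {v : Fin n → E}
    (hv : ∀ j, v j ∈ 𝓜 (d - 1)) (i : Fin m) : act D v i ∈ 𝓜 d := by
  have := act_mem hD h𝓜 hv i
  simpa using this

/-- Exactness in degree `d` of a two-step complex with linear differentials. -/
def Ex {l m n : ℕ} (D' : Matrix (Fin l) (Fin m) (R4 k)) (D : Matrix (Fin m) (Fin n) (R4 k))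
    (𝓜 : ℤ → Submodule k E) (d : ℤ) : Prop :=
  ∀ v : Fin m → E, (∀ j, v j ∈ 𝓜 d) → act D' v = 0 →
    ∃ u : Fin n → E, (∀ j, u j ∈ 𝓜 (d - 1)) ∧ act D u = v

theorem Ex.of_bot {l m n : ℕ} {D' : Matrix (Fin l) (Fin m) (R4 k)}
    {D : Matrix (Fin m) (Fin n) (R4 k)} {𝓜 : ℤ → Submodule k E} {d : ℤ} (h : 𝓜 d = ⊥) :
    Ex D' D 𝓜 d := by
  intro v hv _
  refine ⟨0, fun j => zero_mem _, ?_⟩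
  rw [act_zero]
  ext j
  have := hv j
  rw [h, Submodule.mem_bot] at this
  exact this.symm

/-- A degreewise short exact sequence `0 → 𝓝 → 𝓕 → 𝓜 → 0`. -/
structure SES (𝓝 𝓕 : ℤ → Submodule k F) (𝓜 : ℤ → Submodule k E) (φ : F →ₗ[R4 k] E) : Prop where
  grF : IsGr 𝓕
  surj : ∀ d, ∀ m ∈ 𝓜 d, ∃ w ∈ 𝓕 d, φ w = m
  maps : ∀ d, ∀ w ∈ 𝓕 d, φ w ∈ 𝓜 d
  ker : ∀ d w, w ∈ 𝓝 d ↔ w ∈ 𝓕 d ∧ φ w = 0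

theorem SES.ex_sub {𝓝 𝓕 : ℤ → Submodule k F} {𝓜 : ℤ → Submodule k E} {φ : F →ₗ[R4 k] E}
    (H : SES 𝓝 𝓕 𝓜 φ) {l m n q : ℕ} {D1 : Matrix (Fin l) (Fin m) (R4 k)}
    {D2 : Matrix (Fin m) (Fin n) (R4 k)} {D3 : Matrix (Fin n) (Fin q) (R4 k)}
    (h23 : D2 * D3 = 0) (hD3 : IsLin D3) {d : ℤ}
    (h1 : Ex D1 D2 𝓕 d) (h2 : Ex D2 D3 𝓜 (d - 1)) : Ex D1 D2 𝓝 d := by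
  intro v hv hv0
  obtain ⟨u, hu, rfl⟩ := h1 v (fun j => ((H.ker _ _).1 (hv j)).1) hv0
  obtain ⟨w', hw', hw'2⟩ := h2 (fun j => φ (u j)) (fun j => H.maps _ _ (hu j)) (by
    rw [← map_act]; ext j; exact ((H.ker _ _).1 (hv j)).2)
  choose w hw hw2 using fun j => H.surj _ _ (hw' j)
  have hφ : (fun j => φ (act D3 w j)) = fun j => φ (u j) := by
    rw [map_act, ← hw'2]; congr 1; ext j; exact hw2 j
  refine ⟨u - act D3 w, fun j => (H.ker _ _).2 ⟨sub_mem (hu j) (act_mem' hD3 H.grF hw j), ?_⟩, ?_⟩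
  · have := congrFun hφ j
    simp [this]
  · rw [act_sub, act_act_zero h23, sub_zero]

theorem SES.ex_quot {𝓝 𝓕 : ℤ → Submodule k F} {𝓜 : ℤ → Submodule k E} {φ : F →ₗ[R4 k] E}
    (H : SES 𝓝 𝓕 𝓜 φ) {l m n q : ℕ} {D1 : Matrix (Fin l) (Fin m) (R4 k)}
    {D2 : Matrix (Fin m) (Fin n) (R4 k)} {D3 : Matrix (Fin n) (Fin q) (R4 k)}
    (h12 : D1 * D2 = 0) (hD2 : IsLin D2) {d : ℤ}
    (h1 : Ex D2 D3 𝓕 d) (h2 : Ex D1 D2 𝓝 (d + 1)) : Ex D2 D3 𝓜 d := by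
  intro v hv hv0
  choose w hw hw2 using fun j => H.surj _ _ (hv j)
  obtain ⟨u, hu, hu2⟩ := h2 (act D2 w) (fun j => (H.ker _ _).2 ⟨act_mem hD2 H.grF hw j, by
    have := congrFun (map_act D2 φ w) j
    rw [this, funext hw2]
    exact congrFun hv0 j⟩) (act_act_zero h12 w)
  simp only [add_sub_cancel_right] at hu
  obtain ⟨y, hy, hy2⟩ := h1 (w - u) (fun j => sub_mem (hw j) ((H.ker _ _).1 (hu j)).1) (by
    rw [act_sub, hu2, sub_self])
  refine ⟨fun j => φ (y j), fun j => H.maps _ _ (hy j), ?_⟩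
  rw [← map_act, hy2]
  ext j
  simp [hw2, ((H.ker _ _).1 (hu j)).2]

end Koszul

section KoszulPolynomial

variable {k : Type} [Field k]

theorem X_ne_zero' (i : Fin 4) : (X i : R4 k) ≠ 0 := X_ne_zero i

theorem X_mul_cancel {i : Fin 4} {p q : R4 k} (h : X i * p = X i * q) : p = q :=
  mul_left_cancel₀ (X_ne_zero i) h

theorem X_dvd_of_mul {i j : Fin 4} (hij : i ≠ j) {p : R4 k} (h : (X i : R4 k) ∣ X j * p) :
    (X i : R4 k) ∣ p := by
  rcases (X_prime (R := k) (i := i)).dvd_or_dvd h with h | h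
  · exact absurd (X_dvd_X.1 h) (by simpa using hij)
  · exact h

theorem mem_span_X_of_mul {s : Set (Fin 4)} {j : Fin 4} (hj : j ∉ s) {p : R4 k}
    (h : X j * p ∈ Ideal.span (X '' s : Set (R4 k))) : p ∈ Ideal.span (X '' s : Set (R4 k)) := by
  rw [mem_ideal_span_X_image] at h ⊢
  intro m hm
  obtain ⟨i, hi, hi'⟩ := h (Finsupp.single j 1 + m) (by
    rw [mem_support_iff, add_comm, mul_comm, coeff_mul_X]
    exact mem_support_iff.1 hm)
  refine ⟨i, hi, ?_⟩
  have : j ≠ i := fun h => hj (h ▸ hi)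
  simpa [Finsupp.single_apply, this] using hi'

theorem koszul_two {i j : Fin 4} (hij : i ≠ j) {a b : R4 k} (h : X i * a + X j * b = 0) :
    ∃ c, a = X j * c ∧ b = -(X i * c) := by
  obtain ⟨c, rfl⟩ : (X j : R4 k) ∣ a := X_dvd_of_mul hij.symm ⟨-b, by linear_combination h⟩
  refine ⟨c, rfl, X_mul_cancel (i := j) ?_⟩
  linear_combination h

theorem mem_span_X_pair {i j : Fin 4} {p : R4 k} :
    p ∈ Ideal.span (X '' {i, j} : Set (R4 k)) ↔ ∃ a b, p = X i * a + X j * b := by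
  rw [Set.image_pair, Ideal.mem_span_pair]
  constructor
  · rintro ⟨a, b, h⟩; exact ⟨a, b, by rw [← h]; ring⟩
  · rintro ⟨a, b, h⟩; exact ⟨a, b, by rw [h]; ring⟩

theorem mem_span_X_triple {i j l : Fin 4} {p : R4 k} :
    p ∈ Ideal.span (X '' {i, j, l} : Set (R4 k)) ↔
      ∃ a b c, p = X i * a + X j * b + X l * c := by
  rw [Set.image_insert_eq, Ideal.mem_span_insert]
  simp only [mem_span_X_pair]
  constructor
  · rintro ⟨a, z, ⟨b, c, rfl⟩, h⟩; exact ⟨a, b, c, by rw [h]; ring⟩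
  · rintro ⟨a, b, c, h⟩; exact ⟨a, _, ⟨b, c, rfl⟩, by rw [h]; ring⟩

/-- Exactness of the Koszul complex on three variables. -/
theorem koszul_three {i j l : Fin 4} (hij : i ≠ j) (hil : i ≠ l) (hjl : j ≠ l) {a b c : R4 k}
    (h : X i * a + X j * b + X l * c = 0) :
    ∃ p q r, a = X l * q - X j * r ∧ b = X i * r - X l * p ∧ c = X j * p - X i * q := by
  obtain ⟨s, t, rfl⟩ := mem_span_X_pair.1 (mem_span_X_of_mul (s := {i, j}) (j := l) (p := c)
    (by simp [hil.symm, hjl.symm])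
    (mem_span_X_pair.2 ⟨-a, -b, by linear_combination h⟩))
  obtain ⟨r, hr1, hr2⟩ := koszul_two (a := a + X l * s) (b := b + X l * t) hij
    (by linear_combination h)
  exact ⟨t, -s, -r, by linear_combination hr1, by linear_combination hr2, by ring⟩

theorem ker_KD1 {v : Fin 4 → R4 k} (h : act (KD1 k) v = 0) :
    ∃ u : Fin 6 → R4 k, act (KD2 k) u = v := by
  have h0 := congrFun h 0
  rw [act_KD1] at h0
  simp only [smul_eq_mul, Matrix.cons_val_zero, Pi.zero_apply] at h0
  obtain ⟨a, b, c, habc⟩ := mem_span_X_triple.1 (mem_span_X_of_mul (s := {0, 1, 2}) (j := 3)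
    (p := v 3) (by decide)
    (mem_span_X_triple.2 ⟨-v 0, -v 1, -v 2, by linear_combination h0⟩))
  obtain ⟨p, q, r, hp, hq, hr⟩ := koszul_three (i := 0) (j := 1) (l := 2) (a := v 0 + X 3 * a)
    (b := v 1 + X 3 * b) (c := v 2 + X 3 * c) (by decide) (by decide) (by decide)
    (by rw [habc] at h0; linear_combination h0)
  refine ⟨![r, -q, a, p, b, c], ?_⟩
  rw [act_KD2]
  ext i : 1
  fin_cases i
  · simp; linear_combination -hp
  · simp; linear_combination -hq
  · simp; linear_combination -hr
  · simp; linear_combination -habc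

theorem ker_KD2 {p : Fin 6 → R4 k} (h : act (KD2 k) p = 0) :
    ∃ u : Fin 4 → R4 k, act (KD3 k) u = p := by
  rw [act_KD2] at h
  have e0 : -(X 1 * p 0 + X 2 * p 1 + X 3 * p 2) = 0 := congrFun h 0
  have e1 : X 0 * p 0 - X 2 * p 3 - X 3 * p 4 = 0 := congrFun h 1
  have e2 : X 0 * p 1 + X 1 * p 3 - X 3 * p 5 = 0 := congrFun h 2
  obtain ⟨h1, h2, h3, g0, g1, g2⟩ := koszul_three (i := 1) (j := 2) (l := 3) (a := p 0)
    (b := p 1) (c := p 2) (by decide) (by decide) (by decide) (by linear_combination -e0)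
  obtain ⟨h0, g3, g4⟩ := koszul_two (i := 2) (j := 3) (a := p 3 + X 0 * h3)
    (b := p 4 - X 0 * h2) (by decide) (by rw [g0] at e1; linear_combination -e1)
  have g5 : p 5 = X 1 * h0 - X 0 * h1 := by
    refine X_mul_cancel (i := 3) ?_
    rw [g1] at e2
    linear_combination -e2 + X 1 * g3
  refine ⟨![h0, h1, h2, h3], ?_⟩
  rw [act_KD3]
  ext i : 1
  fin_cases i
  · simp; linear_combination -g0
  · simp; linear_combination -g1
  · simp; linear_combination -g2
  · simp; linear_combination -g3
  · simp; linear_combination -g4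
  · simp; linear_combination -g5

theorem ker_KD3 {h : Fin 4 → R4 k} (hh : act (KD3 k) h = 0) :
    ∃ u : Fin 1 → R4 k, act (KD4 k) u = h := by
  rw [act_KD3_eq_zero_iff] at hh
  obtain ⟨e, he⟩ : (X 0 : R4 k) ∣ h 0 :=
    X_dvd_of_mul (j := 1) (by decide) ⟨h 1, (hh 1 0)⟩
  refine ⟨fun _ => e, ?_⟩
  ext i : 1
  rw [act_KD4_apply]
  refine X_mul_cancel (i := 0) ?_
  have := hh 0 i
  simp only [smul_eq_mul] at this ⊢
  rw [this, he]; ring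

theorem isGr_HZ : IsGr (HZ k) := by
  intro d r x hr hx
  rw [add_comm]
  exact mul_mem_HZ hr hx

theorem cZ_act {m n : ℕ} {D : Matrix (Fin m) (Fin n) (R4 k)} (hD : IsLin D) (d : ℤ)
    (v : Fin n → R4 k) (i : Fin m) :
    cZ k d (act D v i) = act D (fun j => cZ k (d - 1) (v j)) i := by
  simp only [act, map_sum, smul_eq_mul]
  refine Finset.sum_congr rfl fun j _ => ?_
  rw [mul_comm, cZ_mul' _ (hD i j), mul_comm]

theorem ex_HZ_of_ker {l m n : ℕ} {D' : Matrix (Fin l) (Fin m) (R4 k)}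
    {D : Matrix (Fin m) (Fin n) (R4 k)} (hD : IsLin D)
    (h : ∀ v : Fin m → R4 k, act D' v = 0 → ∃ u, act D u = v) (d : ℤ) : Ex D' D (HZ k) d := by
  intro v hv hv0
  obtain ⟨u, rfl⟩ := h v hv0
  refine ⟨fun j => cZ k (d - 1) (u j), fun j => cZ_mem _ _, ?_⟩
  ext i : 1
  rw [← cZ_act hD, cZ_self (hv i)]

theorem ex1_HZ (d : ℤ) : Ex (KD1 k) (KD2 k) (HZ k) d := ex_HZ_of_ker isLin_KD2 (fun _ => ker_KD1) d

theorem ex2_HZ (d : ℤ) : Ex (KD2 k) (KD3 k) (HZ k) d := ex_HZ_of_ker isLin_KD3 (fun _ => ker_KD2) d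

theorem ex3_HZ (d : ℤ) : Ex (KD3 k) (KD4 k) (HZ k) d := ex_HZ_of_ker isLin_KD4 (fun _ => ker_KD3) d

/-- A form of nonzero degree is a combination of the variables. -/
theorem exists_sum_X_mul {d : ℤ} (hd : d ≠ 0) {p : R4 k} (hp : p ∈ HZ k d) :
    ∃ u : Fin 4 → R4 k, (∀ i, u i ∈ HZ k (d - 1)) ∧ ∑ i, X i * u i = p := by
  have hmem : p ∈ Ideal.span (Set.range (X : Fin 4 → R4 k)) := by
    rw [← Set.image_univ, mem_ideal_span_X_image]
    intro m hm
    have := hp m (mem_support_iff.1 hm)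
    by_contra hcon
    push Not at hcon
    apply hd
    rw [← this]
    have : m = 0 := by ext i; simpa using hcon i (Set.mem_univ i)
    simp [this]
  obtain ⟨c, hc⟩ := (Ideal.mem_span_range_iff_exists_fun).1 hmem
  refine ⟨fun i => cZ k (d - 1) (c i), fun i => cZ_mem _ _, ?_⟩
  rw [← cZ_self hp, ← hc, map_sum]
  refine Finset.sum_congr rfl fun i _ => ?_
  rw [cZ_mul' _ (X_mem_HZ i), mul_comm]

theorem ex0_HZ {d : ℤ} (hd : d ≠ 0) : Ex (KD0 k) (KD1 k) (HZ k) d := by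
  intro v hv _
  obtain ⟨u, hu, hu2⟩ := exists_sum_X_mul hd (hv 0)
  refine ⟨u, hu, ?_⟩
  ext i : 1
  rw [act_KD1_apply, Subsingleton.elim i 0, ← hu2]
  rfl

end KoszulPolynomial

section KoszulFree

variable {k : Type} [Field k]

/-- The graded pieces of a graded free module with generators in degrees `e`. -/
noncomputable def HF {n : ℕ} (k : Type) [Field k] (e : Fin n → ℕ) (d : ℤ) : Submodule k (Fin n → R4 k) :=
  Submodule.pi Set.univ fun j => HZ k (d - e j)

theorem mem_HF {n : ℕ} {e : Fin n → ℕ} {d : ℤ} {w : Fin n → R4 k} :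
    w ∈ HF k e d ↔ ∀ j, w j ∈ HZ k (d - e j) := by
  simp [HF, Submodule.mem_pi]

theorem isGr_HF {n : ℕ} (e : Fin n → ℕ) : IsGr (HF k e) := by
  intro d r x hr hx
  rw [mem_HF] at hx ⊢
  intro j
  have := mul_mem_HZ hr (hx j)
  rw [Pi.smul_apply, smul_eq_mul]
  convert this using 1
  congr 1; ring

theorem act_apply_fun {N m n : ℕ} (D : Matrix (Fin m) (Fin n) (R4 k))
    (v : Fin n → Fin N → R4 k) (i : Fin m) (j : Fin N) :
    act D v i j = act D (fun l => v l j) i := by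
  simp [act]

theorem ex_HF {N l m n : ℕ} {e : Fin N → ℕ} {D' : Matrix (Fin l) (Fin m) (R4 k)}
    {D : Matrix (Fin m) (Fin n) (R4 k)} {d : ℤ} (h : ∀ j, Ex D' D (HZ k) (d - e j)) :
    Ex D' D (HF k e) d := by
  intro v hv hv0
  have := fun j => h j (fun l => v l j) (fun l => mem_HF.1 (hv l) j) (by
    ext i : 1
    rw [← act_apply_fun, hv0]; rfl)
  choose u hu hu2 using this
  refine ⟨fun l j => u j l, fun l => mem_HF.2 fun j => ?_, ?_⟩
  · have := hu j l
    rwa [show d - 1 - (e j : ℤ) = d - e j - 1 by ring]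
  · ext i j : 2
    rw [act_apply_fun]
    exact congrFun (hu2 j) i

end KoszulFree

section CoordinateRing

variable {k : Type} [Field k]

/-- The homogeneous coordinate ring `R/(f)`. -/
abbrev SX (f : R4 k) : Type := R4 k ⧸ Ideal.span {f}

/-- The quotient map as an `R`-linear map. -/
noncomputable def mkS (f : R4 k) : R4 k →ₗ[R4 k] SX f := (Ideal.span {f}).mkQ

theorem mkS_eq_zero {f p : R4 k} : mkS f p = 0 ↔ p ∈ Ideal.span {f} :=
  Ideal.Quotient.eq_zero_iff_mem

theorem mkS_eq_mkS {f p q : R4 k} : mkS f p = mkS f q ↔ p - q ∈ Ideal.span {f} := by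
  rw [← mkS_eq_zero, map_sub, sub_eq_zero]

theorem mkS_mul {f p q : R4 k} : mkS f (p * q) = p • mkS f q := by
  rw [← smul_eq_mul, map_smul]

theorem mkS_surjective (f : R4 k) : Function.Surjective (mkS f) := Submodule.mkQ_surjective _

/-- The graded pieces of the coordinate ring. -/
noncomputable def gr (f : R4 k) (d : ℤ) : Submodule k (SX f) :=
  (HZ k d).map ((mkS f).restrictScalars k)

theorem mem_gr {f : R4 k} {d : ℤ} {s : SX f} : s ∈ gr f d ↔ ∃ p ∈ HZ k d, mkS f p = s := Iff.rfl

theorem mkS_mem_gr {f : R4 k} {d : ℤ} {p : R4 k} (hp : p ∈ HZ k d) : mkS f p ∈ gr f d :=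
  ⟨p, hp, rfl⟩

theorem isGr_gr (f : R4 k) : IsGr (gr f) := by
  rintro d r _ hr ⟨p, hp, rfl⟩
  exact ⟨r * p, isGr_HZ d r p hr hp, mkS_mul⟩

instance gr_finiteDimensional (f : R4 k) (d : ℤ) : FiniteDimensional k (gr f d) := by
  unfold gr; infer_instance

/-- The graded pieces of the ideal of the cubic. -/
noncomputable def Jd (f : R4 k) (d : ℤ) : Submodule k (R4 k) :=
  HZ k d ⊓ LinearMap.ker ((mkS f).restrictScalars k)

variable {f : R4 k} (hf : f ∈ HZ k 3) (hf0 : f ≠ 0)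

theorem ses_S (f : R4 k) : SES (Jd f) (HZ k) (gr f) (mkS f) where
  grF := isGr_HZ
  surj := fun _ _ h => h
  maps := fun _ _ h => mkS_mem_gr h
  ker := fun _ _ => Iff.rfl

include hf in
theorem cZ_mem_span {p : R4 k} (hp : p ∈ Ideal.span {f}) (d : ℤ) :
    cZ k d p ∈ Ideal.span {f} := by
  obtain ⟨q, rfl⟩ := Ideal.mem_span_singleton'.1 hp
  rw [cZ_mul' _ hf]
  exact Ideal.mul_mem_left _ _ (Ideal.mem_span_singleton_self f)

include hf in
theorem exists_of_mem_span {p : R4 k} {d : ℤ} (hp : p ∈ HZ k d) (h : p ∈ Ideal.span {f}) :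
    ∃ q ∈ HZ k (d - 3), p = f * q := by
  obtain ⟨q, rfl⟩ := Ideal.mem_span_singleton'.1 h
  refine ⟨cZ k (d - 3) q, cZ_mem _ _, ?_⟩
  rw [mul_comm f, ← cZ_mul' _ hf, cZ_self hp]

include hf in
theorem mem_span_eq_zero_of_lt {p : R4 k} {d : ℤ} (hd : d < 3) (hp : p ∈ HZ k d)
    (h : p ∈ Ideal.span {f}) : p = 0 := by
  obtain ⟨q, hq, rfl⟩ := exists_of_mem_span hf hp h
  rw [eq_zero_of_mem_HZ_neg (by omega) hq, mul_zero]

include hf hf0 in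
theorem ex_Jd {l m n : ℕ} {D' : Matrix (Fin l) (Fin m) (R4 k)}
    {D : Matrix (Fin m) (Fin n) (R4 k)} {d : ℤ} (h : Ex D' D (HZ k) (d - 3)) :
    Ex D' D (Jd f) d := by
  intro v hv hv0
  choose w hw hw2 using fun j => exists_of_mem_span hf (hv j).1 (mkS_eq_zero.1 (hv j).2)
  obtain rfl : v = f • w := funext hw2
  rw [act_smul] at hv0
  obtain ⟨u, hu, rfl⟩ := h w hw (by
    ext i : 1
    have := congrFun hv0 i
    simpa [hf0] using this)
  refine ⟨f • u, fun j => ⟨?_, ?_⟩, act_smul _ _ _⟩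
  · have := mul_mem_HZ hf (hu j)
    rw [Pi.smul_apply, smul_eq_mul]
    rwa [show (3 : ℤ) + (d - 3 - 1) = d - 1 by ring] at this
  · exact mkS_eq_zero.2 (Ideal.mul_mem_right _ _ (Ideal.mem_span_singleton_self f))

include hf hf0 in
theorem ex1_gr {d : ℤ} (hd : d ≠ 2) : Ex (KD1 k) (KD2 k) (gr f) d :=
  (ses_S f).ex_quot KD01 isLin_KD1 (ex1_HZ d) (ex_Jd hf hf0 (ex0_HZ (by omega)))

include hf hf0 in
theorem ex2_gr (d : ℤ) : Ex (KD2 k) (KD3 k) (gr f) d :=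
  (ses_S f).ex_quot KD12 isLin_KD2 (ex2_HZ d) (ex_Jd hf hf0 (ex1_HZ _))

include hf hf0 in
theorem ex3_gr (d : ℤ) : Ex (KD3 k) (KD4 k) (gr f) d :=
  (ses_S f).ex_quot KD23 isLin_KD3 (ex3_HZ d) (ex_Jd hf hf0 (ex2_HZ _))

theorem ex0_gr {d : ℤ} (hd : d ≠ 0) : Ex (KD0 k) (KD1 k) (gr f) d := by
  intro v hv _
  obtain ⟨p, hp, hp2⟩ := hv 0
  obtain ⟨u, hu, hu2⟩ := exists_sum_X_mul hd hp
  refine ⟨fun i => mkS f (u i), fun i => mkS_mem_gr (hu i), ?_⟩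
  ext i : 1
  rw [act_KD1_apply, Subsingleton.elim i 0, ← hp2, ← hu2]
  simp [mkS_mul]

/-- The Hilbert function of the cubic surface. -/
def Hs (d : ℕ) : ℕ := 3 * (d * (d + 1) / 2) + 1

theorem two_mul_Hs (d : ℕ) : 2 * Hs d = 3 * (d * (d + 1)) + 2 := by
  have : 2 ∣ d * (d + 1) := (Nat.even_mul_succ_self d).two_dvd
  unfold Hs
  omega

include hf hf0 in
theorem finrank_Jd (d : ℤ) :
    Module.finrank k (Jd f d) = Module.finrank k (HZ k (d - 3)) := by
  have : Jd f d = (HZ k (d - 3)).map (LinearMap.mulLeft k f) := by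
    ext p
    constructor
    · rintro ⟨h1, h2⟩
      obtain ⟨q, hq, rfl⟩ := exists_of_mem_span hf h1 (mkS_eq_zero.1 h2)
      exact ⟨q, hq, rfl⟩
    · rintro ⟨q, hq, rfl⟩
      refine ⟨?_, mkS_eq_zero.2 (Ideal.mul_mem_right _ _ (Ideal.mem_span_singleton_self f))⟩
      have := mul_mem_HZ hf hq
      simpa using this
  rw [this]
  refine (LinearEquiv.finrank_eq (Submodule.equivMapOfInjective _ ?_ _)).symm
  intro a b hab
  exact mul_left_cancel₀ hf0 hab

theorem choose_three (n : ℕ) : 6 * (n + 3).choose 3 = (n + 1) * (n + 2) * (n + 3) := by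
  induction n with
  | zero => rfl
  | succ n ih =>
    have h2 : 2 * (n + 3).choose 2 = (n + 2) * (n + 3) := by
      rw [Nat.choose_two_right]
      have : 2 ∣ (n + 3) * (n + 3 - 1) := by
        rw [mul_comm]; exact (Nat.even_mul_succ_self (n + 2)).two_dvd
      rw [Nat.mul_div_cancel' this]
      simp; ring
    rw [show n + 1 + 3 = (n + 3) + 1 by ring, Nat.choose_succ_succ]
    nlinarith

include hf hf0 in
theorem finrank_gr (d : ℕ) : Module.finrank k (gr f d) = Hs d := by
  have h := LinearMap.finrank_range_add_finrank_ker
    (((mkS f).restrictScalars k).domRestrict (HZ k d))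
  have h1 : LinearMap.range (((mkS f).restrictScalars k).domRestrict (HZ k d)) = gr f d := by
    rw [LinearMap.range_domRestrict]; rfl
  have h2 : Module.finrank k (LinearMap.ker (((mkS f).restrictScalars k).domRestrict (HZ k d)))
      = Module.finrank k (Jd f d) := by
    rw [LinearMap.ker_domRestrict]
    have : Jd f d = ((LinearMap.ker ((mkS f).restrictScalars k)).comap (HZ k d).subtype).map
      (HZ k d).subtype := by
      rw [Submodule.map_comap_subtype]; rfl
    rw [this]
    exact (LinearEquiv.finrank_eq (Submodule.equivMapOfInjective _
      (Submodule.injective_subtype _) _))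
  rw [h1, h2, finrank_Jd hf hf0, finrank_HZ] at h
  have key := two_mul_Hs d
  have c1 := choose_three d
  rcases Nat.lt_or_ge d 3 with hd | hd
  · rw [HZ_neg (by omega), finrank_bot] at h
    interval_cases d <;> simp [Nat.choose] at h <;> simp [Hs, h]
  · obtain ⟨n, rfl⟩ := Nat.exists_eq_add_of_le hd
    rw [show ((3 + n : ℕ) : ℤ) - 3 = (n : ℕ) by push_cast; ring, finrank_HZ] at h
    have c2 := choose_three n
    zify at h key c1 c2 ⊢
    have : (6 : ℤ) * (Module.finrank k (gr f ((3 + n : ℕ) : ℤ)) : ℤ) = 6 * Hs (3 + n) := by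
      push_cast at *
      linear_combination 6 * h - 3 * key + c1 - c2
    linarith

end CoordinateRing

section Resolution

variable {k : Type} [Field k]
variable {E : Type} [AddCommGroup E] [Module (R4 k) E] [Module k E]

/-- Elements of a subspace representing a basis of a quotient by a smaller subspace. -/
theorem exists_complement_basis {V : Type} [AddCommGroup V] [Module k V] {W U : Submodule k V}
    [FiniteDimensional k U] (hWU : W ≤ U) {n : ℕ}
    (h : Module.finrank k U = Module.finrank k W + n) :
    ∃ m : Fin n → V, (∀ j, m j ∈ U) ∧
      ∀ x ∈ U, ∃ c : Fin n → k, x - ∑ j, c j • m j ∈ W := by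
  have hW' : Module.finrank k (W.comap U.subtype) = Module.finrank k W :=
    (Submodule.comapSubtypeEquivOfLe hWU).finrank_eq
  have hq : Module.finrank k (U ⧸ W.comap U.subtype) = n := by
    have := Submodule.finrank_quotient_add_finrank (W.comap U.subtype)
    omega
  let b := Module.finBasisOfFinrankEq k _ hq
  choose m hm using fun j => Submodule.mkQ_surjective (W.comap U.subtype) (b j)
  refine ⟨fun j => m j, fun j => (m j).2, fun x hx => ?_⟩
  refine ⟨fun j => b.repr (Submodule.Quotient.mk ⟨x, hx⟩) j, ?_⟩
  have : (⟨x, hx⟩ : U) - ∑ j, b.repr (Submodule.Quotient.mk ⟨x, hx⟩) j • m j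
      ∈ W.comap U.subtype := by
    rw [← Submodule.Quotient.mk_eq_zero, ← Submodule.mkQ_apply, map_sub, map_sum]
    simp only [map_smul, hm]
    rw [b.sum_repr, Submodule.mkQ_apply, sub_self]
  simpa using this

/-- The graded pieces of the kernel of a homomorphism. -/
noncomputable def kerGr {F : Type} [AddCommGroup F] [Module (R4 k) F] [Module k F]
    [IsScalarTower k (R4 k) F] [IsScalarTower k (R4 k) E] (𝓕 : ℤ → Submodule k F)
    (φ : F →ₗ[R4 k] E) (d : ℤ) : Submodule k F :=
  𝓕 d ⊓ LinearMap.ker (φ.restrictScalars k)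

variable [IsScalarTower k (R4 k) E]

theorem SES.finrank_add {F : Type} [AddCommGroup F] [Module (R4 k) F] [Module k F]
    [IsScalarTower k (R4 k) F]
    {𝓕 : ℤ → Submodule k F} {𝓜 : ℤ → Submodule k E} {φ : F →ₗ[R4 k] E}
    (H : SES (kerGr 𝓕 φ) 𝓕 𝓜 φ) (d : ℤ) [FiniteDimensional k (𝓕 d)] :
    Module.finrank k (𝓕 d) = Module.finrank k (kerGr 𝓕 φ d) + Module.finrank k (𝓜 d) := by
  have h := LinearMap.finrank_range_add_finrank_ker
    ((φ.restrictScalars k).domRestrict (𝓕 d))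
  have h1 : LinearMap.range ((φ.restrictScalars k).domRestrict (𝓕 d)) = 𝓜 d := by
    ext x
    constructor
    · rintro ⟨w, rfl⟩
      exact H.maps d _ w.2
    · intro hx
      obtain ⟨w, hw, rfl⟩ := H.surj d x hx
      exact ⟨⟨w, hw⟩, rfl⟩
  have h2 : Module.finrank k (LinearMap.ker ((φ.restrictScalars k).domRestrict (𝓕 d)))
      = Module.finrank k (kerGr 𝓕 φ d) := by
    rw [LinearMap.ker_domRestrict]
    have : kerGr 𝓕 φ d = ((LinearMap.ker (φ.restrictScalars k)).comap (𝓕 d).subtype).map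
      (𝓕 d).subtype := by
      rw [Submodule.map_comap_subtype]; rfl
    rw [this]
    exact LinearEquiv.finrank_eq (Submodule.equivMapOfInjective _
      (Submodule.injective_subtype _) _)
  rw [h1, h2] at h
  omega

/-- The homomorphism from a free module given by a family of elements. -/
noncomputable def gens {n : ℕ} (m : Fin n → E) : (Fin n → R4 k) →ₗ[R4 k] E :=
  Fintype.linearCombination (R4 k) m

omit [Module k E] [IsScalarTower k (R4 k) E] in
theorem gens_apply {n : ℕ} (m : Fin n → E) (w : Fin n → R4 k) : gens m w = ∑ j, w j • m j := rfl

/-- Graded modules in which all forms act. -/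
def IsGrAll (𝓜 : ℤ → Submodule k E) : Prop :=
  ∀ (d e : ℤ) (r : R4 k) (x : E), r ∈ HZ k e → x ∈ 𝓜 d → r • x ∈ 𝓜 (d + e)

theorem gens_ses {n : ℕ} {𝓜 : ℤ → Submodule k E} (hgr : IsGrAll 𝓜) {d₀ : ℤ}
    (h0 : ∀ d < d₀, 𝓜 d = ⊥) {e : Fin n → ℕ} {m : Fin n → E} (hm : ∀ j, m j ∈ 𝓜 (e j))
    (h : ∀ d, d₀ ≤ d → ∀ x ∈ 𝓜 d, ∃ w ∈ HF k e d, ∃ u : Fin 4 → E, (∀ i, u i ∈ 𝓜 (d - 1)) ∧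
      x = gens m w + ∑ i, (X i : R4 k) • u i) :
    SES (kerGr (HF k e) (gens m)) (HF k e) 𝓜 (gens m) where
  grF := isGr_HF e
  maps := by
    intro d w hw
    rw [gens_apply]
    refine sum_mem fun j _ => ?_
    have := hgr _ _ _ _ (mem_HF.1 hw j) (hm j)
    rwa [add_sub_cancel] at this
  ker := fun _ _ => Iff.rfl
  surj := by
    have key : ∀ t : ℕ, ∀ x ∈ 𝓜 (d₀ - 1 + t), ∃ w ∈ HF k e (d₀ - 1 + t), gens m w = x := by
      intro t
      induction t with
      | zero =>
        intro x hx
        rw [h0 _ (by simp), Submodule.mem_bot] at hx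
        exact ⟨0, zero_mem _, by simp [hx]⟩
      | succ t ih =>
        intro x hx
        obtain ⟨w, hw, u, hu, rfl⟩ := h _ (by push_cast; omega) x hx
        rw [show d₀ - 1 + ((t + 1 : ℕ) : ℤ) - 1 = d₀ - 1 + t by push_cast; ring] at hu
        choose y hy hy2 using fun i => ih _ (hu i)
        refine ⟨w + ∑ i, (X i : R4 k) • y i, add_mem hw (sum_mem fun i _ => ?_), ?_⟩
        · have := isGr_HF e _ _ _ (X_mem_HZ i) (hy i)
          rwa [add_assoc, ← Nat.cast_succ] at this
        · simp [hy2]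
    intro d x hx
    rcases lt_or_ge d d₀ with hd | hd
    · rw [h0 _ hd, Submodule.mem_bot] at hx
      exact ⟨0, zero_mem _, by simp [hx]⟩
    · obtain ⟨t, ht⟩ := Int.eq_ofNat_of_zero_le (show 0 ≤ d - (d₀ - 1) by omega)
      obtain rfl : d = d₀ - 1 + t := by omega
      exact key t x hx

omit [IsScalarTower k (R4 k) E] in
theorem Ex.exists_sum {𝓜 : ℤ → Submodule k E} {d : ℤ} (h : Ex (KD0 k) (KD1 k) 𝓜 d) {x : E}
    (hx : x ∈ 𝓜 d) : ∃ u : Fin 4 → E, (∀ i, u i ∈ 𝓜 (d - 1)) ∧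
      ∑ i, (X i : R4 k) • u i = x := by
  obtain ⟨u, hu, hu2⟩ := h (fun _ => x) (fun _ => hx) (by ext i; exact i.elim0)
  exact ⟨u, hu, by rw [← act_KD1_apply u 0, hu2]⟩

theorem isGrAll_HF {n : ℕ} (e : Fin n → ℕ) : IsGrAll (HF k e) := by
  intro d c r x hr hx
  rw [mem_HF] at hx ⊢
  intro j
  have := mul_mem_HZ hr (hx j)
  rw [Pi.smul_apply, smul_eq_mul]
  rwa [show c + (d - (e j : ℤ)) = d + c - e j by ring] at this

theorem IsGrAll.kerGr {F : Type} [AddCommGroup F] [Module (R4 k) F] [Module k F]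
    [IsScalarTower k (R4 k) F] {𝓕 : ℤ → Submodule k F} (h : IsGrAll 𝓕) (φ : F →ₗ[R4 k] E) :
    IsGrAll (kerGr 𝓕 φ) := by
  intro d e r x hr hx
  exact ⟨h _ _ _ _ hr hx.1, by
    have : φ x = 0 := hx.2
    simp [this]⟩

instance HF_finiteDimensional {n : ℕ} (e : Fin n → ℕ) (d : ℤ) : FiniteDimensional k (HF k e d) := by
  let φ : HF k e d →ₗ[k] (∀ j, HZ k (d - e j)) :=
    { toFun := fun w j => ⟨w.1 j, mem_HF.1 w.2 j⟩
      map_add' := fun _ _ => rfl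
      map_smul' := fun _ _ => rfl }
  refine Module.Finite.of_injective φ fun w w' h => ?_
  ext1
  funext j
  exact congrArg Subtype.val (congrFun h j)

theorem finrank_HF {n : ℕ} (e : Fin n → ℕ) (d : ℤ) :
    Module.finrank k (HF k e d) = ∑ j, Module.finrank k (HZ k (d - e j)) := by
  let φ : HF k e d ≃ₗ[k] (∀ j, HZ k (d - e j)) :=
    { toFun := fun w j => ⟨w.1 j, mem_HF.1 w.2 j⟩
      invFun := fun w => ⟨fun j => (w j).1, mem_HF.2 fun j => (w j).2⟩
      left_inv := fun _ => rfl
      right_inv := fun _ => rfl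
      map_add' := fun _ _ => rfl
      map_smul' := fun _ _ => rfl }
  rw [φ.finrank_eq, Module.finrank_pi_fintype]

instance kerGr_finiteDimensional {F : Type} [AddCommGroup F] [Module (R4 k) F] [Module k F]
    [IsScalarTower k (R4 k) F] (𝓕 : ℤ → Submodule k F) (φ : F →ₗ[R4 k] E) (d : ℤ)
    [FiniteDimensional k (𝓕 d)] : FiniteDimensional k (kerGr 𝓕 φ d) :=
  Submodule.finiteDimensional_of_le (inf_le_left : _ ≤ 𝓕 d)

/-- Graded component of a vector of polynomials. -/
noncomputable def cF {n : ℕ} (e : Fin n → ℕ) (d : ℤ) (w : Fin n → R4 k) : Fin n → R4 k :=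
  fun j => cZ k (d - e j) (w j)

theorem cF_mem {n : ℕ} (e : Fin n → ℕ) (d : ℤ) (w : Fin n → R4 k) : cF e d w ∈ HF k e d :=
  mem_HF.2 fun _ => cZ_mem _ _

theorem exists_sum_cF {n : ℕ} (e : Fin n → ℕ) (w : Fin n → R4 k) :
    ∃ M : ℕ, ∑ d ∈ Finset.range M, cF e d w = w := by
  choose N hN using fun j => exists_forall_sum_cZ (w j) (e j)
  refine ⟨∑ j, N j, funext fun j => ?_⟩
  rw [Finset.sum_apply]
  exact hN j _ (Finset.single_le_sum (f := N) (fun _ _ => Nat.zero_le _) (Finset.mem_univ j))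

/-- A graded surjection onto the graded pieces of a graded kernel is surjective onto the kernel. -/
theorem exists_gens_eq {n n' : ℕ} {e : Fin n → ℕ} {e' : Fin n' → ℕ} {ψ : (Fin n → R4 k) →ₗ[R4 k] E}
    (hψ : ∀ w, ψ w = 0 → ∀ d : ℤ, ψ (cF e d w) = 0) {φ : (Fin n' → R4 k) →ₗ[R4 k] (Fin n → R4 k)}
    (h : SES (kerGr (HF k e') φ) (HF k e') (kerGr (HF k e) ψ) φ) {w : Fin n → R4 k} (hw : ψ w = 0) :
    ∃ u, φ u = w := by
  obtain ⟨M, hM⟩ := exists_sum_cF e w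
  choose u _ hu using fun d : ℕ => h.surj d (cF e d w) ⟨cF_mem _ _ _, hψ w hw d⟩
  exact ⟨∑ d ∈ Finset.range M, u d, by simp [hu, hM]⟩

theorem eq_zero_of_kerGr {n : ℕ} {e : Fin n → ℕ} {ψ : (Fin n → R4 k) →ₗ[R4 k] E}
    (hψ : ∀ w, ψ w = 0 → ∀ d : ℤ, ψ (cF e d w) = 0)
    (h : ∀ d, kerGr (HF k e) ψ d = ⊥) {w : Fin n → R4 k} (hw : ψ w = 0) : w = 0 := by
  obtain ⟨M, hM⟩ := exists_sum_cF e w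
  rw [← hM]
  refine Finset.sum_eq_zero fun d _ => ?_
  have : cF e d w ∈ kerGr (HF k e) ψ d := ⟨cF_mem _ _ _, hψ w hw d⟩
  rwa [h, Submodule.mem_bot] at this

theorem gens_cF {n n' : ℕ} {e : Fin n → ℕ} {e' : Fin n' → ℕ} {m : Fin n' → Fin n → R4 k}
    (hm : ∀ j, m j ∈ HF k e (e' j)) (d : ℤ) (w : Fin n' → R4 k) :
    gens m (cF e' d w) = cF e d (gens m w) := by
  ext1 j
  simp only [gens_apply, cF, Finset.sum_apply, Pi.smul_apply, smul_eq_mul, map_sum]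
  refine Finset.sum_congr rfl fun i _ => ?_
  rw [cZ_mul' _ (mem_HF.1 (hm i) j)]
  congr 3
  ring

theorem entryOk_of_mem {d e : ℕ} (h : e < d) {q : R4 k} (hq : q ∈ HZ k ((d : ℤ) - e)) :
    EntryOk k d e q := by
  obtain ⟨c, rfl⟩ := Nat.exists_eq_add_of_lt h
  rw [show ((e + c + 1 : ℕ) : ℤ) - e = (c + 1 : ℕ) by push_cast; ring, mem_HZ_nat] at hq
  refine ⟨Or.inr ⟨c + 1, by ring, hq⟩, ?_⟩
  exact hq.coeff_eq_zero (by simp)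

end Resolution

section Evaluation

variable {k : Type} [Field k]

section Homotopy

variable {E : Type} [AddCommGroup E] [Module (R4 k) E]

theorem act_add_mat {m n : ℕ} (D D' : Matrix (Fin m) (Fin n) (R4 k)) (v : Fin n → E) :
    act (D + D') v = act D v + act D' v := by
  ext i; simp [act, add_smul, Finset.sum_add_distrib]

theorem act_smul_one {n : ℕ} (L : R4 k) (v : Fin n → E) :
    act (L • (1 : Matrix (Fin n) (Fin n) (R4 k))) v = L • v := by
  ext i; simp [act, Matrix.one_apply]

variable [Module k E] in
theorem ex_of_homotopy {l m n : ℕ} {D' : Matrix (Fin l) (Fin m) (R4 k)}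
    {D : Matrix (Fin m) (Fin n) (R4 k)} {T' : Matrix (Fin m) (Fin l) (R4 k)}
    {T : Matrix (Fin n) (Fin m) (R4 k)} {L : R4 k} (h : D * T + T' * D' = L • 1)
    (hL : Function.Bijective fun x : E => L • x) {𝓜 : ℤ → Submodule k E} {d : ℤ}
    (hd : n = 0 ∨ 𝓜 (d - 1) = ⊤) : Ex D' D 𝓜 d := by
  intro x _ hx
  choose y hy using fun j => hL.2 (x j)
  have hxy : x = L • y := funext fun j => (hy j).symm
  have h0 : act D' y = 0 := by
    rw [hxy, act_smul] at hx
    ext i : 1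
    apply hL.1
    simpa using congrFun hx i
  refine ⟨act T y, fun j => ?_, ?_⟩
  · rcases hd with rfl | hd
    · exact j.elim0
    · rw [hd]; trivial
  · have := act_smul_one L y
    rw [← h, act_add_mat, ← act_act, ← act_act, h0, act_zero, add_zero] at this
    rw [this, hxy]

/-- Transposed Koszul differentials with constant coefficients. -/
noncomputable def cT {m n : ℕ} (D : Matrix (Fin m) (Fin n) (R4 k)) (c : Fin 4 → k) :
    Matrix (Fin n) (Fin m) (R4 k) := fun i j => C (eval c (D j i))

theorem homotopy_one (c : Fin 4 → k) :
    KD2 k * cT (KD2 k) c + cT (KD1 k) c * KD1 k = (∑ i, C (c i) * X i : R4 k) • 1 := by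
  ext i j : 1
  rw [Matrix.add_apply, Matrix.mul_apply, Matrix.mul_apply]
  simp only [cT, Fin.sum_univ_six, Fin.sum_univ_four, Fin.sum_univ_one]
  fin_cases i <;> fin_cases j <;> simp [KD1, KD2] <;> ring_nf

theorem homotopy_two (c : Fin 4 → k) :
    KD3 k * cT (KD3 k) c + cT (KD2 k) c * KD2 k = (∑ i, C (c i) * X i : R4 k) • 1 := by
  ext i j : 1
  rw [Matrix.add_apply, Matrix.mul_apply, Matrix.mul_apply]
  simp only [cT, Fin.sum_univ_four]
  fin_cases i <;> fin_cases j <;> simp [KD3, KD2] <;> ring_nf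

theorem homotopy_three (c : Fin 4 → k) :
    KD4 k * cT (KD4 k) c + cT (KD3 k) c * KD3 k = (∑ i, C (c i) * X i : R4 k) • 1 := by
  ext i j : 1
  rw [Matrix.add_apply, Matrix.mul_apply, Matrix.mul_apply]
  simp only [cT, Fin.sum_univ_six, Fin.sum_univ_four, Fin.sum_univ_one]
  fin_cases i <;> fin_cases j <;> simp [KD3, KD4] <;> ring_nf

theorem homotopy_four (c : Fin 4 → k) :
    KD5 k * cT (KD5 k) c + cT (KD4 k) c * KD4 k = (∑ i, C (c i) * X i : R4 k) • 1 := by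
  ext i j : 1
  rw [Matrix.add_apply, Matrix.mul_apply, Matrix.mul_apply]
  simp only [cT, Fin.sum_univ_four, Fin.sum_univ_zero]
  fin_cases i; fin_cases j
  simp [KD4]

end Homotopy

variable {ι : Type}

/-- Functions on a family of vectors, as a module over the polynomial ring through evaluation. -/
def EvMod (_ : ι → Fin 4 → k) : Type := ι → k

variable (v : ι → Fin 4 → k)

instance : AddCommGroup (EvMod v) := inferInstanceAs (AddCommGroup (ι → k))
instance : Module k (EvMod v) := inferInstanceAs (Module k (ι → k))
noncomputable instance : Module (R4 k) (EvMod v) :=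
  Module.compHom (ι → k) (RingHom.pi fun p => eval (v p))

variable {v}

theorem evMod_smul (r : R4 k) (x : EvMod v) (p : ι) : (r • x) p = eval (v p) r * x p := rfl

instance : IsScalarTower k (R4 k) (EvMod v) := ⟨fun c r x => by
  funext p
  rw [evMod_smul, smul_eval, mul_assoc]
  rfl⟩

/-- Evaluation as a linear map on the polynomial ring. -/
noncomputable def evR (v : ι → Fin 4 → k) : R4 k →ₗ[R4 k] EvMod v where
  toFun r := fun p => eval (v p) r
  map_add' r s := by funext p; exact map_add _ r s
  map_smul' r s := by
    funext p
    exact map_mul (eval (v p)) r s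

/-- Evaluation on the coordinate ring, at vectors on the cone. -/
noncomputable def evS {f : R4 k} (hv : ∀ p, eval (v p) f = 0) : SX f →ₗ[R4 k] EvMod v :=
  (Ideal.span {f}).liftQ (evR v) (by
    rw [Ideal.span, Submodule.span_le, Set.singleton_subset_iff]
    funext p
    exact hv p)

theorem evS_mkS {f : R4 k} (hv : ∀ p, eval (v p) f = 0) (r : R4 k) (p : ι) :
    evS hv (mkS f r) p = eval (v p) r := rfl

theorem exists_linear_form_ne_zero [Infinite k] [Finite ι] (hv0 : ∀ p, v p ≠ 0) :
    ∃ c : Fin 4 → k, ∀ p, ∑ i, c i * v p i ≠ 0 := by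
  have := Fintype.ofFinite ι
  have hne : ∏ p, (∑ i, C (v p i) * X i : R4 k) ≠ 0 := by
    rw [Finset.prod_ne_zero_iff]
    intro p _ h
    apply hv0 p
    ext j
    have := congrArg (eval (Pi.single j 1)) h
    simpa [Pi.single_apply] using this
  obtain ⟨c, hc⟩ : ∃ c, eval c (∏ p, (∑ i, C (v p i) * X i : R4 k)) ≠ 0 := by
    by_contra hcon
    push Not at hcon
    exact hne (MvPolynomial.funext fun c => by simpa using hcon c)
  refine ⟨c, fun p hp => hc ?_⟩
  rw [map_prod]
  refine Finset.prod_eq_zero (Finset.mem_univ p) ?_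
  rw [← hp]
  simp [mul_comm]

theorem exists_form_bijective [Infinite k] [Finite ι] (hv0 : ∀ p, v p ≠ 0) :
    ∃ c : Fin 4 → k, Function.Bijective fun x : EvMod v => (∑ i, C (c i) * X i : R4 k) • x := by
  obtain ⟨c, hc⟩ := exists_linear_form_ne_zero hv0
  have key (p : ι) : eval (v p) (∑ i, C (c i) * X i : R4 k) ≠ 0 := by simpa using hc p
  refine ⟨c, fun x y hxy => ?_, fun y => ⟨fun p => (eval (v p) (∑ i, C (c i) * X i : R4 k))⁻¹ * y p, ?_⟩⟩
  · funext p
    exact mul_left_cancel₀ (key p) (congrFun hxy p)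
  · funext p
    exact mul_inv_cancel_left₀ (key p) _

theorem ex1_ev [Infinite k] [Finite ι] (hv0 : ∀ p, v p ≠ 0) {𝓠 : ℤ → Submodule k (EvMod v)}
    {d : ℤ} (h : 𝓠 (d - 1) = ⊤) : Ex (KD1 k) (KD2 k) 𝓠 d :=
  let ⟨c, hc⟩ := exists_form_bijective hv0
  ex_of_homotopy (homotopy_one c) hc (Or.inr h)

theorem ex2_ev [Infinite k] [Finite ι] (hv0 : ∀ p, v p ≠ 0) {𝓠 : ℤ → Submodule k (EvMod v)}
    {d : ℤ} (h : 𝓠 (d - 1) = ⊤) : Ex (KD2 k) (KD3 k) 𝓠 d :=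
  let ⟨c, hc⟩ := exists_form_bijective hv0
  ex_of_homotopy (homotopy_two c) hc (Or.inr h)

theorem ex3_ev [Infinite k] [Finite ι] (hv0 : ∀ p, v p ≠ 0) {𝓠 : ℤ → Submodule k (EvMod v)}
    {d : ℤ} (h : 𝓠 (d - 1) = ⊤) : Ex (KD3 k) (KD4 k) 𝓠 d :=
  let ⟨c, hc⟩ := exists_form_bijective hv0
  ex_of_homotopy (homotopy_three c) hc (Or.inr h)

theorem ex4_ev [Infinite k] [Finite ι] (hv0 : ∀ p, v p ≠ 0) (𝓠 : ℤ → Submodule k (EvMod v))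
    (d : ℤ) : Ex (KD4 k) (KD5 k) 𝓠 d :=
  let ⟨c, hc⟩ := exists_form_bijective hv0
  ex_of_homotopy (homotopy_four c) hc (Or.inl rfl)

end Evaluation

section NewGenerators

variable {k : Type} [Field k]
variable {E : Type} [AddCommGroup E] [Module (R4 k) E] [Module k E] [IsScalarTower k (R4 k) E]

/-- In the degree after the initial one, the new generators are counted by the Hilbert function. -/
theorem exists_new_gens {𝓜 : ℤ → Submodule k E} (hgr : IsGr 𝓜) {d : ℤ}
    [FiniteDimensional k (𝓜 d)] [FiniteDimensional k (𝓜 (d + 1))]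
    (h1 : Ex (KD1 k) (KD2 k) 𝓜 d) (h0 : 𝓜 (d - 1) = ⊥) {n : ℕ}
    (hn : Module.finrank k (𝓜 (d + 1)) = 4 * Module.finrank k (𝓜 d) + n) :
    ∃ m : Fin n → E, (∀ j, m j ∈ 𝓜 (d + 1)) ∧ ∀ x ∈ 𝓜 (d + 1), ∃ c : Fin n → k,
      ∃ u : Fin 4 → E, (∀ i, u i ∈ 𝓜 d) ∧ x = ∑ j, c j • m j + ∑ i, (X i : R4 k) • u i := by
  let ψ : (Fin 4 → 𝓜 d) →ₗ[k] E :=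
    { toFun := fun u => ∑ i, (X i : R4 k) • (u i : E)
      map_add' := fun u w => by simp [Finset.sum_add_distrib]
      map_smul' := fun c u => by
        simp only [Pi.smul_apply, Submodule.coe_smul, RingHom.id_apply, Finset.smul_sum]
        exact Finset.sum_congr rfl fun i _ => smul_comm _ _ _ }
  have hinj : Function.Injective ψ := by
    rw [← LinearMap.ker_eq_bot, LinearMap.ker_eq_bot']
    intro u hu
    obtain ⟨y, hy, hy2⟩ := h1 (fun i => u i) (fun i => (u i).2) (by
      ext i
      rw [act_KD1_apply]
      exact hu)
    have : y = 0 := by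
      ext j
      have := hy j
      rwa [h0, Submodule.mem_bot] at this
    rw [this, act_zero] at hy2
    ext i
    exact (congrFun hy2 i).symm
  have hW : LinearMap.range ψ ≤ 𝓜 (d + 1) := by
    rintro _ ⟨u, rfl⟩
    change ∑ i, (X i : R4 k) • (u i : E) ∈ _
    exact sum_mem fun i _ => hgr _ _ _ (X_mem_HZ i) (u i).2
  obtain ⟨m, hm, hm2⟩ := exists_complement_basis (n := n) hW (by
    rw [LinearMap.finrank_range_of_inj hinj, Module.finrank_pi_fintype]
    simpa using hn)
  refine ⟨m, hm, fun x hx => ?_⟩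
  obtain ⟨c, u, hu⟩ := hm2 x hx
  exact ⟨c, fun i => u i, fun i => (u i).2, by
    rw [eq_comm, sub_eq_iff_eq_add'] at hu
    exact hu⟩

omit [Module k E] [IsScalarTower k (R4 k) E] in
theorem gens_append {n n' : ℕ} (m : Fin n → E) (m' : Fin n' → E) (w : Fin n → R4 k)
    (w' : Fin n' → R4 k) :
    gens (Fin.append m m') (Fin.append w w') = gens m w + gens m' w' := by
  simp [gens_apply, Fin.sum_univ_add]

theorem gens_C {n : ℕ} (m : Fin n → E) (c : Fin n → k) :
    gens m (fun j => (C (c j) : R4 k)) = ∑ j, c j • m j := by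
  rw [gens_apply]
  refine Finset.sum_congr rfl fun j _ => ?_
  rw [← algebraMap_eq, algebraMap_smul]

end NewGenerators

section Criterion

variable {k : Type} [Field k] {ι : Type}

/-- Forms of degree `d` separate the given vectors. -/
def EvSur (d : ℤ) (v : ι → Fin 4 → k) : Prop :=
  ∀ c : ι → k, ∃ p ∈ HZ k d, ∀ i, eval (v i) p = c i

/-- Linear syzygies modulo `f` of degree `d` take arbitrary admissible values at the vectors. -/
def SyzSur (f : R4 k) (d : ℤ) (v : ι → Fin 4 → k) : Prop :=
  ∀ ξ : ι → Fin 4 → k, (∀ p, ∑ i, ξ p i * v p i = 0) →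
    ∃ g : Fin 4 → R4 k, (∀ i, g i ∈ HZ k d) ∧ ∑ i, X i * g i ∈ Ideal.span {f} ∧
      ∀ p i, eval (v p) (g i) = ξ p i

/-- A vector of forms of degree `d` proportional to the position vector at every given vector
is a multiple of the position vector modulo `f`. -/
def RadialOnly (f : R4 k) (d : ℤ) (v : ι → Fin 4 → k) : Prop :=
  ∀ h : Fin 4 → R4 k, (∀ i, h i ∈ HZ k d) →
    (∀ p i j, eval (v p) (h i) * v p j = eval (v p) (h j) * v p i) →
    ∃ e ∈ HZ k (d - 1), ∀ i, h i - X i * e ∈ Ideal.span {f}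

variable {f : R4 k}

theorem isPrime_span (hirr : Irreducible f) : (Ideal.span {f}).IsPrime :=
  (Ideal.span_singleton_prime hirr.ne_zero).2 hirr.prime

theorem X_notMem_span (hf : f ∈ HZ k 3) (i : Fin 4) : (X i : R4 k) ∉ Ideal.span {f} :=
  fun h => X_ne_zero' i (mem_span_eq_zero_of_lt hf (by norm_num) (X_mem_HZ i) h)

theorem mem_span_of_X_mul (hf : f ∈ HZ k 3) (hirr : Irreducible f) {i : Fin 4} {p : R4 k}
    (h : X i * p ∈ Ideal.span {f}) : p ∈ Ideal.span {f} :=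
  ((isPrime_span hirr).mem_or_mem h).resolve_left (X_notMem_span hf i)

variable {v : ι → Fin 4 → k} (hv : ∀ p, eval (v p) f = 0)

/-- The graded pieces of the ideal of the given vectors in the coordinate ring. -/
noncomputable def vanGr (d : ℤ) : Submodule k (SX f) := kerGr (gr f) (evS hv) d

/-- The graded pieces of the module of values. -/
noncomputable def valGr (d : ℤ) : Submodule k (EvMod v) :=
  (gr f d).map ((evS hv).restrictScalars k)

theorem mkS_mem_vanGr {d : ℤ} {p : R4 k} (hp : p ∈ HZ k d) (h : ∀ i, eval (v i) p = 0) :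
    mkS f p ∈ vanGr hv d := ⟨mkS_mem_gr hp, funext h⟩

theorem mem_vanGr {d : ℤ} {s : SX f} (h : s ∈ vanGr hv d) :
    ∃ p ∈ HZ k d, mkS f p = s ∧ ∀ i, eval (v i) p = 0 := by
  obtain ⟨⟨p, hp, rfl⟩, h2⟩ := h
  exact ⟨p, hp, rfl, fun i => congrFun h2 i⟩

theorem isGrAll_gr (f : R4 k) : IsGrAll (gr f) := by
  rintro d e r _ hr ⟨p, hp, rfl⟩
  refine ⟨r * p, ?_, mkS_mul⟩
  rw [add_comm]
  exact mul_mem_HZ hr hp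

theorem isGrAll_vanGr : IsGrAll (vanGr hv) := (isGrAll_gr f).kerGr _

theorem IsGrAll.isGr {E : Type} [AddCommGroup E] [Module (R4 k) E] [Module k E]
    {𝓜 : ℤ → Submodule k E} (h : IsGrAll 𝓜) : IsGr 𝓜 := fun d r x hr hx => h d 1 r x hr hx

theorem ses_van : SES (vanGr hv) (gr f) (valGr hv) (evS hv) where
  grF := isGr_gr f
  surj := fun _ _ h => h
  maps := fun _ w h => ⟨w, h, rfl⟩
  ker := fun _ _ => Iff.rfl

theorem EvSur.succ [Infinite k] [Finite ι] (hv0 : ∀ p, v p ≠ 0) {d : ℤ} (h : EvSur d v) :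
    EvSur (d + 1) v := by
  obtain ⟨c, hc⟩ := exists_linear_form_ne_zero hv0
  intro b
  obtain ⟨p, hp, hp2⟩ := h fun i => (∑ j, c j * v i j)⁻¹ * b i
  refine ⟨(∑ j, C (c j) * X j) * p, ?_, fun i => ?_⟩
  · rw [add_comm]
    exact mul_mem_HZ (sum_mem fun j _ => C_mul_mem_HZ _ (X_mem_HZ j)) hp
  · rw [map_mul, hp2]
    simpa using mul_inv_cancel_left₀ (hc i) (b i)

theorem EvSur.of_le [Infinite k] [Finite ι] (hv0 : ∀ p, v p ≠ 0) {d e : ℤ} (h : EvSur d v)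
    (hde : d ≤ e) : EvSur e v := by
  obtain ⟨t, ht⟩ := Int.eq_ofNat_of_zero_le (sub_nonneg.2 hde)
  obtain rfl : e = d + t := by omega
  clear ht hde
  induction t with
  | zero => simpa using h
  | succ t ih =>
    have := ih.succ hv0
    rwa [add_assoc, ← Nat.cast_succ] at this

theorem valGr_eq_top {d : ℤ} (h : EvSur d v) : valGr hv d = ⊤ := by
  rw [eq_top_iff]
  intro c _
  obtain ⟨p, hp, hp2⟩ := h c
  exact ⟨mkS f p, mkS_mem_gr hp, funext hp2⟩

theorem finrank_vanGr [Fintype ι] (hf : f ∈ HZ k 3) (hf0 : f ≠ 0) {d : ℕ} (h : EvSur (d : ℤ) v) :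
    Hs d = Module.finrank k (vanGr hv d) + Fintype.card ι := by
  rw [← finrank_gr hf hf0, SES.finrank_add (ses_van hv), valGr_eq_top hv h, finrank_top]
  congr 1
  exact Module.finrank_fintype_fun_eq_card k

theorem vanGr_eq_bot (hf : f ∈ HZ k 3) (hirr : Irreducible f) {a : ℤ}
    (hiv : RadialOnly f (a - 1) v) : ∀ d < a, vanGr hv d = ⊥ := by
  have key : ∀ t : ℕ, vanGr hv (a - 1 - t) = ⊥ := by
    intro t
    rw [eq_bot_iff]
    intro s hs
    obtain ⟨p, hp, rfl, hp2⟩ := mem_vanGr hv hs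
    rw [Submodule.mem_bot, mkS_eq_zero]
    induction t generalizing p with
    | zero =>
      obtain ⟨e, _, he2⟩ := hiv (Pi.single 0 p) (fun i => by
        rcases eq_or_ne i 0 with rfl | hi
        · simpa using hp
        · simp [hi]) (fun q i j => by
        have h0 (i : Fin 4) : eval (v q) ((Pi.single 0 p : Fin 4 → R4 k) i) = 0 := by
          rcases eq_or_ne i 0 with rfl | hi
          · simpa using hp2 q
          · simp [hi]
        rw [h0, h0, zero_mul, zero_mul])
      have h1 := he2 1
      rw [Pi.single_eq_of_ne (by decide), zero_sub, neg_mem_iff] at h1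
      have h2 := he2 0
      rw [Pi.single_eq_same] at h2
      have := add_mem h2 (Ideal.mul_mem_left _ (X 0) (mem_span_of_X_mul hf hirr h1))
      simpa using this
    | succ t ih =>
      rw [show a - 1 - ((t + 1 : ℕ) : ℤ) = a - 1 - t - 1 by push_cast; ring] at hp
      have h0 : ∀ i, eval (v i) (X 0 * p) = 0 := fun i => by simp [hp2]
      have h1 : X 0 * p ∈ HZ k (a - 1 - t) := X_mul_mem_HZ' 0 hp
      exact mem_span_of_X_mul hf hirr (i := 0) (ih (X 0 * p) h1 h0 (mkS_mem_vanGr hv h1 h0))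
  intro d hd
  obtain ⟨t, ht⟩ := Int.eq_ofNat_of_zero_le (show 0 ≤ a - 1 - d by omega)
  obtain rfl : d = a - 1 - t := by omega
  exact key t

theorem ex0_van_succ {a : ℤ} (ha : a + 1 ≠ 0) (hsur : SyzSur f a v) :
    Ex (KD0 k) (KD1 k) (vanGr hv) (a + 1) := by
  intro x hx _
  obtain ⟨p, hp, hpx, hp2⟩ := mem_vanGr hv (hx 0)
  obtain ⟨u, hu, hu2⟩ := exists_sum_X_mul ha hp
  rw [add_sub_cancel_right] at hu
  obtain ⟨g, hg, hg1, hg2⟩ := hsur (fun q i => eval (v q) (u i)) (fun q => by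
    rw [← hp2 q, ← hu2]; simp [mul_comm])
  refine ⟨fun i => mkS f (u i - g i), fun i => mkS_mem_vanGr hv ?_ ?_, ?_⟩
  · rw [add_sub_cancel_right]
    exact sub_mem (hu i) (hg i)
  · intro q; simp [hg2]
  · ext i
    rw [act_KD1_apply, Subsingleton.elim i 0, ← hpx, ← hu2]
    simp only [← mkS_mul, ← map_sum]
    rw [mkS_eq_mkS, ← neg_mem_iff]
    convert hg1 using 1
    simp [mul_sub]

theorem ex2_van_init (hf : f ∈ HZ k 3) (hf0 : f ≠ 0) {a : ℤ} (hiv : RadialOnly f (a - 1) v) :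
    Ex (KD2 k) (KD3 k) (vanGr hv) a := by
  intro x hx hx0
  obtain ⟨h, hh, rfl⟩ := ex2_gr hf hf0 a x (fun j => (hx j).1) hx0
  choose p hp hp2 using hh
  have hph : h = fun i => mkS f (p i) := funext fun i => (hp2 i).symm
  have hx' : act (KD3 k) (fun i => evS hv (h i)) = 0 := by
    rw [← map_act]
    exact funext fun j => (hx j).2
  rw [act_KD3_eq_zero_iff] at hx'
  obtain ⟨e, _, he⟩ := hiv p hp (fun q i j => by
    have := congrFun (hx' i j) q
    simp only [hph, evMod_smul, eval_X, evS_mkS] at this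
    linear_combination -this)
  refine ⟨0, fun j => zero_mem _, ?_⟩
  rw [act_zero, eq_comm, act_KD3_eq_zero_iff]
  intro i j
  have hi (i) : h i = (X i : R4 k) • mkS f e := by
    rw [← mkS_mul, hph, mkS_eq_mkS]
    exact he i
  rw [hi, hi, smul_smul, smul_smul, mul_comm]

variable [Infinite k] [Finite ι] (hf : f ∈ HZ k 3) (hf0 : f ≠ 0) (hv0 : ∀ p, v p ≠ 0)

include hv0 in
theorem ex0_van {d : ℤ} (hd : d ≠ 0) (h : EvSur (d - 2) v) :
    Ex (KD0 k) (KD1 k) (vanGr hv) d :=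
  (ses_van hv).ex_sub KD12 isLin_KD2 (ex0_gr hd) (ex1_ev hv0
    (valGr_eq_top hv (by rwa [sub_sub])))

include hf hf0 hv0 in
theorem ex1_van {d : ℤ} (hd : d ≠ 2) (h : EvSur (d - 2) v) :
    Ex (KD1 k) (KD2 k) (vanGr hv) d :=
  (ses_van hv).ex_sub KD23 isLin_KD3 (ex1_gr hf hf0 hd) (ex2_ev hv0
    (valGr_eq_top hv (by rwa [sub_sub])))

include hf hf0 hv0 in
theorem ex2_van {d : ℤ} (h : EvSur (d - 2) v) : Ex (KD2 k) (KD3 k) (vanGr hv) d :=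
  (ses_van hv).ex_sub KD34 isLin_KD4 (ex2_gr hf hf0 d) (ex3_ev hv0
    (valGr_eq_top hv (by rwa [sub_sub])))

include hf hf0 hv0 in
theorem ex3_van (d : ℤ) : Ex (KD3 k) (KD4 k) (vanGr hv) d :=
  (ses_van hv).ex_sub KD45 isLin_KD5 (ex3_gr hf hf0 d) (ex4_ev hv0 _ _)

end Criterion

section CriterionResolution

variable {k : Type} [Field k]

theorem finrank_HZ_zero : Module.finrank k (HZ k 0) = 1 := finrank_HZ 0
theorem finrank_HZ_one : Module.finrank k (HZ k 1) = 4 := finrank_HZ 1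
theorem finrank_HZ_two : Module.finrank k (HZ k 2) = 10 := finrank_HZ 2
theorem finrank_HZ_three : Module.finrank k (HZ k 3) = 20 := finrank_HZ 3
theorem finrank_HZ_neg {z : ℤ} (hz : z < 0) : Module.finrank k (HZ k z) = 0 := by
  rw [HZ_neg hz, finrank_bot]

theorem finrank_HF_const (n e : ℕ) (d : ℤ) :
    Module.finrank k (HF k (fun _ : Fin n => e) d) = n * Module.finrank k (HZ k (d - e)) := by
  rw [finrank_HF]; simp

theorem exists_basis_gens {E : Type} [AddCommGroup E] [Module (R4 k) E] [Module k E]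
    {U : Submodule k E} [FiniteDimensional k U] {n : ℕ} (h : Module.finrank k U = n) :
    ∃ m : Fin n → E, (∀ j, m j ∈ U) ∧ ∀ x ∈ U, ∃ c : Fin n → k, x = ∑ j, c j • m j := by
  obtain ⟨m, hm, hm2⟩ := exists_complement_basis (W := (⊥ : Submodule k E)) (U := U) (n := n)
    bot_le (by rw [finrank_bot, zero_add, h])
  refine ⟨m, hm, fun x hx => ?_⟩
  obtain ⟨c, hc⟩ := hm2 x hx
  exact ⟨c, sub_eq_zero.1 ((Submodule.mem_bot k).1 hc)⟩

theorem eq_bot_of_finrank {E : Type} [AddCommGroup E] [Module k E]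
    {U : Submodule k E} [FiniteDimensional k U] (h : Module.finrank k U = 0) : U = ⊥ :=
  Submodule.finrank_eq_zero.1 h

variable {ι : Type} [Infinite k] [Fintype ι] {f : R4 k} {v : ι → Fin 4 → k}

/-- Points with the right value conditions have the expected minimal free resolution. -/
theorem hasMinFreeRes3_of_conditions (hf : f ∈ HZ k 3) (hirr : Irreducible f)
    (hv : ∀ p, eval (v p) f = 0) (hv0 : ∀ p, v p ≠ 0) {a : ℕ} (ha : 3 ≤ a)
    (hcard : 2 * Fintype.card ι = 3 * (a * (a - 1)) + 2 * a + 2)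
    (hev : EvSur (a : ℤ) v) (hsur : SyzSur f a v) (hiv : RadialOnly f (a - 1 : ℤ) v)
    {I : Ideal (R4 k)} (hI : ∀ x, x ∈ I ↔ ∀ (d : ℕ) (p : ι), eval (v p) (cZ k d x) = 0) :
    HasMinFreeRes3 k (Ideal.span {f}) I (fun _ : Fin (2 * a) => a)
      (Fin.append (fun _ : Fin (3 * a - 3) => a + 1) (fun _ : Fin 3 => a + 2))
      (fun _ : Fin a => a + 3) := by
  have hf0 := hirr.ne_zero
  have hevd : ∀ d : ℤ, (a : ℤ) ≤ d → EvSur d v := fun d => hev.of_le hv0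
  -- the graded ideal of the points
  have hM0 : ∀ d < (a : ℤ), vanGr hv d = ⊥ := vanGr_eq_bot hv hf hirr hiv
  have hE0 : ∀ d, (a : ℤ) + 1 ≤ d → Ex (KD0 k) (KD1 k) (vanGr hv) d := by
    intro d hd
    rcases eq_or_lt_of_le hd with rfl | hd
    · exact ex0_van_succ hv (by omega) hsur
    · exact ex0_van hv hv0 (by omega) (hevd _ (by omega))
  have hE1 : ∀ d, (a : ℤ) + 2 ≤ d → Ex (KD1 k) (KD2 k) (vanGr hv) d := fun d hd =>
    ex1_van hv hf hf0 hv0 (by omega) (hevd _ (by omega))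
  have hE2 : ∀ d, d ≠ (a : ℤ) + 1 → Ex (KD2 k) (KD3 k) (vanGr hv) d := by
    intro d hd
    rcases lt_trichotomy d (a : ℤ) with h | h | h
    · exact Ex.of_bot (hM0 d h)
    · rw [h]; exact ex2_van_init hv hf hf0 hiv
    · exact ex2_van hv hf hf0 hv0 (hevd _ (by omega))
  have hE3 := ex3_van hv hf hf0 hv0
  have hfin (d : ℤ) : FiniteDimensional k (vanGr hv d) := by unfold vanGr; infer_instance
  have hMdim : ∀ d : ℕ, a ≤ d → Hs d = Module.finrank k (vanGr hv d) + Fintype.card ι := fun d hd =>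
    finrank_vanGr hv hf hf0 (hevd _ (by exact_mod_cast hd))
  have ha1 : a * (a - 1) + a = a * a := by
    obtain ⟨b, rfl⟩ := Nat.exists_eq_add_of_le ha
    simp only [show 3 + b - 1 = 2 + b by omega]; ring
  have hdimM0 : Module.finrank k (vanGr hv (a : ℤ)) = 2 * a := by
    have h1 := hMdim a le_rfl
    have h2 := two_mul_Hs a
    nlinarith
  have hdimM1 : Module.finrank k (vanGr hv ((a : ℤ) + 1)) = 5 * a + 3 := by
    have h1 := hMdim (a + 1) (by omega)
    have h2 := two_mul_Hs (a + 1)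
    push_cast at h1
    nlinarith
  have hdimM2 : Module.finrank k (vanGr hv ((a : ℤ) + 2)) = 8 * a + 9 := by
    have h1 := hMdim (a + 2) (by omega)
    have h2 := two_mul_Hs (a + 2)
    rw [Nat.cast_add, Nat.cast_ofNat] at h1
    nlinarith
  have hdimM3 : Module.finrank k (vanGr hv ((a : ℤ) + 3)) = 11 * a + 18 := by
    have h1 := hMdim (a + 3) (by omega)
    have h2 := two_mul_Hs (a + 3)
    rw [Nat.cast_add, Nat.cast_ofNat] at h1
    nlinarith
  -- generators
  obtain ⟨m1, hm1, hm1'⟩ := exists_basis_gens hdimM0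
  set e1 : Fin (2 * a) → ℕ := fun _ => a with he1
  have S1 : SES (kerGr (HF k e1) (gens m1)) (HF k e1) (vanGr hv) (gens m1) := by
    refine gens_ses (isGrAll_vanGr hv) hM0 hm1 fun d hd x hx => ?_
    rcases eq_or_lt_of_le hd with rfl | hd
    · obtain ⟨c, rfl⟩ := hm1' x hx
      refine ⟨fun j => C (c j), mem_HF.2 fun j => ?_, 0, fun _ => zero_mem _, ?_⟩
      · simpa [he1] using C_mem_HZ (c j)
      · rw [gens_C]; simp
    · obtain ⟨u, hu, rfl⟩ := (hE0 d hd).exists_sum hx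
      exact ⟨0, zero_mem _, u, hu, by simp⟩
  have hF1 (d : ℤ) : Module.finrank k (HF k e1 d) = 2 * a * Module.finrank k (HZ k (d - a)) :=
    finrank_HF_const _ _ _
  -- first syzygies
  set 𝓝 := kerGr (HF k e1) (gens m1) with h𝓝
  have hfr1 (d : ℤ) : Module.finrank k (HF k e1 d) =
      Module.finrank k (𝓝 d) + Module.finrank k (vanGr hv d) := SES.finrank_add S1 d
  have hN0 : ∀ d < (a : ℤ) + 1, 𝓝 d = ⊥ := by
    intro d hd
    apply eq_bot_of_finrank
    have h := hfr1 d
    rw [hF1] at h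
    rcases eq_or_lt_of_le (Int.lt_add_one_iff.1 hd) with rfl | hd
    · rw [sub_self, finrank_HZ_zero, hdimM0] at h
      omega
    · rw [finrank_HZ_neg (show d - a < 0 by omega)] at h
      omega
  have hN1 : Module.finrank k (𝓝 ((a : ℤ) + 1)) = 3 * a - 3 := by
    have h := hfr1 ((a : ℤ) + 1)
    rw [hF1, hdimM1] at h
    rw [add_sub_cancel_left, finrank_HZ_one] at h
    omega
  have hN2 : Module.finrank k (𝓝 ((a : ℤ) + 2)) = 12 * a - 9 := by
    have h := hfr1 ((a : ℤ) + 2)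
    rw [hF1, hdimM2] at h
    rw [add_sub_cancel_left, finrank_HZ_two] at h
    omega
  have hN3 : Module.finrank k (𝓝 ((a : ℤ) + 3)) + 18 = 29 * a := by
    have h := hfr1 ((a : ℤ) + 3)
    rw [hF1, hdimM3] at h
    rw [add_sub_cancel_left, finrank_HZ_three] at h
    omega
  have hgrN : IsGrAll 𝓝 := (isGrAll_HF e1).kerGr _
  have hNE0 : ∀ d, (a : ℤ) + 3 ≤ d → Ex (KD0 k) (KD1 k) 𝓝 d := fun d hd =>
    S1.ex_sub KD12 isLin_KD2 (ex_HF fun _ => ex0_HZ (by simp only [he1]; omega)) (hE1 _ (by omega))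
  have hNE1 : ∀ d, d ≠ (a : ℤ) + 2 → Ex (KD1 k) (KD2 k) 𝓝 d := fun d hd =>
    S1.ex_sub KD23 isLin_KD3 (ex_HF fun _ => ex1_HZ _) (hE2 _ (by omega))
  have hNE2 : ∀ d, Ex (KD2 k) (KD3 k) 𝓝 d := fun d =>
    S1.ex_sub KD34 isLin_KD4 (ex_HF fun _ => ex2_HZ _) (hE3 _)
  obtain ⟨m2a, hm2a, hm2a'⟩ := exists_basis_gens hN1
  obtain ⟨m2b, hm2b, hm2b'⟩ := exists_new_gens (n := 3) (𝓜 := 𝓝) hgrN.isGr (d := (a : ℤ) + 1)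
    (hNE1 _ (by omega)) (hN0 _ (by omega)) (by
      rw [add_assoc, show (1 : ℤ) + 1 = 2 by norm_num, hN1, hN2]; omega)
  rw [add_assoc, show (1 : ℤ) + 1 = 2 by norm_num] at hm2b hm2b'
  set e2 : Fin (3 * a - 3 + 3) → ℕ :=
    Fin.append (fun _ : Fin (3 * a - 3) => a + 1) (fun _ : Fin 3 => a + 2) with he2
  set m2 := Fin.append m2a m2b with hm2def
  have hm2 : ∀ j, m2 j ∈ 𝓝 (e2 j) := by
    intro j
    refine Fin.addCases (fun i => ?_) (fun i => ?_) j
    · simpa [he2, hm2def] using hm2a i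
    · simpa [he2, hm2def] using hm2b i
  have hHF2 {d : ℤ} {w : Fin (3 * a - 3) → R4 k} {w' : Fin 3 → R4 k}
      (hw : ∀ j, w j ∈ HZ k (d - a - 1)) (hw' : ∀ j, w' j ∈ HZ k (d - a - 2)) :
      Fin.append w w' ∈ HF k e2 d := by
    rw [mem_HF]
    intro j
    refine Fin.addCases (fun i => ?_) (fun i => ?_) j
    · simpa [he2, sub_sub] using hw i
    · simpa [he2, sub_sub] using hw' i
  have S2 : SES (kerGr (HF k e2) (gens m2)) (HF k e2) 𝓝 (gens m2) := by
    refine gens_ses hgrN hN0 hm2 fun d hd x hx => ?_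
    rcases eq_or_lt_of_le hd with rfl | hd
    · obtain ⟨c, rfl⟩ := hm2a' x hx
      refine ⟨Fin.append (fun j => C (c j)) 0, hHF2 (fun j => ?_) (fun _ => zero_mem _), 0,
        fun _ => zero_mem _, ?_⟩
      · simpa using C_mem_HZ (c j)
      · rw [hm2def, gens_append, gens_C]; simp
    rcases eq_or_lt_of_le (Int.add_one_le_iff.2 hd) with rfl | hd
    · rw [add_assoc, show (1 : ℤ) + 1 = 2 by norm_num] at hx ⊢
      obtain ⟨c, u, hu, rfl⟩ := hm2b' x hx
      refine ⟨Fin.append 0 (fun j => C (c j)), hHF2 (fun _ => zero_mem _) (fun j => ?_), u,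
        fun i => ?_, ?_⟩
      · simpa using C_mem_HZ (c j)
      · convert hu i using 1; congr 1; ring
      · rw [hm2def, gens_append, gens_C]; simp
    · obtain ⟨u, hu, rfl⟩ := (hNE0 d (by omega)).exists_sum hx
      exact ⟨0, zero_mem _, u, hu, by simp⟩
  -- second syzygies
  set 𝓟 := kerGr (HF k e2) (gens m2) with h𝓟
  have hfr2 (d : ℤ) : Module.finrank k (HF k e2 d) =
      Module.finrank k (𝓟 d) + Module.finrank k (𝓝 d) := SES.finrank_add S2 d
  have hdim2 (d : ℤ) : Module.finrank k (HF k e2 d) =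
      (3 * a - 3) * Module.finrank k (HZ k (d - a - 1)) + 3 * Module.finrank k (HZ k (d - a - 2)) := by
    rw [finrank_HF, Fin.sum_univ_add]
    have h1 (i : Fin (3 * a - 3)) : d - (e2 (Fin.castAdd 3 i) : ℤ) = d - a - 1 := by
      rw [he2, Fin.append_left]; push_cast; ring
    have h2 (i : Fin 3) : d - (e2 (Fin.natAdd (3 * a - 3) i) : ℤ) = d - a - 2 := by
      rw [he2, Fin.append_right]; push_cast; ring
    congr 1
    · rw [Finset.sum_congr rfl fun i _ => by rw [h1 i]]; simp
    · rw [Finset.sum_congr rfl fun i _ => by rw [h2 i]]; simp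
  have hP0 : ∀ d < (a : ℤ) + 3, 𝓟 d = ⊥ := by
    intro d hd
    apply eq_bot_of_finrank
    have h := hfr2 d
    rw [hdim2] at h
    rcases lt_or_ge d (a + 1 : ℤ) with h1 | h1
    · rw [finrank_HZ_neg (show d - a - 1 < 0 by omega),
        finrank_HZ_neg (show d - a - 2 < 0 by omega)] at h
      omega
    · rcases eq_or_lt_of_le h1 with rfl | h1
      · rw [show (a : ℤ) + 1 - a - 1 = 0 by ring, finrank_HZ_zero,
          finrank_HZ_neg (show (a : ℤ) + 1 - a - 2 < 0 by omega), hN1] at h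
        omega
      · obtain rfl : d = a + 2 := by omega
        rw [show (a : ℤ) + 2 - a - 1 = 1 by ring, show (a : ℤ) + 2 - a - 2 = 0 by ring,
          finrank_HZ_zero, finrank_HZ_one, hN2] at h
        omega
  have hP3 : Module.finrank k (𝓟 ((a : ℤ) + 3)) = a := by
    have h := hfr2 ((a : ℤ) + 3)
    rw [hdim2, show (a : ℤ) + 3 - a - 1 = 2 by ring, show (a : ℤ) + 3 - a - 2 = 1 by ring,
          finrank_HZ_two, finrank_HZ_one] at h
    omega
  have hgrP : IsGrAll 𝓟 := (isGrAll_HF e2).kerGr _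
  have hPE0 : ∀ d, (a : ℤ) + 4 ≤ d → Ex (KD0 k) (KD1 k) 𝓟 d := fun d hd =>
    S2.ex_sub KD12 isLin_KD2 (ex_HF fun j => ex0_HZ (by
      refine Fin.addCases (fun i => ?_) (fun i => ?_) j
      · simp only [he2, Fin.append_left]; omega
      · simp only [he2, Fin.append_right]; omega)) (hNE1 _ (by omega))
  have hPE1 : ∀ d, Ex (KD1 k) (KD2 k) 𝓟 d := fun d =>
    S2.ex_sub KD23 isLin_KD3 (ex_HF fun _ => ex1_HZ _) (hNE2 _)
  obtain ⟨m3, hm3, hm3'⟩ := exists_basis_gens hP3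
  set e3 : Fin a → ℕ := fun _ => a + 3 with he3
  have S3 : SES (kerGr (HF k e3) (gens m3)) (HF k e3) 𝓟 (gens m3) := by
    refine gens_ses hgrP hP0 (fun j => by simpa [he3] using hm3 j) fun d hd x hx => ?_
    rcases eq_or_lt_of_le hd with rfl | hd
    · obtain ⟨c, rfl⟩ := hm3' x hx
      refine ⟨fun j => C (c j), mem_HF.2 fun j => ?_, 0, fun _ => zero_mem _, ?_⟩
      · simpa [he3] using C_mem_HZ (c j)
      · rw [gens_C]; simp
    · obtain ⟨u, hu, rfl⟩ := (hPE0 d (by omega)).exists_sum hx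
      exact ⟨0, zero_mem _, u, hu, by simp⟩
  have hF3 (d : ℤ) : Module.finrank k (HF k e3 d) = a * Module.finrank k (HZ k (d - (a + 3))) := by
    have := finrank_HF_const (k := k) a (a + 3) d
    rwa [Nat.cast_add, Nat.cast_ofNat] at this
  have hQ0 : ∀ t : ℕ, kerGr (HF k e3) (gens m3) ((a : ℤ) + 3 + t) = ⊥ := by
    intro t
    induction t with
    | zero =>
      apply eq_bot_of_finrank
      have h := SES.finrank_add S3 ((a : ℤ) + 3 + (0 : ℕ))
      rw [Nat.cast_zero, add_zero] at h ⊢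
      rw [hF3, hP3, sub_self, finrank_HZ_zero] at h
      omega
    | succ t ih =>
      rw [eq_bot_iff]
      intro x hx
      have hex : Ex (KD0 k) (KD1 k) (kerGr (HF k e3) (gens m3)) ((a : ℤ) + 3 + (t + 1 : ℕ)) :=
        S3.ex_sub KD12 isLin_KD2 (ex_HF fun j => ex0_HZ (by simp only [he3]; push_cast; omega))
          (hPE1 _)
      obtain ⟨u, hu, rfl⟩ := hex.exists_sum hx
      rw [show (a : ℤ) + 3 + (t + 1 : ℕ) - 1 = a + 3 + t by push_cast; ring, ih] at hu
      simp only [Submodule.mem_bot] at hu ⊢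
      simp [hu]
  have hQ : ∀ d, kerGr (HF k e3) (gens m3) d = ⊥ := by
    intro d
    rcases lt_or_ge d (a + 3 : ℤ) with hd | hd
    · apply eq_bot_of_finrank
      have h := SES.finrank_add S3 d
      rw [hF3, finrank_HZ_neg (show d - (a + 3) < 0 by omega)] at h
      omega
    · obtain ⟨t, ht⟩ := Int.eq_ofNat_of_zero_le (show 0 ≤ d - (a + 3) by omega)
      obtain rfl : d = a + 3 + t := by omega
      exact hQ0 t
  -- assembling
  choose g hg hgm hgv using fun j => mem_vanGr hv (hm1 j)
  have hcl1 : ∀ w : Fin (2 * a) → R4 k, gens m1 w = 0 → ∀ d : ℤ, gens m1 (cF e1 d w) = 0 := by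
    intro w hw d
    simp only [gens_apply, ← hgm, ← mkS_mul, ← map_sum, mkS_eq_zero] at hw ⊢
    have := cZ_mem_span hf hw d
    rw [map_sum] at this
    convert this using 2 with j
    rw [cZ_mul' _ (hg j)]
    rfl
  have hm2HF : ∀ j, m2 j ∈ HF k e1 (e2 j) := fun j => (hm2 j).1
  have hm3HF : ∀ j, m3 j ∈ HF k e2 (e3 j) := fun j => by simpa [he3] using (hm3 j).1
  have hcl2 : ∀ w : Fin (3 * a - 3 + 3) → R4 k, gens m2 w = 0 → ∀ d : ℤ, gens m2 (cF e2 d w) = 0 := by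
    intro w hw d
    rw [gens_cF hm2HF, hw]
    ext1 j; simp [cF]
  have hcl3 : ∀ w : Fin a → R4 k, gens m3 w = 0 → ∀ d : ℤ, gens m3 (cF e3 d w) = 0 := by
    intro w hw d
    rw [gens_cF hm3HF, hw]
    ext1 j; simp [cF]
  have hsum1 (w : Fin (2 * a) → R4 k) : (∑ j, w j * g j) ∈ Ideal.span {f} ↔ gens m1 w = 0 := by
    simp only [gens_apply, ← hgm, ← mkS_mul, ← map_sum, mkS_eq_zero]
  have hsum2 (u : Fin (3 * a - 3 + 3) → R4 k) (j) : (∑ i, u i * m2 i j) = gens m2 u j := by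
    simp [gens_apply]
  have hsum3 (u : Fin a → R4 k) (j) : (∑ i, u i * m3 i j) = gens m3 u j := by
    simp [gens_apply]
  refine ⟨g, m2, m3, fun j => ⟨?_, mem_HZ_nat.1 (hg j)⟩, fun x hx => ?_, fun i j => ?_,
    fun i j => ?_, fun w => ?_, fun u => ?_, fun t ht => ?_⟩
  · rw [hI]
    intro d p
    rw [cZ_of_mem (hg j)]
    split_ifs
    · exact hgv j p
    · simp
  · rw [hI] at hx
    choose w _ hw using fun d : ℕ => S1.surj d _ (mkS_mem_vanGr hv (cZ_mem d x) (hx d))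
    refine ⟨∑ d ∈ Finset.range (x.totalDegree + 1), w d, ?_⟩
    have key : gens m1 (∑ d ∈ Finset.range (x.totalDegree + 1), w d) = mkS f x := by
      rw [map_sum]
      simp only [hw]
      rw [← map_sum, sum_cZ]
    rw [← mkS_eq_mkS, ← key, gens_apply]
    simp [← hgm, mkS_mul]
  · refine entryOk_of_mem ?_ (mem_HF.1 (hm2HF i) j)
    refine Fin.addCases (fun i => ?_) (fun i => ?_) i <;> simp [he1, he2]
  · refine entryOk_of_mem ?_ (mem_HF.1 (hm3HF i) j)
    refine Fin.addCases (fun i => ?_) (fun i => ?_) j <;> simp [he3, he2]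
  · rw [hsum1]
    constructor
    · intro hw
      obtain ⟨u, hu⟩ := exists_gens_eq hcl1 S2 hw
      exact ⟨u, fun j => by rw [hsum2, hu]⟩
    · rintro ⟨u, hu⟩
      obtain rfl : w = gens m2 u := funext fun j => by rw [hu, hsum2]
      rw [gens_apply m2, map_sum]
      refine Finset.sum_eq_zero fun i _ => ?_
      have : gens m1 (m2 i) = 0 := (hm2 i).2
      rw [map_smul, this, smul_zero]
  · simp only [hsum2, hsum3]
    constructor
    · intro hu
      obtain ⟨t, ht⟩ := exists_gens_eq hcl2 S3 (funext hu)
      exact ⟨t, fun i => by rw [ht]⟩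
    · rintro ⟨t, ht⟩ j
      obtain rfl : u = gens m3 t := funext ht
      have : gens m2 (gens m3 t) = 0 := by
        rw [gens_apply m3, map_sum]
        refine Finset.sum_eq_zero fun i _ => ?_
        have : gens m2 (m3 i) = 0 := (hm3 i).2
        rw [map_smul, this, smul_zero]
      rw [this]; rfl
  · simp only [hsum3] at ht
    exact eq_zero_of_kerGr hcl3 hQ (funext ht)

end CriterionResolution

section Genericity

variable {k : Type} [Field k] {σ κ W : Type} [AddCommGroup W] [Module k W]

/-- The specialization at a point of a linear family of vectors of polynomials. -/
noncomputable def special (L : W →ₗ[k] (κ → MvPolynomial σ k)) (x : σ → k) : W →ₗ[k] (κ → k) :=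
  (LinearMap.compLeft (aeval x).toLinearMap κ) ∘ₗ L

theorem special_apply (L : W →ₗ[k] (κ → MvPolynomial σ k)) (x : σ → k) (w : W) (c : κ) :
    special L x w c = eval x (L w c) := rfl

/-- The rank of a specialization is lower semicontinuous. -/
theorem exists_rank_le [Fintype κ] (L : W →ₗ[k] (κ → MvPolynomial σ k)) (x0 : σ → k) :
    ∃ G : MvPolynomial σ k, eval x0 G ≠ 0 ∧ ∀ x, eval x G ≠ 0 →
      Module.finrank k (LinearMap.range (special L x0)) ≤
        Module.finrank k (LinearMap.range (special L x)) := by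
  classical
  set r := Module.finrank k (LinearMap.range (special L x0)) with hr
  let b := Module.finBasis k (LinearMap.range (special L x0))
  choose w hw using fun j => (b j).2
  have hli : LinearIndependent k fun j => special L x0 (w j) := by
    have := b.linearIndependent.map' (LinearMap.range (special L x0)).subtype
      (Submodule.ker_subtype _)
    simp only [hw]
    exact this
  obtain ⟨l, hl⟩ := LinearMap.exists_leftInverse_of_injective
    (Fintype.linearCombination k fun j => special L x0 (w j))
    (LinearMap.ker_eq_bot.2 hli.fintypeLinearCombination_injective)
  let M : Matrix (Fin r) (Fin r) (MvPolynomial σ k) :=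
    Matrix.of fun i j => ∑ c, C (l (Pi.single c 1) i) * L (w j) c
  have hM (x : σ → k) : (eval x).mapMatrix M = Matrix.of fun i j => l (special L x (w j)) i := by
    ext i j
    have h1 : special L x (w j) = ∑ c, special L x (w j) c • Pi.single c (1 : k) := by
      ext c; simp [Finset.sum_apply, Pi.single_apply]
    rw [Matrix.of_apply, h1, map_sum]
    simp [M, special_apply, mul_comm]
  refine ⟨M.det, ?_, fun x hx => ?_⟩
  · rw [RingHom.map_det, hM]
    have : (Matrix.of fun i j => l (special L x0 (w j)) i) = (1 : Matrix (Fin r) (Fin r) k) := by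
      ext i j
      have := congrFun (LinearMap.congr_fun hl (Pi.single j 1)) i
      simp only [LinearMap.comp_apply, Fintype.linearCombination_apply_single, one_smul,
        LinearMap.id_apply] at this
      rw [Matrix.of_apply, this, Matrix.one_apply, Pi.single_apply]
    rw [this, Matrix.det_one]
    exact one_ne_zero
  · rw [RingHom.map_det, hM] at hx
    have h1 := Matrix.linearIndependent_cols_of_det_ne_zero hx
    have h2 : LinearIndependent k fun j => special L x (w j) := LinearIndependent.of_comp l h1
    have h3 : LinearIndependent k fun j => (special L x).rangeRestrict (w j) :=
      LinearIndependent.of_comp (LinearMap.range (special L x)).subtype h2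
    simpa using h3.fintype_card_le_finrank

/-- Enough independent functions are separated by suitable points. -/
theorem exists_independent_points {T : Type} [FiniteDimensional k W] (E : W →ₗ[k] (T → k)) :
    ∀ t : ℕ, t + Module.finrank k (LinearMap.ker E) ≤ Module.finrank k W →
      ∃ x : Fin t → T, ∀ c : Fin t → k, ∃ w, ∀ i, E w (x i) = c i
  | 0, _ => ⟨Fin.elim0, fun _ => ⟨0, fun i => i.elim0⟩⟩
  | t + 1, ht => by
    obtain ⟨x, hx⟩ := exists_independent_points E t (by omega)
    let φ : W →ₗ[k] (Fin t → k) := LinearMap.pi fun i => LinearMap.proj (x i) ∘ₗ E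
    have h1 := LinearMap.finrank_range_add_finrank_ker φ
    have h2 : Module.finrank k (LinearMap.range φ) ≤ t := by
      simpa using Submodule.finrank_le (LinearMap.range φ)
    obtain ⟨w, hw, hw2⟩ : ∃ w ∈ LinearMap.ker φ, w ∉ LinearMap.ker E := by
      by_contra! h
      have := Submodule.finrank_mono (show LinearMap.ker φ ≤ LinearMap.ker E from h)
      omega
    obtain ⟨y, hy⟩ : ∃ y, E w y ≠ 0 := by
      by_contra! h
      exact hw2 (funext h)
    have hw' (i) : E w (x i) = 0 := congrFun hw i
    refine ⟨Fin.snoc x y, fun c => ?_⟩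
    obtain ⟨u, hu⟩ := hx fun i => c i.castSucc
    refine ⟨u + ((c (Fin.last t) - E u y) / E w y) • w, fun i => ?_⟩
    refine Fin.lastCases ?_ (fun i => ?_) i
    · simp [hy]
    · simp [hw', hu]

end Genericity

section ConeOpen

variable {k : Type} [Field k] {ι : Type} {f : R4 k}

/-- A property of tuples of vectors in the cone `f = 0` is open if it persists wherever a
suitable polynomial does not vanish. -/
def OpenOnCone (f : R4 k) (P : (ι → Fin 4 → k) → Prop) : Prop :=
  ∀ v0, (∀ p, eval (v0 p) f = 0) → P v0 → ∃ G : MvPolynomial (ι × Fin 4) k,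
    eval (fun q => v0 q.1 q.2) G ≠ 0 ∧
      ∀ v : ι → Fin 4 → k, (∀ p, eval (v p) f = 0) → eval (fun q => v q.1 q.2) G ≠ 0 → P v

theorem OpenOnCone.and {P Q : (ι → Fin 4 → k) → Prop} (hP : OpenOnCone f P)
    (hQ : OpenOnCone f Q) : OpenOnCone f fun v => P v ∧ Q v := by
  rintro v0 hv ⟨h1, h2⟩
  obtain ⟨G, hG, hG'⟩ := hP v0 hv h1
  obtain ⟨H, hH, hH'⟩ := hQ v0 hv h2
  refine ⟨G * H, by simpa using ⟨hG, hH⟩, fun v hv h => ?_⟩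
  rw [map_mul, mul_ne_zero_iff] at h
  exact ⟨hG' v hv h.1, hH' v hv h.2⟩

theorem OpenOnCone.congr {P Q : (ι → Fin 4 → k) → Prop} (hP : OpenOnCone f P)
    (h : ∀ v, (∀ p, eval (v p) f = 0) → (P v ↔ Q v)) : OpenOnCone f Q := by
  intro v0 hv hQ
  obtain ⟨G, hG, hG'⟩ := hP v0 hv ((h v0 hv).2 hQ)
  exact ⟨G, hG, fun v hv hvG => (h v hv).1 (hG' v hv hvG)⟩

theorem eval_rename_mk (v : ι → Fin 4 → k) (p : ι) (q : R4 k) :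
    eval (fun q => v q.1 q.2) (rename (Prod.mk p) q) = eval (v p) q := by
  rw [eval_rename]; rfl

theorem openOnCone_eval_ne_zero [Fintype ι] (g : R4 k) :
    OpenOnCone f fun v : ι → Fin 4 → k => ∀ p, eval (v p) g ≠ 0 := by
  intro v0 _ h
  refine ⟨∏ p, rename (Prod.mk p) g, ?_, fun v _ hv p => ?_⟩
  · rw [map_prod, Finset.prod_ne_zero_iff]
    exact fun p _ => by rw [eval_rename_mk]; exact h p
  · rw [map_prod, Finset.prod_ne_zero_iff] at hv
    simpa only [eval_rename_mk] using hv p (Finset.mem_univ p)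

theorem openOnCone_ne_zero [Fintype ι] :
    OpenOnCone f fun v : ι → Fin 4 → k => ∀ p, v p ≠ 0 := by
  intro v0 _ h
  choose i hi using fun p => Function.ne_iff.1 (h p)
  refine ⟨∏ p, X (p, i p), ?_, fun v _ hv p => ?_⟩
  · rw [map_prod, Finset.prod_ne_zero_iff]
    simpa using hi
  · rw [map_prod, Finset.prod_ne_zero_iff] at hv
    have := hv p (Finset.mem_univ p)
    intro h0
    simp [h0] at this

theorem openOnCone_rank {κ W : Type} [Fintype κ] [AddCommGroup W] [Module k W]
    (L : W →ₗ[k] (κ → MvPolynomial (ι × Fin 4) k)) (r : ℕ) :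
    OpenOnCone f fun v : ι → Fin 4 → k =>
      r ≤ Module.finrank k (LinearMap.range (special L fun q => v q.1 q.2)) := by
  intro v0 _ h
  obtain ⟨G, hG, hG'⟩ := exists_rank_le L fun q => v0 q.1 q.2
  exact ⟨G, hG, fun v _ hv => h.trans (hG' _ hv)⟩

theorem exists_cone_eval_ne_zero [IsAlgClosed k] (hirr : Irreducible f) {g : R4 k}
    (hg : g ∉ Ideal.span {f}) : ∃ x, eval x f = 0 ∧ eval x g ≠ 0 := by
  by_contra! h
  have := isPrime_span hirr
  apply hg
  rw [← MvPolynomial.IsPrime.vanishingIdeal_zeroLocus (K := k) (Ideal.span {f})]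
  intro x hx
  exact h x (hx f (Ideal.subset_span rfl))

theorem notMem_span_of_eval {g : R4 k} {x : Fin 4 → k} (hx : eval x f = 0) (hg : eval x g ≠ 0) :
    g ∉ Ideal.span {f} := by
  rw [Ideal.mem_span_singleton]
  rintro ⟨q, rfl⟩
  simp [hx] at hg

/-- The powers of the cone over an irreducible hypersurface are irreducible. -/
theorem exists_common_eval_ne_zero [IsAlgClosed k] [Fintype ι] (hirr : Irreducible f)
    {G H : MvPolynomial (ι × Fin 4) k} {v w : ι → Fin 4 → k} (hv : ∀ p, eval (v p) f = 0)
    (hw : ∀ p, eval (w p) f = 0) (hG : eval (fun q => v q.1 q.2) G ≠ 0)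
    (hH : eval (fun q => w q.1 q.2) H ≠ 0) :
    ∃ u : ι → Fin 4 → k, (∀ p, eval (u p) f = 0) ∧ eval (fun q => u q.1 q.2) G ≠ 0 ∧
      eval (fun q => u q.1 q.2) H ≠ 0 := by
  classical
  have key (s : Finset ι) : ∃ v w : ι → Fin 4 → k, (∀ p, eval (v p) f = 0) ∧
      (∀ p, eval (w p) f = 0) ∧ eval (fun q => v q.1 q.2) G ≠ 0 ∧
      eval (fun q => w q.1 q.2) H ≠ 0 ∧ ∀ p ∈ s, v p = w p := by
    induction s using Finset.induction_on with
    | empty => exact ⟨v, w, hv, hw, hG, hH, by simp⟩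
    | insert p s hp ih =>
      obtain ⟨v, w, hv, hw, hG, hH, hs⟩ := ih
      let sub (v : ι → Fin 4 → k) : MvPolynomial (ι × Fin 4) k →+* R4 k :=
        eval₂Hom C fun q => if q.1 = p then X q.2 else C (v q.1 q.2)
      have hsub (v : ι → Fin 4 → k) (x : Fin 4 → k) (F) :
          eval x (sub v F) = eval (fun q => Function.update v p x q.1 q.2) F := by
        have : (eval x).comp (sub v) = eval (fun q => Function.update v p x q.1 q.2) := by
          ext q
          · simp [sub]
          · by_cases h : q.1 = p <;> simp [sub, h, Function.update_apply]
        exact RingHom.congr_fun this F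
      have h1 : sub v G ∉ Ideal.span {f} := notMem_span_of_eval (hv p) (by
        rw [hsub, Function.update_eq_self]; exact hG)
      have h2 : sub w H ∉ Ideal.span {f} := notMem_span_of_eval (hw p) (by
        rw [hsub, Function.update_eq_self]; exact hH)
      obtain ⟨x, hx, hx2⟩ := exists_cone_eval_ne_zero hirr
        (g := sub v G * sub w H) (fun h => ((isPrime_span hirr).mem_or_mem h).elim h1 h2)
      rw [map_mul, mul_ne_zero_iff, hsub, hsub] at hx2
      refine ⟨Function.update v p x, Function.update w p x, fun q => ?_, fun q => ?_, hx2.1,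
        hx2.2, fun q hq => ?_⟩
      · by_cases h : q = p <;> simp [h, hx, hv]
      · by_cases h : q = p <;> simp [h, hx, hw]
      · by_cases h : q = p
        · simp [h]
        · simpa [h] using hs q ((Finset.mem_insert.1 hq).resolve_left h)
  obtain ⟨v, w, hv, _, hG, hH, hvw⟩ := key Finset.univ
  obtain rfl : v = w := funext fun p => hvw p (Finset.mem_univ p)
  exact ⟨v, hv, hG, hH⟩

theorem OpenOnCone.exists_and [IsAlgClosed k] [Fintype ι] (hirr : Irreducible f)
    {P Q : (ι → Fin 4 → k) → Prop} (hP : OpenOnCone f P) (hQ : OpenOnCone f Q)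
    (h1 : ∃ v, (∀ p, eval (v p) f = 0) ∧ P v) (h2 : ∃ v, (∀ p, eval (v p) f = 0) ∧ Q v) :
    ∃ v, (∀ p, eval (v p) f = 0) ∧ P v ∧ Q v := by
  obtain ⟨v, hv, hPv⟩ := h1
  obtain ⟨w, hw, hQw⟩ := h2
  obtain ⟨G, hG, hG'⟩ := hP v hv hPv
  obtain ⟨H, hH, hH'⟩ := hQ w hw hQw
  obtain ⟨u, hu, h1, h2⟩ := exists_common_eval_ne_zero hirr hv hw hG hH
  exact ⟨u, hu, hG' u hu h1, hH' u hu h2⟩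

end ConeOpen

section RankConditions

variable {k : Type} [Field k] {ι : Type} {f : R4 k}

theorem EvSur.openOnCone [Fintype ι] (d : ℤ) :
    OpenOnCone f fun v : ι → Fin 4 → k => EvSur d v := by
  let L : HZ k d →ₗ[k] (ι → MvPolynomial (ι × Fin 4) k) :=
    LinearMap.pi fun p => (rename (Prod.mk p)).toLinearMap ∘ₗ (HZ k d).subtype
  refine (openOnCone_rank L (Fintype.card ι)).congr fun v _ => ?_
  have hL (w : HZ k d) (p : ι) : special L (fun q => v q.1 q.2) w p = eval (v p) w.1 :=
    eval_rename_mk v p w.1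
  constructor
  · intro h c
    have h1 : LinearMap.range (special L fun q => v q.1 q.2) = ⊤ :=
      Submodule.eq_top_of_finrank_eq (le_antisymm (Submodule.finrank_le _) (by simpa using h))
    obtain ⟨w, hw⟩ := LinearMap.range_eq_top.1 h1 c
    exact ⟨w.1, w.2, fun p => by rw [← hL, hw]⟩
  · intro h
    have h1 : LinearMap.range (special L fun q => v q.1 q.2) = ⊤ := by
      refine LinearMap.range_eq_top.2 fun c => ?_
      obtain ⟨p, hp, hp2⟩ := h c
      exact ⟨⟨p, hp⟩, funext fun i => by rw [hL]; exact hp2 i⟩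
    rw [h1, finrank_top]; simp

/-- The space of vectors of forms of degree `d`. -/
noncomputable def formVec (k : Type) [Field k] (d : ℤ) : Submodule k (Fin 4 → R4 k) := HF k (fun _ : Fin 4 => 0) d

theorem mem_formVec {d : ℤ} {g : Fin 4 → R4 k} : g ∈ formVec k d ↔ ∀ i, g i ∈ HZ k d := by
  simp [formVec, mem_HF]

instance (d : ℤ) : FiniteDimensional k (formVec k d) := by unfold formVec; infer_instance

/-- The space of linear syzygies modulo `f` among the coordinates in degree `d`. -/
noncomputable def syzVec (f : R4 k) (d : ℤ) : Submodule k (Fin 4 → R4 k) :=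
  formVec k d ⊓ ((Ideal.span {f}).restrictScalars k).comap
    (∑ i, LinearMap.mulLeft k (X i : R4 k) ∘ₗ LinearMap.proj i)

theorem mem_syzVec {d : ℤ} {g : Fin 4 → R4 k} :
    g ∈ syzVec f d ↔ (∀ i, g i ∈ HZ k d) ∧ ∑ i, X i * g i ∈ Ideal.span {f} := by
  simp [syzVec, mem_formVec]

instance (d : ℤ) : FiniteDimensional k (syzVec f d) :=
  Submodule.finiteDimensional_of_le (inf_le_left : _ ≤ formVec k d)

/-- The values of a vector of forms at the points. -/
noncomputable def evVec (v : ι → Fin 4 → k) : (Fin 4 → R4 k) →ₗ[k] (ι × Fin 4 → k) :=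
  LinearMap.pi fun q => (aeval (v q.1)).toLinearMap ∘ₗ LinearMap.proj q.2

theorem evVec_apply (v : ι → Fin 4 → k) (g : Fin 4 → R4 k) (q : ι × Fin 4) :
    evVec v g q = eval (v q.1) (g q.2) := rfl

/-- The generic version of `evVec`. -/
noncomputable def genVec (k ι : Type) [Field k] :
    (Fin 4 → R4 k) →ₗ[k] (ι × Fin 4 → MvPolynomial (ι × Fin 4) k) :=
  LinearMap.pi fun q => (rename (Prod.mk q.1)).toLinearMap ∘ₗ LinearMap.proj q.2

theorem genVec_apply (g : Fin 4 → R4 k) (q : ι × Fin 4) :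
    genVec k ι g q = rename (Prod.mk q.1) (g q.2) := rfl

/-- The values admissible for linear syzygies. -/
noncomputable def tangentVec (v : ι → Fin 4 → k) : Submodule k (ι × Fin 4 → k) :=
  LinearMap.ker (LinearMap.pi fun p => ∑ i, v p i • LinearMap.proj (p, i) :
    (ι × Fin 4 → k) →ₗ[k] (ι → k))

theorem mem_tangentVec {v : ι → Fin 4 → k} {ξ : ι × Fin 4 → k} :
    ξ ∈ tangentVec v ↔ ∀ p, ∑ i, ξ (p, i) * v p i = 0 := by
  simp [tangentVec, funext_iff, mul_comm]

theorem finrank_tangentVec [Fintype ι] {v : ι → Fin 4 → k} (hv0 : ∀ p, v p ≠ 0) :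
    Module.finrank k (tangentVec v) = 3 * Fintype.card ι := by
  classical
  have h := LinearMap.finrank_range_add_finrank_ker
    (LinearMap.pi fun p => ∑ i, v p i • LinearMap.proj (p, i) : (ι × Fin 4 → k) →ₗ[k] (ι → k))
  choose i hi using fun p => Function.ne_iff.1 (hv0 p)
  rw [LinearMap.range_eq_top.2, finrank_top] at h
  · simp only [Module.finrank_fintype_fun_eq_card, Fintype.card_prod, Fintype.card_fin] at h
    unfold tangentVec
    omega
  · intro c
    refine ⟨fun q => if q.2 = i q.1 then c q.1 / v q.1 (i q.1) else 0, funext fun p => ?_⟩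
    simp only [LinearMap.pi_apply, LinearMap.sum_apply, LinearMap.smul_apply, LinearMap.proj_apply,
      smul_eq_mul, mul_ite, mul_zero, Finset.sum_ite_eq', Finset.mem_univ, if_true]
    exact mul_div_cancel₀ _ (hi p)

theorem evVec_mem_tangentVec {v : ι → Fin 4 → k} (hv : ∀ p, eval (v p) f = 0) {d : ℤ}
    {g : Fin 4 → R4 k} (hg : g ∈ syzVec f d) : evVec v g ∈ tangentVec v := by
  rw [mem_tangentVec]
  intro p
  obtain ⟨q, hq⟩ := Ideal.mem_span_singleton.1 (mem_syzVec.1 hg).2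
  have := congrArg (eval (v p)) hq
  simpa [hv, evVec_apply, mul_comm] using this

theorem syzSur_iff_rank [Fintype ι] {v : ι → Fin 4 → k} (hv : ∀ p, eval (v p) f = 0)
    (hv0 : ∀ p, v p ≠ 0) {d : ℤ} : SyzSur f d v ↔
      3 * Fintype.card ι ≤ Module.finrank k (LinearMap.range ((evVec v).domRestrict (syzVec f d))) := by
  have hle : LinearMap.range ((evVec v).domRestrict (syzVec f d)) ≤ tangentVec v := by
    rintro _ ⟨g, rfl⟩
    exact evVec_mem_tangentVec hv g.2
  constructor
  · intro h
    rw [← finrank_tangentVec hv0]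
    refine Submodule.finrank_mono fun ξ hξ => ?_
    obtain ⟨g, hg, hgX, hgv⟩ := h (fun p i => ξ (p, i)) (mem_tangentVec.1 hξ)
    exact ⟨⟨g, mem_syzVec.2 ⟨hg, hgX⟩⟩, funext fun q => hgv q.1 q.2⟩
  · intro h ξ hξ
    have heq := Submodule.eq_of_le_of_finrank_le hle (by rwa [finrank_tangentVec hv0])
    obtain ⟨g, hg⟩ : (fun q : ι × Fin 4 => ξ q.1 q.2) ∈
        LinearMap.range ((evVec v).domRestrict (syzVec f d)) := by
      rw [heq, mem_tangentVec]
      exact hξ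
    exact ⟨g, (mem_syzVec.1 g.2).1, (mem_syzVec.1 g.2).2, fun p i => congrFun hg (p, i)⟩

theorem SyzSur.openOnCone [Fintype ι] (d : ℤ) :
    OpenOnCone f fun v : ι → Fin 4 → k => SyzSur f d v ∧ ∀ p, v p ≠ 0 := by
  refine ((openOnCone_rank ((genVec k ι).domRestrict (syzVec f d)) (3 * Fintype.card ι)).and
    openOnCone_ne_zero).congr fun v hv => and_congr_left fun hv0 => ?_
  rw [syzSur_iff_rank hv hv0]
  have : special ((genVec k ι).domRestrict (syzVec f d)) (fun q => v q.1 q.2) =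
      (evVec v).domRestrict (syzVec f d) := by
    ext g q
    exact eval_rename_mk v q.1 (g.1 q.2)
  rw [this]

/-- The multiples of the position vector modulo `f`. -/
noncomputable def radialVec (f : R4 k) (d : ℤ) : Submodule k (Fin 4 → R4 k) :=
  formVec k d ⊓
    ((HZ k (d - 1)).map (LinearMap.pi fun i => LinearMap.mulLeft k (X i : R4 k)) ⊔
      Submodule.pi Set.univ fun _ => (Ideal.span {f}).restrictScalars k)

theorem mem_radialVec {d : ℤ} {g : Fin 4 → R4 k} : g ∈ radialVec f d ↔
    (∀ i, g i ∈ HZ k d) ∧ ∃ e ∈ HZ k (d - 1), ∀ i, g i - X i * e ∈ Ideal.span {f} := by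
  rw [radialVec, Submodule.mem_inf, mem_formVec, Submodule.mem_sup]
  refine and_congr_right fun _ => ⟨?_, ?_⟩
  · rintro ⟨_, ⟨e, he, rfl⟩, z, hz, rfl⟩
    refine ⟨e, he, fun i => ?_⟩
    simpa using hz i trivial
  · rintro ⟨e, he, h⟩
    exact ⟨_, ⟨e, he, rfl⟩, fun i => g i - X i * e, fun i _ => h i, by ext1 i; simp⟩

/-- The map detecting proportionality to the position vector, generically. -/
noncomputable def genRadial (k ι : Type) [Field k] :
    (Fin 4 → R4 k) →ₗ[k] (ι × Fin 4 × Fin 4 → MvPolynomial (ι × Fin 4) k) :=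
  LinearMap.pi fun q =>
    LinearMap.mulRight k (X (q.1, q.2.2)) ∘ₗ LinearMap.proj (q.1, q.2.1) ∘ₗ genVec k ι -
    LinearMap.mulRight k (X (q.1, q.2.1)) ∘ₗ LinearMap.proj (q.1, q.2.2) ∘ₗ genVec k ι

theorem RadialOnly.openOnCone [Fintype ι] (d : ℤ) :
    OpenOnCone f fun v : ι → Fin 4 → k => RadialOnly f d v := by
  set L := (genRadial k ι).domRestrict (formVec k d) with hL
  set T := (radialVec f d).comap (formVec k d).subtype with hT
  have hker (v : ι → Fin 4 → k) (g : formVec k d) :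
      g ∈ LinearMap.ker (special L fun q => v q.1 q.2) ↔
        ∀ p i j, eval (v p) (g.1 i) * v p j = eval (v p) (g.1 j) * v p i := by
    have h1 (q : ι × Fin 4 × Fin 4) : special L (fun q => v q.1 q.2) g q =
        eval (v q.1) (g.1 q.2.1) * v q.1 q.2.2 - eval (v q.1) (g.1 q.2.2) * v q.1 q.2.1 := by
      rw [special_apply, hL]
      simp only [genRadial, LinearMap.domRestrict_apply, LinearMap.pi_apply, LinearMap.sub_apply,
        LinearMap.comp_apply, LinearMap.proj_apply, LinearMap.mulRight_apply, genVec_apply, map_sub,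
        map_mul, eval_rename_mk, eval_X]
    rw [LinearMap.mem_ker, funext_iff]
    simp only [h1, Pi.zero_apply, sub_eq_zero, Prod.forall]
  have hTle (v : ι → Fin 4 → k) (hv : ∀ p, eval (v p) f = 0) :
      T ≤ LinearMap.ker (special L fun q => v q.1 q.2) := by
    intro g hg
    obtain ⟨_, e, _, he⟩ := mem_radialVec.1 (show g.1 ∈ radialVec f d from hg)
    rw [hker]
    intro p i j
    have h1 (i) : eval (v p) (g.1 i) = v p i * eval (v p) e := by
      obtain ⟨q, hq⟩ := Ideal.mem_span_singleton.1 (he i)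
      have := congrArg (eval (v p)) hq
      simpa [hv, sub_eq_zero] using this
    rw [h1, h1]; ring
  have hiff (v : ι → Fin 4 → k) :
      RadialOnly f d v ↔ LinearMap.ker (special L fun q => v q.1 q.2) ≤ T := by
    constructor
    · intro h g hg
      exact mem_radialVec.2 ⟨mem_formVec.1 g.2, h g.1 (mem_formVec.1 g.2) ((hker v g).1 hg)⟩
    · intro h g hg hgv
      exact (mem_radialVec.1
        (h ((hker v ⟨g, mem_formVec.2 hg⟩).2 hgv) : g ∈ radialVec f d)).2
  refine (openOnCone_rank L (Module.finrank k (formVec k d) - Module.finrank k T)).congr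
    fun v hv => ?_
  have h1 := LinearMap.finrank_range_add_finrank_ker (special L fun q => v q.1 q.2)
  have h2 := Submodule.finrank_mono (hTle v hv)
  rw [hiff]
  constructor
  · intro h
    exact (Submodule.eq_of_le_of_finrank_le (hTle v hv) (by omega)).ge
  · intro h
    have := Submodule.finrank_mono h
    omega

end RankConditions

section LinearSubstitution

variable {k : Type} [Field k]

/-- The linear change of coordinates given by a matrix. -/
noncomputable def linSub (A : Matrix (Fin 4) (Fin 4) k) : R4 k →ₐ[k] R4 k :=
  aeval fun i => ∑ j, C (A i j) * X j

theorem linSub_X (A : Matrix (Fin 4) (Fin 4) k) (i : Fin 4) :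
    linSub A (X i) = ∑ j, C (A i j) * X j := aeval_X _ _

theorem eval_linSub (A : Matrix (Fin 4) (Fin 4) k) (x : Fin 4 → k) (p : R4 k) :
    eval x (linSub A p) = eval (A.mulVec x) p := by
  have : (aeval x).comp (linSub A) = aeval (A.mulVec x) := by
    ext i
    simp [linSub_X, Matrix.mulVec, dotProduct]
  exact AlgHom.congr_fun this p

theorem linSub_linSub [Infinite k] {A B : Matrix (Fin 4) (Fin 4) k} (h : B * A = 1) (p : R4 k) :
    linSub A (linSub B p) = p := by
  refine MvPolynomial.funext fun x => ?_
  rw [eval_linSub, eval_linSub, Matrix.mulVec_mulVec, h, Matrix.one_mulVec]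

theorem linSub_mem_HZ (A : Matrix (Fin 4) (Fin 4) k) {d : ℤ} {p : R4 k} (hp : p ∈ HZ k d) :
    linSub A p ∈ HZ k d := by
  rcases lt_or_ge d 0 with hd | hd
  · rw [eq_zero_of_mem_HZ_neg hd hp, map_zero]
    exact zero_mem _
  · obtain ⟨n, rfl⟩ := Int.eq_ofNat_of_zero_le hd
    rw [mem_HZ_nat] at hp ⊢
    rw [← one_mul n]
    refine hp.aeval _ fun i => mem_HZ_nat.1 ?_
    exact sum_mem fun j _ => C_mul_mem_HZ _ (X_mem_HZ j)

theorem linSub_mem_span (A : Matrix (Fin 4) (Fin 4) k) {f p : R4 k} (hp : p ∈ Ideal.span {f}) :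
    linSub A p ∈ Ideal.span {linSub A f} := by
  rw [Ideal.mem_span_singleton] at hp ⊢
  exact map_dvd _ hp

theorem linSub_irreducible [Infinite k] {A B : Matrix (Fin 4) (Fin 4) k} (h : B * A = 1) {f : R4 k}
    (hf : Irreducible f) : Irreducible (linSub A f) := by
  have h' : A * B = 1 := mul_eq_one_comm.1 h
  let e : R4 k ≃* R4 k :=
    { toFun := linSub A, invFun := linSub B, left_inv := linSub_linSub h',
      right_inv := linSub_linSub h, map_mul' := map_mul _ }
  exact (MulEquiv.irreducible_iff e).2 hf

variable {ι : Type} {f : R4 k} {v : ι → Fin 4 → k} {A B : Matrix (Fin 4) (Fin 4) k} {d : ℤ}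

theorem sum_C_mul_C {A B : Matrix (Fin 4) (Fin 4) k} (h : A * B = 1) (i j : Fin 4) :
    ∑ l, C (A i l) * C (B l j) = (if i = j then 1 else 0 : R4 k) := by
  have := congrArg (C : k → R4 k) (congrFun (congrFun h i) j)
  rw [Matrix.mul_apply, map_sum, Matrix.one_apply] at this
  simp only [map_mul] at this
  rw [this]
  split_ifs <;> simp

theorem RadialOnly.linSub [Infinite k] (h : B * A = 1) (H : RadialOnly (linSub A f) d v) :
    RadialOnly f d fun p => A.mulVec (v p) := by
  have h' : A * B = 1 := mul_eq_one_comm.1 h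
  intro g hg hgv
  have hB (p) : B.mulVec (A.mulVec (v p)) = v p := by
    rw [Matrix.mulVec_mulVec, h, Matrix.one_mulVec]
  obtain ⟨e, he, hge⟩ := H (fun j => ∑ i, C (B j i) * _root_.linSub A (g i))
    (fun j => sum_mem fun i _ => C_mul_mem_HZ _ (linSub_mem_HZ A (hg i))) (by
      intro p i j
      simp only [map_sum, map_mul, eval_C, eval_linSub]
      nth_rw 2 [← hB]
      nth_rw 4 [← hB]
      simp only [Matrix.mulVec, dotProduct, Finset.sum_mul_sum]
      simp only [Matrix.mulVec, dotProduct] at hgv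
      rw [Finset.sum_comm]
      refine Finset.sum_congr rfl fun l _ => Finset.sum_congr rfl fun m _ => ?_
      linear_combination B i m * B j l * hgv p m l)
  refine ⟨_root_.linSub B e, linSub_mem_HZ B he, fun i => ?_⟩
  have key : g i - X i * _root_.linSub B e = ∑ j, C (A i j) *
      _root_.linSub B (∑ i, C (B j i) * _root_.linSub A (g i) - X j * e) := by
    have h1 (l) : _root_.linSub B (_root_.linSub A (g l)) = g l := linSub_linSub h' _
    simp only [map_sub, map_sum, map_mul, h1, linSub_X, mul_sub, Finset.sum_sub_distrib,
      algHom_C]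
    congr 1
    · simp only [algebraMap_eq, Finset.mul_sum, ← mul_assoc]
      rw [Finset.sum_comm]
      simp only [← Finset.sum_mul, sum_C_mul_C h']
      simp
    · simp only [Finset.mul_sum, Finset.sum_mul, ← mul_assoc]
      rw [Finset.sum_comm]
      simp only [← Finset.sum_mul, sum_C_mul_C h']
      simp
  rw [key]
  refine sum_mem fun j _ => Ideal.mul_mem_left _ _ ?_
  have := linSub_mem_span B (hge j)
  rwa [linSub_linSub h'] at this

theorem SyzSur.linSub [Infinite k] (h : B * A = 1) (H : SyzSur (linSub A f) d v) :
    SyzSur f d fun p => A.mulVec (v p) := by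
  have h' : A * B = 1 := mul_eq_one_comm.1 h
  intro ξ hξ
  have hB (p) : B.mulVec (A.mulVec (v p)) = v p := by
    rw [Matrix.mulVec_mulVec, h, Matrix.one_mulVec]
  obtain ⟨g, hg, hgX, hgv⟩ := H (fun p j => ∑ i, A i j * ξ p i) (by
    intro p
    rw [← hξ p]
    simp only [Matrix.mulVec, dotProduct, Finset.sum_mul, Finset.mul_sum]
    rw [Finset.sum_comm]
    refine Finset.sum_congr rfl fun l _ => Finset.sum_congr rfl fun m _ => by ring)
  refine ⟨fun i => ∑ j, C (B j i) * _root_.linSub B (g j),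
    fun i => sum_mem fun j _ => C_mul_mem_HZ _ (linSub_mem_HZ B (hg j)), ?_, fun p i => ?_⟩
  · have := linSub_mem_span B hgX
    rw [linSub_linSub h'] at this
    convert this using 1
    simp only [map_sum, map_mul, linSub_X, Finset.mul_sum, Finset.sum_mul]
    rw [Finset.sum_comm]
    refine Finset.sum_congr rfl fun l _ => Finset.sum_congr rfl fun m _ => by ring
  · simp only [map_sum, map_mul, eval_C, eval_linSub, hB, hgv]
    simp only [Finset.mul_sum, ← mul_assoc]
    rw [Finset.sum_comm]
    have (l : Fin 4) : ∑ j, B j i * A l j = if l = i then 1 else 0 := by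
      have := congrFun (congrFun h' l) i
      rw [Matrix.mul_apply, Matrix.one_apply] at this
      rw [← this]
      exact Finset.sum_congr rfl fun _ _ => mul_comm _ _
    simp only [← Finset.sum_mul, this]
    simp

end LinearSubstitution

section Transversal

variable {k : Type} [Field k] {f : R4 k}

/-- The polarization of a form, linear in the direction `u`. -/
noncomputable def polar (f : R4 k) (w u : Fin 4 → k) : k := ∑ i, u i * eval w (pderiv i f)

theorem eval_smul_of_mem_HZ {d : ℕ} {p : R4 k} (hp : p ∈ HZ k d) (c : k) (x : Fin 4 → k) :
    eval (c • x) p = c ^ d * eval x p := by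
  rw [eval_eq', eval_eq', Finset.mul_sum]
  refine Finset.sum_congr rfl fun m hm => ?_
  have h : m.degree = d := by
    rw [Finsupp.degree_eq_weight_one (R := ℕ)]
    exact (mem_HZ_nat.1 hp) (mem_support_iff.1 hm)
  simp only [Pi.smul_apply, smul_eq_mul, mul_pow, Finset.prod_mul_distrib,
    Finset.prod_pow_eq_pow_sum]
  rw [Finsupp.degree_eq_sum] at h
  rw [h]
  ring

theorem exists_cubic_expansion (hf : f ∈ HZ k 3) :
    ∃ c : Fin 4 → Fin 4 → Fin 4 → k, f = ∑ i, ∑ j, ∑ l, C (c i j l) * (X i * X j * X l) := by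
  obtain ⟨u, hu, hu2⟩ := exists_sum_X_mul (by norm_num) hf
  choose u' hu' hu2' using fun i => exists_sum_X_mul (by norm_num) (hu i)
  choose u'' hu'' hu2'' using fun i j => exists_sum_X_mul (by norm_num) (hu' i j)
  refine ⟨fun i j l => coeff 0 (u'' i j l), ?_⟩
  rw [← hu2]
  refine Finset.sum_congr rfl fun i _ => ?_
  rw [← hu2' i, Finset.mul_sum]
  refine Finset.sum_congr rfl fun j _ => ?_
  rw [← hu2'' i j, Finset.mul_sum, Finset.mul_sum]
  refine Finset.sum_congr rfl fun l _ => ?_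
  rw [← mem_HZ_zero (p := u'' i j l) (by simpa using hu'' i j l)]
  ring

theorem sum_mul_ite (u : Fin 4 → k) (j : Fin 4) :
    ∑ i, u i * (Pi.single i 1 : Fin 4 → k) j = u j := by
  simp [Pi.single_apply]

theorem polar_monomial (w u : Fin 4 → k) (i j l : Fin 4) (c : k) :
    polar (C c * (X i * X j * X l)) w u =
      c * (u i * w j * w l + w i * u j * w l + w i * w j * u l) := by
  have h (s : Fin 4) : eval w (pderiv s (C c * (X i * X j * X l) : R4 k)) =
      c * ((Pi.single s 1 : Fin 4 → k) i * w j * w l + w i * (Pi.single s 1 : Fin 4 → k) j * w l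
        + w i * w j * (Pi.single s 1 : Fin 4 → k) l) := by
    simp only [Derivation.leibniz, smul_eq_mul, map_add, map_mul, pderiv_C, pderiv_X, eval_X,
      eval_C, mul_zero, add_zero]
    simp only [Pi.single_apply, apply_ite (eval w), map_one, map_zero]
    ring
  unfold polar
  simp only [h]
  rw [← sum_mul_ite u i, ← sum_mul_ite u j, ← sum_mul_ite u l]
  simp only [Finset.sum_mul, Finset.mul_sum, mul_add, Finset.sum_add_distrib]
  congr 1
  · congr 1 <;> exact Finset.sum_congr rfl fun s _ => by ring
  · exact Finset.sum_congr rfl fun s _ => by ring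

theorem polar_sum {ι : Type} (s : Finset ι) (F : ι → R4 k) (w u : Fin 4 → k) :
    polar (∑ i ∈ s, F i) w u = ∑ i ∈ s, polar (F i) w u := by
  simp only [polar, map_sum, Finset.mul_sum]
  exact Finset.sum_comm

/-- The expansion of a cubic form along a line. -/
theorem eval_add_smul (hf : f ∈ HZ k 3) (w u : Fin 4 → k) (t : k) :
    eval (w + t • u) f =
      eval u f * t ^ 3 + polar f u w * t ^ 2 + polar f w u * t + eval w f := by
  obtain ⟨c, rfl⟩ := exists_cubic_expansion hf
  simp only [polar_sum, map_sum, polar_monomial, Finset.sum_mul, ← Finset.sum_add_distrib]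
  refine Finset.sum_congr rfl fun i _ => Finset.sum_congr rfl fun j _ =>
    Finset.sum_congr rfl fun l _ => ?_
  simp
  ring

/-- The discriminant of the restriction of a cubic form to a line. -/
noncomputable def lineCubic (f : R4 k) (w u : Fin 4 → k) : Cubic k :=
  ⟨eval u f, polar f u w, polar f w u, eval w f⟩

/-- The line through `w` in the direction `u` meets the cone in three distinct vectors. -/
def TransLine (f : R4 k) (w u : Fin 4 → k) : Prop :=
  eval u f ≠ 0 ∧ ∃ t : Fin 3 → k, Function.Injective t ∧ ∀ i, eval (w + t i • u) f = 0

theorem transLine_iff [IsAlgClosed k] (hf : f ∈ HZ k 3) (w u : Fin 4 → k) :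
    TransLine f w u ↔ eval u f ≠ 0 ∧ (lineCubic f w u).discr ≠ 0 := by
  classical
  refine and_congr_right fun ha => ?_
  have ha' : (lineCubic f w u).a ≠ 0 := ha
  have hev (t : k) : (lineCubic f w u).toPoly.eval t = eval (w + t • u) f := by
    rw [eval_add_smul hf]
    simp [lineCubic, Cubic.toPoly]
  have h0 : (lineCubic f w u).toPoly ≠ 0 := by
    intro h
    exact ha' (by simpa using congrArg (fun p => p.coeff 3) h)
  have hsp : ((lineCubic f w u).toPoly.map (RingHom.id k)).Splits := IsAlgClosed.splits _
  have hroot (t : k) : t ∈ (Cubic.map (RingHom.id k) (lineCubic f w u)).roots ↔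
      eval (w + t • u) f = 0 := by
    rw [Cubic.map_roots, Polynomial.map_id, Polynomial.mem_roots h0, Polynomial.IsRoot, hev]
  obtain ⟨x, y, z, h3⟩ := (Cubic.splits_iff_roots_eq_three ha').1 hsp
  rw [Cubic.discr_ne_zero_iff_roots_ne ha' h3]
  constructor
  · rintro ⟨t, ht, ht2⟩
    have hm (i) : t i = x ∨ t i = y ∨ t i = z := by
      have := (hroot (t i)).2 (ht2 i)
      rw [h3] at this
      simpa using this
    have h01 : t 0 ≠ t 1 := ht.ne (by decide)
    have h02 : t 0 ≠ t 2 := ht.ne (by decide)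
    have h12 : t 1 ≠ t 2 := ht.ne (by decide)
    have hm0 := hm 0
    have hm1 := hm 1
    have hm2 := hm 2
    grind
  · rintro ⟨h1, h2, h4⟩
    have hm (t) (h : t = x ∨ t = y ∨ t = z) : eval (w + t • u) f = 0 := by
      rw [← hroot, h3]
      simpa using h
    refine ⟨![x, y, z], ?_, ?_⟩
    · intro i j
      fin_cases i <;> fin_cases j <;> simp [h1, h2, h4, h1.symm, h2.symm, h4.symm]
    · intro i
      fin_cases i <;> exact hm _ (by simp)

theorem pderiv_mem_HZ {d : ℤ} (hf : f ∈ HZ k d) (i : Fin 4) : pderiv i f ∈ HZ k (d - 1) := by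
  rcases le_or_gt d 0 with h | h
  · rcases h.lt_or_eq with h | rfl
    · rw [eq_zero_of_mem_HZ_neg h hf, map_zero]
      exact zero_mem _
    · rw [mem_HZ_zero hf, pderiv_C]
      exact zero_mem _
  · obtain ⟨n, rfl⟩ := Int.eq_ofNat_of_zero_le h.le
    obtain ⟨n, rfl⟩ := Nat.exists_eq_succ_of_ne_zero (show n ≠ 0 by omega)
    have : ((n.succ : ℕ) : ℤ) - 1 = n := by simp
    rw [this]
    exact mem_HZ_nat.2 ((mem_HZ_nat.1 hf).pderiv)

/-- A smooth cubic surface has a line meeting it in three distinct points. -/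
theorem exists_transLine [IsAlgClosed k] (hf : f ∈ HZ k 3) (hirr : Irreducible f)
    (hsm : ∀ v : Fin 4 → k, v ≠ 0 → eval v f = 0 → ∃ i, eval v (pderiv i f) ≠ 0) :
    ∃ w u, TransLine f w u := by
  have hlin {g : R4 k} {d : ℤ} (hd : d < 3) (hg : g ∈ HZ k d) (hg0 : g ≠ 0) :
      g ∉ Ideal.span {f} := fun h => hg0 (mem_span_eq_zero_of_lt hf hd hg h)
  obtain ⟨v1, hv1, hv1'⟩ := exists_cone_eval_ne_zero hirr (X_notMem_span hf 0)
  obtain ⟨i0, hi0⟩ := hsm v1 (by rintro rfl; simp at hv1') hv1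
  obtain ⟨m, hm⟩ : ∃ m, coeff m (pderiv i0 f) ≠ 0 := by
    by_contra! h
    apply hi0
    rw [show pderiv i0 f = 0 from MvPolynomial.ext _ _ (by simpa using h), map_zero]
  have hlin0 (c : Fin 4 → k) (i : Fin 4) (hc : c i ≠ 0) :
      (∑ i, C (c i) * X i : R4 k) ≠ 0 := by
    intro h
    have := congrArg (eval (Pi.single i 1)) h
    simp [Pi.single_apply] at this
    exact hc this
  have hlinZ (c : Fin 4 → k) : (∑ i, C (c i) * X i : R4 k) ∈ HZ k 1 :=
    sum_mem fun i _ => C_mul_mem_HZ _ (X_mem_HZ i)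
  obtain ⟨v, hv, hv'⟩ := exists_cone_eval_ne_zero hirr
    (hlin (by norm_num) (hlinZ fun i => coeff m (pderiv i f)) (hlin0 _ i0 hm))
  have hv0 : v ≠ 0 := by rintro rfl; simp at hv'
  obtain ⟨j, hj⟩ := hsm v hv0 hv
  let b : R4 k := ∑ i, C (v i) * pderiv i f
  let c : R4 k := ∑ i, C (eval v (pderiv i f)) * X i
  have hb0 : b ≠ 0 := by
    intro h
    apply hv'
    have := congrArg (coeff m) h
    simpa [b, coeff_sum, mul_comm] using this
  have hb : b ∈ HZ k 2 := sum_mem fun i _ => C_mul_mem_HZ _ (pderiv_mem_HZ hf i)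
  have hc0 : c ≠ 0 := hlin0 _ j hj
  have hd0 : b ^ 2 - 4 * f * c ≠ 0 := by
    intro h
    have h1 : b ^ 2 ∈ Ideal.span {f} := by
      rw [sub_eq_zero.1 h, Ideal.mem_span_singleton]
      exact ⟨4 * c, by ring⟩
    exact hlin (by norm_num) hb hb0 ((isPrime_span hirr).mem_of_pow_mem _ h1)
  have hne : f * c * (b ^ 2 - 4 * f * c) ≠ 0 := mul_ne_zero (mul_ne_zero hirr.ne_zero hc0) hd0
  obtain ⟨x, hx⟩ : ∃ x, eval x (f * c * (b ^ 2 - 4 * f * c)) ≠ 0 := by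
    by_contra! h
    exact hne (MvPolynomial.funext fun x => by simpa using h x)
  refine ⟨v, x, (transLine_iff hf v x).2 ?_⟩
  have hpb : polar f x v = eval x b := by simp [polar, b]
  have hpc : polar f v x = eval x c := by simp [polar, c, mul_comm]
  simp only [map_mul, mul_ne_zero_iff] at hx
  refine ⟨hx.1.1, ?_⟩
  have : (lineCubic f v x).discr =
      eval x c ^ 2 * eval x (b ^ 2 - 4 * f * c) := by
    simp only [Cubic.discr, lineCubic, hv, hpb, hpc, map_sub, map_mul, map_pow, map_ofNat]
    ring
  rw [this]
  exact mul_ne_zero (pow_ne_zero _ hx.1.2) hx.2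

theorem TransLine.linearIndependent (hf : f ∈ HZ k 3) {w u : Fin 4 → k} (h : TransLine f w u) :
    LinearIndependent k ![w, u] := by
  obtain ⟨hu, t, ht, ht2⟩ := h
  have hsm (c : k) : eval (c • u) f = c ^ 3 * eval u f := eval_smul_of_mem_HZ (d := 3) hf c u
  have hu0 : u ≠ 0 := by
    rintro rfl
    apply hu
    have := hsm 0
    simpa using this
  rw [LinearIndependent.pair_symm_iff, LinearIndependent.pair_iff' hu0]
  rintro a rfl
  have h1 (i) : a + t i = 0 := by
    have := ht2 i
    rw [← add_smul, hsm] at this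
    simpa [hu] using this
  have := ht (show t 0 = t 1 by linear_combination h1 0 - h1 1)
  simp at this

/-- Some change of coordinates moves a transversal line into the plane `x₀ = 0`. -/
theorem exists_linSub_transLine (hf : f ∈ HZ k 3) {w u : Fin 4 → k} (h : TransLine f w u) :
    ∃ A B : Matrix (Fin 4) (Fin 4) k, B * A = 1 ∧ ∃ w' u', w' 0 = 0 ∧ u' 0 = 0 ∧
      TransLine (linSub A f) w' u' := by
  have hli := h.linearIndependent hf
  have hW : Module.finrank k (Submodule.span k (Set.range ![w, u])) = 2 := by
    simpa using finrank_span_eq_card hli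
  obtain ⟨m, -, hm⟩ := exists_complement_basis (W := Submodule.span k (Set.range ![w, u]))
    (U := ⊤) le_top (n := 2) (by rw [hW, finrank_top]; simp)
  let A : Matrix (Fin 4) (Fin 4) k := (Matrix.of ![m 0, w, u, m 1]).transpose
  have hA (x : Fin 4 → k) : A.mulVec x = x 0 • m 0 + x 1 • w + x 2 • u + x 3 • m 1 := by
    ext i
    simp [A, Matrix.mulVec, dotProduct, Fin.sum_univ_four]
    ring
  have hsurj : Function.Surjective A.mulVec := by
    intro x
    obtain ⟨c, hc⟩ := hm x trivial
    rw [Matrix.range_cons, Matrix.range_cons, Matrix.range_empty, Set.union_empty,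
      Set.singleton_union, Submodule.mem_span_pair] at hc
    obtain ⟨p, q, hpq⟩ := hc
    refine ⟨![c 0, p, q, c 1], ?_⟩
    rw [hA]
    simp only [Fin.sum_univ_two] at hpq
    simp [Matrix.cons_val_zero, Matrix.cons_val_one]
    rw [eq_sub_iff_add_eq] at hpq
    rw [← hpq]
    abel
  obtain ⟨B, hB⟩ := (Matrix.mulVec_surjective_iff_isUnit.1 hsurj).exists_left_inv
  refine ⟨A, B, hB, Pi.single 1 1, Pi.single 2 1, by simp, by simp, ?_⟩
  obtain ⟨hu, t, ht, ht2⟩ := h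
  refine ⟨?_, t, ht, fun i => ?_⟩
  · rw [eval_linSub, hA]
    simpa using hu
  · rw [eval_linSub, hA]
    simpa using ht2 i

end Transversal

section PlaneSection

variable {k : Type} [Field k] {f : R4 k}

/-- The linear form with given coefficients. -/
noncomputable def lf (c : Fin 4 → k) : R4 k := ∑ i, C (c i) * X i

theorem eval_lf (c x : Fin 4 → k) : eval x (lf c) = ∑ i, c i * x i := by simp [lf]

theorem lf_mem_HZ (c : Fin 4 → k) : lf c ∈ HZ k 1 :=
  sum_mem fun i _ => C_mul_mem_HZ _ (X_mem_HZ i)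

theorem linSub_X_eq_lf (A : Matrix (Fin 4) (Fin 4) k) (i : Fin 4) : linSub A (X i) = lf (A i) :=
  linSub_X A i

theorem lf_smul (a : k) (c : Fin 4 → k) : lf (a • c) = C a * lf c := by
  simp [lf, Finset.mul_sum, mul_assoc]

theorem lf_add (b c : Fin 4 → k) : lf (b + c) = lf b + lf c := by
  simp [lf, add_mul, Finset.sum_add_distrib]

/-- The ideal of the plane section `x₀ = f = 0`. -/
noncomputable def secIdeal (f : R4 k) : Ideal (R4 k) := Ideal.span {f, X 0}

theorem mem_secIdeal {p : R4 k} : p ∈ secIdeal f ↔ ∃ a b, a * f + b * X 0 = p :=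
  Ideal.mem_span_pair

theorem secIdeal_eval {p : R4 k} (hp : p ∈ secIdeal f) {x : Fin 4 → k} (hx : eval x f = 0)
    (hx0 : x 0 = 0) : eval x p = 0 := by
  obtain ⟨a, b, rfl⟩ := mem_secIdeal.1 hp
  simp [hx, hx0]

theorem X_zero_mul_mem_secIdeal (p : R4 k) : X 0 * p ∈ secIdeal f :=
  Ideal.mul_mem_right _ _ (Ideal.subset_span (by simp))

theorem exists_of_mem_secIdeal (hf : f ∈ HZ k 3) {p : R4 k} {d : ℤ} (hp : p ∈ HZ k d)
    (h : p ∈ secIdeal f) : ∃ w ∈ HZ k (d - 1), p - X 0 * w ∈ Ideal.span {f} := by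
  obtain ⟨a, b, hab⟩ := mem_secIdeal.1 h
  refine ⟨cZ k (d - 1) b, cZ_mem _ _, ?_⟩
  have h1 := congrArg (cZ k d) hab
  rw [map_add, cZ_self hp, mul_comm b, cZ_X_mul, cZ_mul' _ hf] at h1
  rw [← h1, Ideal.mem_span_singleton]
  exact ⟨cZ k (d - 3) a, by ring⟩

theorem cZ_mem_secIdeal (hf : f ∈ HZ k 3) {p : R4 k} (h : p ∈ secIdeal f) (d : ℤ) :
    cZ k d p ∈ secIdeal f := by
  obtain ⟨a, b, rfl⟩ := mem_secIdeal.1 h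
  rw [map_add, mul_comm b, cZ_X_mul, cZ_mul' _ hf, mul_comm (X 0)]
  exact mem_secIdeal.2 ⟨_, _, rfl⟩

theorem sub_linSub_mem {A : Matrix (Fin 4) (Fin 4) k} {I : Ideal (R4 k)}
    (h : ∀ i, X i - linSub A (X i) ∈ I) (p : R4 k) : p - linSub A p ∈ I := by
  have : (Ideal.Quotient.mkₐ k I).comp (linSub A) = Ideal.Quotient.mkₐ k I := by
    ext i
    exact (Ideal.Quotient.eq.2 (h i)).symm
  exact Ideal.Quotient.eq.1 (AlgHom.congr_fun this p).symm

/-- Curves in the plane `x₀ = 0` meeting the cubic properly in the given points. -/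
structure GoodDiv (f : R4 k) (j : ℕ) (D : R4 k) {ι : Type} (P : ι → Fin 4 → k) : Prop where
  mem : D ∈ HZ k j
  cone : ∀ p, eval (P p) f = 0
  plane : ∀ p, P p 0 = 0
  ne : ∀ p, P p ≠ 0
  div : ∀ (d : ℤ), ∀ F ∈ HZ k d, (∀ p, eval (P p) F = 0) →
    ∃ F' ∈ HZ k (d - j), F - D * F' ∈ secIdeal f
  reg : ∀ s, D * s ∈ secIdeal f → s ∈ secIdeal f

theorem GoodDiv.one (f : R4 k) {ι : Type} [IsEmpty ι] (P : ι → Fin 4 → k) :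
    GoodDiv f 0 1 P where
  mem := C_mem_HZ 1
  cone := isEmptyElim
  plane := isEmptyElim
  ne := isEmptyElim
  div := fun d F hF _ => ⟨F, by simpa using hF, by simp⟩
  reg := by simp

theorem GoodDiv.mul {j : ℕ} {D l : R4 k} {ι ι' : Type} {P : ι → Fin 4 → k} {P' : ι' → Fin 4 → k}
    (h : GoodDiv f j D P) (h' : GoodDiv f 1 l P') (hl : ∀ p, eval (P p) l ≠ 0) :
    GoodDiv f (j + 1) (l * D) (Sum.elim P' P) where
  mem := by
    have := mul_mem_HZ h'.mem h.mem
    rwa [add_comm, ← Nat.cast_add] at this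
  cone := by rintro (p | p); exacts [h'.cone p, h.cone p]
  plane := by rintro (p | p); exacts [h'.plane p, h.plane p]
  ne := by rintro (p | p); exacts [h'.ne p, h.ne p]
  div := by
    intro d F hF hP
    obtain ⟨F1, hF1, h1⟩ := h'.div d F hF fun p => hP (.inl p)
    obtain ⟨F2, hF2, h2⟩ := h.div _ F1 hF1 fun p => by
      have := secIdeal_eval h1 (h.cone p) (h.plane p)
      have hFp := hP (.inr p)
      simp only [Sum.elim_inr] at hFp
      rw [map_sub, hFp, zero_sub, neg_eq_zero, map_mul] at this
      exact (mul_eq_zero.1 this).resolve_left (hl p)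
    refine ⟨F2, ?_, ?_⟩
    · convert hF2 using 1
      congr 1
      push_cast
      ring
    · have := add_mem h1 (Ideal.mul_mem_left _ l h2)
      convert this using 1
      ring
  reg := fun s hs => h.reg _ (h'.reg _ (by rwa [← mul_assoc]))

/-- The coefficients of the linear form vanishing on the span of two vectors in the plane. -/
def crossVec (w u : Fin 4 → k) : Fin 4 → k :=
  ![0, w 2 * u 3 - w 3 * u 2, w 3 * u 1 - w 1 * u 3, w 1 * u 2 - w 2 * u 1]

theorem eval_lf_crossVec (w u x : Fin 4 → k) : eval x (lf (crossVec w u)) =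
    (w 2 * u 3 - w 3 * u 2) * x 1 + (w 3 * u 1 - w 1 * u 3) * x 2 +
      (w 1 * u 2 - w 2 * u 1) * x 3 := by
  simp [eval_lf, crossVec, Fin.sum_univ_four]

variable {w u q : Fin 4 → k}

theorem GoodDiv.of_transLine [Infinite k] (hf : f ∈ HZ k 3) (hw : w 0 = 0) (hu : u 0 = 0)
    (hq : q 0 = 0) (hdet : eval q (lf (crossVec w u)) ≠ 0) (hfu : eval u f ≠ 0) {t : Fin 3 → k}
    (ht : Function.Injective t) (htf : ∀ i, eval (w + t i • u) f = 0) :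
    GoodDiv f 1 (lf (crossVec w u)) fun i => w + t i • u := by
  set l := lf (crossVec w u) with hl
  set δ := eval q l with hδ
  let s : Fin 4 → k := δ⁻¹ • crossVec u q
  let r : Fin 4 → k := δ⁻¹ • crossVec q w
  let I : Ideal (R4 k) := Ideal.span {X 0, l}
  have hI {p : R4 k} : p ∈ I ↔ ∃ a b, a * X 0 + b * l = p := Ideal.mem_span_pair
  have hδ' : δ = (w 2 * u 3 - w 3 * u 2) * q 1 + (w 3 * u 1 - w 1 * u 3) * q 2 +
      (w 1 * u 2 - w 2 * u 1) * q 3 := eval_lf_crossVec _ _ _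
  have hsx (x : Fin 4 → k) : eval x (lf s) = δ⁻¹ * ((u 2 * q 3 - u 3 * q 2) * x 1 +
      (u 3 * q 1 - u 1 * q 3) * x 2 + (u 1 * q 2 - u 2 * q 1) * x 3) := by
    rw [← eval_lf_crossVec, eval_lf, eval_lf, Finset.mul_sum]
    exact Finset.sum_congr rfl fun i _ => by simp [s, mul_assoc]
  have hrx (x : Fin 4 → k) : eval x (lf r) = δ⁻¹ * ((q 2 * w 3 - q 3 * w 2) * x 1 +
      (q 3 * w 1 - q 1 * w 3) * x 2 + (q 1 * w 2 - q 2 * w 1) * x 3) := by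
    rw [← eval_lf_crossVec, eval_lf, eval_lf, Finset.mul_sum]
    exact Finset.sum_congr rfl fun i _ => by simp [r, mul_assoc]
  have hdec (i : Fin 4) : (X i : R4 k) = C (w i) * lf s + C (u i) * lf r + C (q i * δ⁻¹) * l +
      C (if i = 0 then 1 else 0) * X 0 := by
    refine MvPolynomial.funext fun x => ?_
    simp only [map_add, map_mul, eval_C, eval_X, hsx, hrx, hl, eval_lf_crossVec]
    fin_cases i
    · simp [hw, hu, hq]
    all_goals
      simp
      field_simp
      rw [hδ']
      ring
  have hsw : eval w (lf s) = 1 := by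
    rw [hsx, inv_mul_eq_one₀ hdet, hδ']; ring
  have hsu : eval u (lf s) = 0 := by rw [hsx]; ring
  have hrw : eval w (lf r) = 0 := by rw [hrx]; ring
  have hru : eval u (lf r) = 1 := by
    rw [hrx, inv_mul_eq_one₀ hdet, hδ']; ring
  have hlw : eval w l = 0 := by rw [hl, eval_lf_crossVec]; ring
  have hlu : eval u l = 0 := by rw [hl, eval_lf_crossVec]; ring
  have hadd (c x y : Fin 4 → k) (a : k) : eval (x + a • y) (lf c) =
      eval x (lf c) + a * eval y (lf c) := by
    simp only [eval_lf, Finset.mul_sum, ← Finset.sum_add_distrib]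
    exact Finset.sum_congr rfl fun i _ => by simp; ring
  have hsP (i) : eval (w + t i • u) (lf s) = 1 := by rw [hadd, hsw, hsu]; ring
  have hrP (i) : eval (w + t i • u) (lf r) = t i := by rw [hadd, hrw, hru]; ring
  have hlP (i) : eval (w + t i • u) l = 0 := by rw [hl, hadd, ← hl, hlw, hlu]; ring
  have hP0 (i) : (w + t i • u) 0 = 0 := by simp [hw, hu]
  have hIP {p : R4 k} (hp : p ∈ I) (i) : eval (w + t i • u) p = 0 := by
    obtain ⟨a, b, rfl⟩ := hI.1 hp
    rw [map_add, map_mul, map_mul, hlP, eval_X, hP0]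
    ring
  have hl1 : l ∈ HZ k 1 := lf_mem_HZ _
  let L (i : Fin 3) : R4 k := lf r - C (t i) * lf s
  have hL1 (i) : L i ∈ HZ k 1 := sub_mem (lf_mem_HZ _) (C_mul_mem_HZ _ (lf_mem_HZ _))
  have hLP (i j) : eval (w + t j • u) (L i) = t j - t i := by
    simp [L, hrP, hsP]
  have hstep (i) {d : ℤ} {G : R4 k} (hG : G ∈ HZ k d) (h0 : eval (w + t i • u) G = 0) :
      ∃ G' ∈ HZ k (d - 1), G - L i * G' ∈ I := by
    rcases lt_or_ge d 0 with hd | hd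
    · exact ⟨0, zero_mem _, by simp [eq_zero_of_mem_HZ_neg hd hG]⟩
    obtain ⟨n, rfl⟩ := Int.eq_ofNat_of_zero_le hd
    let A : Matrix (Fin 4) (Fin 4) k := fun a b => (w + t i • u) a * s b
    have hAX (a) : linSub A (X a) = C ((w + t i • u) a) * lf s := by
      rw [linSub_X_eq_lf, ← lf_smul]
      rfl
    have hA (x : Fin 4 → k) : A.mulVec x = eval x (lf s) • (w + t i • u) := by
      ext a
      simp only [A, Matrix.mulVec, dotProduct, eval_lf, Pi.smul_apply, smul_eq_mul,
        Finset.sum_mul]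
      exact Finset.sum_congr rfl fun b _ => by ring
    have hz : linSub A G = 0 := MvPolynomial.funext fun x => by
      rw [eval_linSub, hA, eval_smul_of_mem_HZ hG, h0, mul_zero, map_zero]
    let J : Ideal (R4 k) := Ideal.span {L i} ⊔ I
    have hmem : G ∈ J := by
      have := sub_linSub_mem (A := A) (I := J) (fun a => ?_) G
      · rwa [hz, sub_zero] at this
      · have : X a - linSub A (X a) = C (u a) * L i +
            (C (if a = 0 then 1 else 0) * X 0 + C (q a * δ⁻¹) * l) := by
          rw [hAX]
          conv_lhs => rw [hdec a]
          simp only [L, Pi.add_apply, Pi.smul_apply, smul_eq_mul, map_add, map_mul]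
          ring
        rw [this]
        refine Submodule.add_mem_sup (Ideal.mul_mem_left _ _ (Ideal.mem_span_singleton_self _)) ?_
        exact hI.2 ⟨_, _, rfl⟩
    obtain ⟨y, hy, z, hzI, rfl⟩ := Submodule.mem_sup.1 hmem
    obtain ⟨c, rfl⟩ := Ideal.mem_span_singleton'.1 hy
    obtain ⟨a, b, rfl⟩ := hI.1 hzI
    refine ⟨cZ k (n - 1) c, cZ_mem _ _, ?_⟩
    rw [← cZ_self hG, map_add, map_add, cZ_mul' _ (hL1 i), cZ_mul' _ hl1, cZ_mul' _ (X_mem_HZ 0)]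
    exact hI.2 ⟨cZ k (n - 1) a, cZ k (n - 1) b, by ring⟩
  have hthree {d : ℤ} {G : R4 k} (hG : G ∈ HZ k d) (h0 : ∀ i, eval (w + t i • u) G = 0) :
      ∃ G' ∈ HZ k (d - 3), G - L 0 * L 1 * L 2 * G' ∈ I := by
    have hnext (i j) (hij : i ≠ j) {F F' : R4 k} (h : F - L i * F' ∈ I)
        (hF : eval (w + t j • u) F = 0) : eval (w + t j • u) F' = 0 := by
      have := hIP h j
      rw [map_sub, hF, map_mul, hLP, zero_sub, neg_eq_zero] at this
      exact (mul_eq_zero.1 this).resolve_left (sub_ne_zero.2 (ht.ne hij.symm))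
    obtain ⟨G1, hG1, h1⟩ := hstep 0 hG (h0 0)
    have h11 := hnext 0 1 (by decide) h1 (h0 1)
    have h12 := hnext 0 2 (by decide) h1 (h0 2)
    obtain ⟨G2, hG2, h2⟩ := hstep 1 hG1 h11
    have h22 := hnext 1 2 (by decide) h2 h12
    obtain ⟨G3, hG3, h3⟩ := hstep 2 hG2 h22
    refine ⟨G3, by convert hG3 using 2; ring, ?_⟩
    have := add_mem h1 (add_mem (Ideal.mul_mem_left _ (L 0) h2)
      (Ideal.mul_mem_left _ (L 0 * L 1) h3))
    convert this using 1
    ring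
  obtain ⟨g, hg, hfg⟩ := hthree hf htf
  obtain ⟨c, rfl⟩ : ∃ c, g = C c := ⟨_, mem_HZ_zero (by simpa using hg)⟩
  have hc : c ≠ 0 := by
    rintro rfl
    obtain ⟨a, b, hab⟩ := hI.1 hfg
    have := congrArg (eval u) hab
    simp [hu, hlu] at this
    exact hfu this.symm
  refine ⟨hl1, htf, hP0, ?_, ?_, ?_⟩
  · intro i h
    have := hsP i
    rw [eval_lf, h] at this
    simp at this
  · intro d F hF h0
    obtain ⟨G, hG, hFG⟩ := hthree hF h0
    have h1 := sub_mem hFG (Ideal.mul_mem_left _ (C c⁻¹ * G) hfg)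
    obtain ⟨a, b, hab⟩ := hI.1 h1
    have hcc : (C c⁻¹ * C c : R4 k) = 1 := by rw [← map_mul, inv_mul_cancel₀ hc, map_one]
    refine ⟨cZ k (d - 1) b, cZ_mem _ _, ?_⟩
    have h2 : F - b * l ∈ secIdeal f := by
      refine mem_secIdeal.2 ⟨C c⁻¹ * G, a, ?_⟩
      linear_combination hab + L 0 * L 1 * L 2 * G * hcc
    have h3 := cZ_mem_secIdeal hf h2 d
    rwa [map_sub, cZ_self hF, cZ_mul' _ hl1, mul_comm] at h3
  · intro p hp
    obtain ⟨a, b, hab⟩ := mem_secIdeal.1 hp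
    let A : Matrix (Fin 4) (Fin 4) k := fun i j => w i * s j + u i * r j
    have hAX (i) : linSub A (X i) = C (w i) * lf s + C (u i) * lf r := by
      rw [linSub_X_eq_lf, ← lf_smul, ← lf_smul, ← lf_add]
      rfl
    have hA (x : Fin 4 → k) : A.mulVec x = eval x (lf s) • w + eval x (lf r) • u := by
      ext i
      simp only [A, Matrix.mulVec, dotProduct, eval_lf, Pi.smul_apply, Pi.add_apply, smul_eq_mul,
        Finset.sum_mul, ← Finset.sum_add_distrib]
      exact Finset.sum_congr rfl fun b _ => by ring
    have hX0 : linSub A (X 0) = 0 := by rw [hAX, hw, hu]; simp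
    have hl0 : linSub A l = 0 := MvPolynomial.funext fun x => by
      have h0 := hadd (crossVec w u) 0 w (eval x (lf s))
      rw [zero_add, ← hl, hlw, hl, eval_lf (crossVec w u) 0] at h0
      rw [eval_linSub, hA, hl, hadd, ← hl, hlu, hl, h0]
      simp
    have hf0 : linSub A f ≠ 0 := by
      intro h
      have := eval_linSub A u f
      rw [h, hA, hsu, hru] at this
      simp at this
      exact hfu this.symm
    have ha0 : linSub A a = 0 := by
      have := congrArg (linSub A) hab
      rw [map_add, map_mul, map_mul, map_mul, hX0, hl0, mul_zero, add_zero, zero_mul] at this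
      exact (mul_eq_zero.1 this).resolve_right hf0
    have haI : a ∈ I := by
      have := sub_linSub_mem (A := A) (I := I) (fun i => ?_) a
      · rwa [ha0, sub_zero] at this
      · rw [hAX]
        exact hI.2 ⟨C (if i = 0 then 1 else 0), C (q i * δ⁻¹), by linear_combination -hdec i⟩
    obtain ⟨a1, a2, rfl⟩ := hI.1 haI
    have hdvd : (X 0 : R4 k) ∣ l * (p - a2 * f) := ⟨a1 * f + b, by linear_combination -hab⟩
    rcases (X_prime (R := k) (i := (0 : Fin 4))).dvd_or_dvd hdvd with ⟨m, hm⟩ | ⟨m, hm⟩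
    · have := congrArg (eval q) hm
      rw [map_mul, eval_X, hq, zero_mul] at this
      exact absurd this hdet
    · exact mem_secIdeal.2 ⟨a2, m, by linear_combination -hm⟩

end PlaneSection

section GenericLines

variable {k : Type} [Field k] {f : R4 k}

/-- The plane `x₀ = 0` contains a line meeting the cubic in three distinct points. -/
def TransPlane (f : R4 k) : Prop := ∃ w u : Fin 4 → k, w 0 = 0 ∧ u 0 = 0 ∧ TransLine f w u

/-- Substitution of the coordinates of one of two generic vectors in the plane. -/
noncomputable def planeSub (r : Fin 2) : R4 k →ₐ[k] MvPolynomial (Fin 2 × Fin 3) k :=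
  aeval (Fin.cons 0 fun j => X (r, j))

/-- One of two vectors in the plane with given coordinates. -/
def planeVec (y : Fin 2 × Fin 3 → k) (r : Fin 2) : Fin 4 → k := Fin.cons 0 fun j => y (r, j)

theorem eval_planeSub (y : Fin 2 × Fin 3 → k) (r : Fin 2) (p : R4 k) :
    eval y (planeSub r p) = eval (planeVec y r) p := by
  have : (aeval y : MvPolynomial (Fin 2 × Fin 3) k →ₐ[k] k).comp (planeSub r) =
      aeval (planeVec y r) := by
    ext i
    refine Fin.cases ?_ (fun j => ?_) i <;> simp [planeSub, planeVec]
  exact AlgHom.congr_fun this p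

theorem exists_planeVec {w u : Fin 4 → k} (hw : w 0 = 0) (hu : u 0 = 0) :
    ∃ y, planeVec y 0 = w ∧ planeVec y 1 = u := by
  refine ⟨fun q => ![w, u] q.1 q.2.succ, ?_, ?_⟩ <;> ext i <;>
    refine Fin.cases ?_ (fun j => ?_) i <;> simp [planeVec, hw, hu]

theorem exists_crossVec_ne_zero {q : Fin 4 → k} (hq : q 0 = 0) (hq0 : q ≠ 0) :
    ∃ w u : Fin 4 → k, w 0 = 0 ∧ u 0 = 0 ∧ eval q (lf (crossVec w u)) ≠ 0 := by
  obtain ⟨i, hi⟩ := Function.ne_iff.1 hq0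
  simp only [eval_lf_crossVec]
  fin_cases i
  · exact absurd hq hi
  · exact ⟨Pi.single 2 1, Pi.single 3 1, by simp, by simp, by simpa using hi⟩
  · exact ⟨Pi.single 3 1, Pi.single 1 1, by simp, by simp, by simpa using hi⟩
  · exact ⟨Pi.single 1 1, Pi.single 2 1, by simp, by simp, by simpa using hi⟩

/-- Transversal lines avoiding given points of the plane. -/
theorem TransPlane.exists_avoid [IsAlgClosed k] (hf : f ∈ HZ k 3) (h : TransPlane f) {κ : Type}
    [Finite κ] (q : κ → Fin 4 → k) (hq : ∀ i, q i 0 = 0) (hq0 : ∀ i, q i ≠ 0) :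
    ∃ (n : Fin 4 → k) (P : Fin 3 → Fin 4 → k), GoodDiv f 1 (lf n) P ∧
      ∀ i, eval (q i) (lf n) ≠ 0 := by
  have := Fintype.ofFinite κ
  obtain ⟨w0, u0, hw0, hu0, htr⟩ := h
  let q' : Option κ → Fin 4 → k := fun o => o.elim (Pi.single 1 1) q
  have hq' (o) : q' o 0 = 0 := by cases o <;> simp [q', hq]
  have hq0' (o) : q' o ≠ 0 := by
    cases o
    · intro h
      have := congrFun h 1
      simp [q'] at this
    · exact hq0 _
  let W (i : Fin 4) : MvPolynomial (Fin 2 × Fin 3) k := planeSub 0 (X i)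
  let U (i : Fin 4) : MvPolynomial (Fin 2 × Fin 3) k := planeSub 1 (X i)
  let Q : Cubic (MvPolynomial (Fin 2 × Fin 3) k) :=
    ⟨planeSub 1 f, ∑ i, W i * planeSub 1 (pderiv i f), ∑ i, U i * planeSub 0 (pderiv i f),
      planeSub 0 f⟩
  let Δ (o : Option κ) : MvPolynomial (Fin 2 × Fin 3) k :=
    (W 2 * U 3 - W 3 * U 2) * C (q' o 1) + (W 3 * U 1 - W 1 * U 3) * C (q' o 2) +
      (W 1 * U 2 - W 2 * U 1) * C (q' o 3)
  have hW (y i) : eval y (W i) = planeVec y 0 i := by simp [W, eval_planeSub]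
  have hU (y i) : eval y (U i) = planeVec y 1 i := by simp [U, eval_planeSub]
  have hQ (y) : eval y Q.discr = (lineCubic f (planeVec y 0) (planeVec y 1)).discr := by
    simp [Cubic.discr, lineCubic, Q, polar, eval_planeSub, hW, hU]
  have hΔ (y o) : eval y (Δ o) =
      eval (q' o) (lf (crossVec (planeVec y 0) (planeVec y 1))) := by
    simp [Δ, eval_lf_crossVec, hW, hU]
  have hT : planeSub 1 f * Q.discr ≠ 0 := by
    obtain ⟨y, rfl, rfl⟩ := exists_planeVec hw0 hu0
    intro h
    have := congrArg (eval y) h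
    rw [map_mul, eval_planeSub, hQ, map_zero, mul_eq_zero] at this
    have h1 := (transLine_iff hf _ _).1 htr
    exact this.elim h1.1 h1.2
  have hΔ0 (o) : Δ o ≠ 0 := by
    obtain ⟨w, u, hw, hu, hwu⟩ := exists_crossVec_ne_zero (hq' o) (hq0' o)
    obtain ⟨y, rfl, rfl⟩ := exists_planeVec hw hu
    intro h
    rw [← hΔ, h, map_zero] at hwu
    exact hwu rfl
  obtain ⟨y, hy⟩ : ∃ y, eval y (planeSub 1 f * Q.discr * ∏ o, Δ o) ≠ 0 := by
    by_contra! h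
    refine mul_ne_zero hT (Finset.prod_ne_zero_iff.2 fun o (_ : o ∈ Finset.univ) => hΔ0 o)
      (MvPolynomial.funext fun y => ?_)
    rw [h y, map_zero]
  rw [map_mul, mul_ne_zero_iff, map_mul, mul_ne_zero_iff, map_prod, Finset.prod_ne_zero_iff,
    eval_planeSub, hQ] at hy
  obtain ⟨h1, h2⟩ := hy
  obtain ⟨hu, t, ht, htf⟩ := (transLine_iff hf _ _).2 h1
  have h3 (o) := hΔ y o ▸ h2 o (Finset.mem_univ o)
  exact ⟨_, _, GoodDiv.of_transLine hf rfl rfl (hq' none) (h3 none) hu ht htf, fun i => h3 (some i)⟩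

/-- The plane section of the cubic spans the plane. -/
theorem TransPlane.exists_cone_ne_zero [IsAlgClosed k] (hf : f ∈ HZ k 3) (h : TransPlane f)
    {z : Fin 4 → k} {i : Fin 4} (hi : i ≠ 0) (hz : z i ≠ 0) :
    ∃ c : Fin 4 → k, eval c f = 0 ∧ c 0 = 0 ∧ eval c (lf z) ≠ 0 := by
  obtain ⟨q, hq, hq0, hzq⟩ : ∃ q : Fin 4 → k, q 0 = 0 ∧ q ≠ 0 ∧ eval q (lf z) = 0 := by
    by_cases h1 : z 1 = 0
    · refine ⟨Pi.single 1 1, by simp, by simp, ?_⟩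
      simpa [eval_lf, Pi.single_apply] using h1
    · refine ⟨![0, -z 2, z 1, 0], by simp, fun h => ?_, ?_⟩
      · exact h1 (by simpa using congrFun h 2)
      · simp [eval_lf, Fin.sum_univ_four]
        ring
  obtain ⟨n, P, hP, hn⟩ := h.exists_avoid hf (fun _ : Unit => q) (fun _ => hq) fun _ => hq0
  by_contra! hc
  obtain ⟨F, hF, hF2⟩ := hP.div 1 (lf z) (lf_mem_HZ z) fun p => hc _ (hP.cone p) (hP.plane p)
  have hF' := mem_HZ_zero (by simpa using hF)
  have hdeg : lf z - lf n * F ∈ HZ k 1 := by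
    rw [hF', mul_comm]
    exact sub_mem (lf_mem_HZ z) (C_mul_mem_HZ _ (lf_mem_HZ n))
  obtain ⟨w, hw, hw2⟩ := exists_of_mem_secIdeal hf hdeg hF2
  have heq := mem_span_eq_zero_of_lt hf (by norm_num)
    (sub_mem hdeg (by simpa using X_mul_mem_HZ 0 hw)) hw2
  have h1 := congrArg (eval q) heq
  rw [hF'] at h1
  simp [hzq, hq, hn ()] at h1
  rw [hF', h1] at heq
  have h2 := congrArg (eval (Pi.single i 1)) heq
  simp [eval_lf, Pi.single_apply, hi.symm] at h2
  exact hz h2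

/-- Plane curves of any degree meeting the cubic properly and lying outside a given subspace. -/
theorem TransPlane.exists_goodDiv [IsAlgClosed k] (hf : f ∈ HZ k 3) (h : TransPlane f)
    {B : Submodule k (R4 k)} (hB : ∀ p, X 0 * p ∈ B) {c : Fin 4 → k} (hc : c 0 = 0) (hc0 : c ≠ 0)
    {b : ℕ} {G : R4 k} (hG : G ∈ HZ k b) (hGB : G ∉ B) :
    ∃ (D : R4 k) (ι : Type) (_ : Fintype ι) (P : ι → Fin 4 → k), Fintype.card ι = 3 * b ∧
      GoodDiv f b D P ∧ eval c D ≠ 0 ∧ D ∉ B := by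
  have key : ∀ j ≤ b, ∃ (D : R4 k) (ι : Type) (_ : Fintype ι) (P : ι → Fin 4 → k),
      Fintype.card ι = 3 * j ∧ GoodDiv f j D P ∧ eval c D ≠ 0 ∧
        ∃ G ∈ HZ k ((b : ℤ) - j), D * G ∉ B := by
    intro j
    induction j with
    | zero =>
      intro _
      exact ⟨1, Fin 0, inferInstance, Fin.elim0, by simp, GoodDiv.one f _, by simp, G,
        by simpa using hG, by simpa using hGB⟩
    | succ j ih =>
      intro hj
      obtain ⟨D, ι, _, P, hcard, hD, hcD, G, hG, hGB⟩ := ih (by omega)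
      obtain ⟨u, hu, rfl⟩ := exists_sum_X_mul (by omega) hG
      obtain ⟨i, hi⟩ : ∃ i, X i * (D * u i) ∉ B := by
        by_contra! hall
        apply hGB
        rw [Finset.mul_sum]
        refine sum_mem fun i _ => ?_
        convert hall i using 1
        ring
      let φ : (Fin 4 → k) →ₗ[k] R4 k :=
        { toFun := fun m => lf m * (D * u i)
          map_add' := fun m m' => by rw [lf_add, add_mul]
          map_smul' := fun a m => by
            rw [lf_smul, RingHom.id_apply, smul_eq_C_mul, mul_assoc] }
      have hsingle (l : Fin 4) : lf (Pi.single l 1 : Fin 4 → k) = X l := by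
        simp [lf, Pi.single_apply]
      have hlt : B.comap φ < ⊤ := by
        refine lt_top_iff_ne_top.2 fun htop => hi ?_
        have : (Pi.single i 1 : Fin 4 → k) ∈ B.comap φ := htop ▸ trivial
        simpa [φ, hsingle] using this
      obtain ⟨ψ, hψ, hψB⟩ := Submodule.exists_le_ker_of_lt_top _ hlt
      let z : Fin 4 → k := fun l => ψ (Pi.single l 1)
      have hz (m : Fin 4 → k) : eval z (lf m) = ψ m := by
        rw [eval_lf]
        conv_rhs => rw [pi_eq_sum_univ' m]
        simp [z]
      have hz0 : z 0 = 0 := hψB (by simpa [φ, hsingle] using hB _)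
      have hzne : z ≠ 0 := by
        intro h0
        apply hψ
        ext l
        exact congrFun h0 l
      obtain ⟨n, P', hP', hn⟩ := h.exists_avoid hf
        (fun o : ι ⊕ Bool => o.elim P fun x => if x then c else z)
        (by rintro (p | _ | _) <;> simp [hD.plane, hc, hz0])
        (by rintro (p | _ | _) <;> simp [hD.ne, hc0, hzne])
      refine ⟨lf n * D, Fin 3 ⊕ ι, inferInstance, _, ?_, hD.mul hP' fun p => hn (.inl p), ?_,
        u i, by convert hu i using 2; push_cast; ring, fun hmem => ?_⟩
      · rw [Fintype.card_sum, hcard, Fintype.card_fin]; ring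
      · rw [map_mul]
        exact mul_ne_zero (hn (.inr true)) hcD
      · apply hn (.inr false)
        have : n ∈ B.comap φ := by
          rw [mul_assoc] at hmem
          exact hmem
        simpa [hz] using hψB this
  obtain ⟨D, ι, inst, P, hcard, hD, hcD, G, hG, hGB⟩ := key b le_rfl
  refine ⟨D, ι, inst, P, hcard, hD, hcD, fun hDB => hGB ?_⟩
  rw [mem_HZ_zero (p := G) (by simpa using hG), mul_comm, ← smul_eq_C_mul]
  exact B.smul_mem _ hDB

/-- A form vanishing on the plane section lies in its ideal. -/
theorem TransPlane.mem_secIdeal [IsAlgClosed k] (hf : f ∈ HZ k 3) (h : TransPlane f) {d : ℕ}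
    {F : R4 k} (hF : F ∈ HZ k d) (hF0 : ∀ c : Fin 4 → k, eval c f = 0 → c 0 = 0 → eval c F = 0) :
    F ∈ secIdeal f := by
  let B : Submodule k (R4 k) := (Ideal.span {X 0}).restrictScalars k
  have hG : (X 1 : R4 k) ^ (d + 1) ∈ HZ k ((d + 1 : ℕ) : ℤ) :=
    mem_HZ_nat.2 (by simpa using (isHomogeneous_X k (1 : Fin 4)).pow (d + 1))
  obtain ⟨D, ι, _, P, -, hD, -⟩ := h.exists_goodDiv hf (B := B) (c := Pi.single 1 1)
    (fun p => Ideal.mul_mem_right _ _ (Ideal.mem_span_singleton_self _)) (by simp) (by simp)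
    hG (by
      intro hmem
      obtain ⟨m, hm⟩ := Ideal.mem_span_singleton.1 
        (show (X 1 : R4 k) ^ (d + 1) ∈ Ideal.span {X 0} from hmem)
      have := congrArg (eval (Pi.single 1 1)) hm
      simp at this)
  obtain ⟨F', hF', hF2⟩ := hD.div d F hF fun p => hF0 _ (hD.cone p) (hD.plane p)
  rwa [eq_zero_of_mem_HZ_neg (by push_cast; omega) hF', mul_zero, sub_zero] at hF2

end GenericLines

section RadialStep

variable {k : Type} [Field k] {f : R4 k}

theorem exists_eq_lf {p : R4 k} (hp : p ∈ HZ k 1) : ∃ m : Fin 4 → k, p = lf m := by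
  obtain ⟨u, hu, rfl⟩ := exists_sum_X_mul one_ne_zero hp
  refine ⟨fun i => coeff 0 (u i), Finset.sum_congr rfl fun i _ => ?_⟩
  conv_lhs => rw [mem_HZ_zero (p := u i) (by simpa using hu i)]
  rw [mul_comm]

theorem smul_X_eq_zero (hf : f ∈ HZ k 3) (hirr : Irreducible f) {i : Fin 4} {s : SX f}
    (h : (X i : R4 k) • s = 0) : s = 0 := by
  obtain ⟨p, rfl⟩ := mkS_surjective f s
  rw [← mkS_mul, mkS_eq_zero] at h
  exact mkS_eq_zero.2 (mem_span_of_X_mul hf hirr h)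

/-- Vectors of forms that are proportional to the position vector on the plane section. -/
theorem exists_of_secIdeal_minors (hf : f ∈ HZ k 3) (hirr : Irreducible f) {b : ℤ}
    {n : Fin 4 → R4 k} (hn : ∀ i, n i ∈ HZ k b)
    (h : ∀ i j, X i * n j - X j * n i ∈ secIdeal f) :
    ∃ w : Fin 4 → R4 k, (∀ i, w i ∈ HZ k (b - 1)) ∧ ∃ e ∈ HZ k (b - 1),
      ∀ i, n i - X 0 * w i - X i * e ∈ Ideal.span {f} := by
  have key (i j) : ∃ s ∈ gr f b, (X i : R4 k) • mkS f (n j) - (X j : R4 k) • mkS f (n i) =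
      (X 0 : R4 k) • s := by
    obtain ⟨w, hw, hw2⟩ := exists_of_mem_secIdeal hf
      (sub_mem (X_mul_mem_HZ i (hn j)) (X_mul_mem_HZ j (hn i))) (h i j)
    refine ⟨mkS f w, mkS_mem_gr (by simpa using hw), ?_⟩
    rw [← mkS_mul, ← mkS_mul, ← mkS_mul, ← map_sub]
    exact mkS_eq_mkS.2 hw2
  choose s hs hs2 using key
  let N : Fin 4 → SX f := fun i => mkS f (n i)
  let W : Fin 6 → SX f := ![s 3 2, s 1 3, s 2 1, s 3 0, s 0 2, s 1 0]
  have hW (t) : W t ∈ gr f b := by fin_cases t <;> exact hs _ _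
  have hNW : act (KD3 k) N = (X 0 : R4 k) • W := by
    rw [act_KD3]
    ext t
    fin_cases t <;> simp [W, N, ← hs2]
  have hW0 : act (KD2 k) W = 0 := by
    have h0 := act_act_zero (KD23 (k := k)) N
    rw [hNW, act_smul] at h0
    ext t
    exact smul_X_eq_zero hf hirr (congrFun h0 t)
  obtain ⟨w, hw, hw2⟩ := ex2_gr hf hirr.ne_zero b W hW hW0
  have hmem (j) : (N - (X 0 : R4 k) • w) j ∈ gr f b := by
    refine sub_mem (mkS_mem_gr (hn j)) ?_
    simpa using isGr_gr f _ _ _ (X_mem_HZ 0) (hw j)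
  obtain ⟨e, he, he2⟩ := ex3_gr hf hirr.ne_zero b (N - (X 0 : R4 k) • w) hmem (by
    rw [act_sub, act_smul, hw2, hNW, sub_self])
  choose w' hw' hw'2 using hw
  obtain ⟨e', he', he'2⟩ := he 0
  refine ⟨w', hw', e', he', fun i => ?_⟩
  have := congrFun he2 i
  rw [act_KD4_apply] at this
  rw [← mkS_eq_zero, map_sub, map_sub, mkS_mul, mkS_mul]
  erw [hw'2 i, he'2, this]
  simp [N]

variable {ι : Type}

/-- The multiples of the constant vector `c` that can be corrected by multiples of `x₀` to be
proportional to the position vector at the given vectors. -/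
noncomputable def badSub (b : ℤ) (Y : ι → Fin 4 → k) (c : Fin 4 → k) : Submodule k (R4 k) where
  carrier := {p | ∃ h : Fin 4 → R4 k, (∀ i, h i ∈ HZ k (b - 1)) ∧ ∀ y i j,
    (eval (Y y) (cZ k b p) * c i + Y y 0 * eval (Y y) (h i)) * Y y j =
      (eval (Y y) (cZ k b p) * c j + Y y 0 * eval (Y y) (h j)) * Y y i}
  zero_mem' := ⟨0, fun _ => zero_mem _, by simp⟩
  add_mem' := by
    rintro p q ⟨h, hh, H⟩ ⟨h', hh', H'⟩
    refine ⟨h + h', fun i => add_mem (hh i) (hh' i), fun y i j => ?_⟩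
    simp only [map_add, Pi.add_apply]
    linear_combination H y i j + H' y i j
  smul_mem' := by
    rintro a p ⟨h, hh, H⟩
    refine ⟨a • h, fun i => (HZ k _).smul_mem a (hh i), fun y i j => ?_⟩
    simp only [map_smul, Pi.smul_apply, smul_eval]
    linear_combination a * H y i j

theorem mem_badSub {b : ℤ} {Y : ι → Fin 4 → k} {c : Fin 4 → k} {p : R4 k} (hp : p ∈ HZ k b) :
    p ∈ badSub b Y c ↔ ∃ h : Fin 4 → R4 k, (∀ i, h i ∈ HZ k (b - 1)) ∧ ∀ y i j,
      (eval (Y y) p * c i + Y y 0 * eval (Y y) (h i)) * Y y j =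
        (eval (Y y) p * c j + Y y 0 * eval (Y y) (h j)) * Y y i := by
  conv_rhs => rw [← cZ_self hp]
  rfl

theorem X_zero_mul_mem_badSub (b : ℤ) (Y : ι → Fin 4 → k) (c : Fin 4 → k) (p : R4 k) :
    X 0 * p ∈ badSub b Y c := by
  refine ⟨fun i => C (-c i) * cZ k (b - 1) p, fun i => C_mul_mem_HZ _ (cZ_mem _ _),
    fun y i j => ?_⟩
  rw [cZ_X_mul]
  simp
  ring

/-- The constant vectors for which a given form is correctable. -/
noncomputable def badVec (b : ℤ) (Y : ι → Fin 4 → k) {p : R4 k} (hp : p ∈ HZ k b) : Submodule k (Fin 4 → k) where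
  carrier := {c | p ∈ badSub b Y c}
  zero_mem' := (mem_badSub hp).2 ⟨0, fun _ => zero_mem _, by simp⟩
  add_mem' := by
    intro c c' hc hc'
    obtain ⟨h, hh, H⟩ := (mem_badSub hp).1 hc
    obtain ⟨h', hh', H'⟩ := (mem_badSub hp).1 hc'
    refine (mem_badSub hp).2 ⟨h + h', fun i => add_mem (hh i) (hh' i), fun y i j => ?_⟩
    simp only [map_add, Pi.add_apply]
    linear_combination H y i j + H' y i j
  smul_mem' := by
    intro a c hc
    obtain ⟨h, hh, H⟩ := (mem_badSub hp).1 hc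
    refine (mem_badSub hp).2 ⟨a • h, fun i => (HZ k _).smul_mem a (hh i), fun y i j => ?_⟩
    simp only [Pi.smul_apply, smul_eval, smul_eq_mul]
    linear_combination a * H y i j

theorem GoodDiv.eval_eq_zero {b : ℕ} {D : R4 k} {P : ι → Fin 4 → k} (hD : GoodDiv f b D P)
    {h : Fin 4 → R4 k} (hh : ∀ p i j, eval (P p) (h i) * P p j = eval (P p) (h j) * P p i) (p : ι) :
    eval (P p) (h 0) = 0 := by
  obtain ⟨j, hj⟩ := Function.ne_iff.1 (hD.ne p)
  have := hh p 0 j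
  rw [hD.plane p, mul_zero] at this
  exact (mul_eq_zero.1 this).resolve_right hj

/-- Vectors of forms proportional to the position vector at the points of a plane curve section
agree with a constant multiple of the equation of the curve, up to proportional vectors. -/
theorem GoodDiv.exists_const (hf : f ∈ HZ k 3) {b : ℕ} {D : R4 k}
    {P : ι → Fin 4 → k} (hD : GoodDiv f b D P) {h : Fin 4 → R4 k} (hh : ∀ i, h i ∈ HZ k b)
    (hpar : ∀ p i j, eval (P p) (h i) * P p j = eval (P p) (h j) * P p i)
    (h0 : h 0 ∈ secIdeal f) : ∃ γ : Fin 4 → k, γ 0 = 0 ∧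
      ∀ i j, X i * (h j - D * C (γ j)) - X j * (h i - D * C (γ i)) ∈ secIdeal f := by
  have key (i j) : ∃ m : Fin 4 → k, X i * h j - X j * h i - D * lf m ∈ secIdeal f := by
    obtain ⟨M, hM, hM2⟩ := hD.div (b + 1) (X i * h j - X j * h i)
      (sub_mem (X_mul_mem_HZ i (hh j)) (X_mul_mem_HZ j (hh i))) (fun p => by
        simp only [map_sub, map_mul, eval_X]
        linear_combination hpar p j i)
    obtain ⟨m, rfl⟩ := exists_eq_lf (p := M) (by simpa using hM)
    exact ⟨m, hM2⟩
  choose m hm using key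
  have hq : X 1 * lf (m 2 3) - X 2 * lf (m 1 3) + X 3 * lf (m 1 2) ∈ secIdeal f := by
    apply hD.reg
    have := (secIdeal f).sub_mem ((secIdeal f).sub_mem ((secIdeal f).mul_mem_left (X 2) (hm 1 3))
      ((secIdeal f).mul_mem_left (X 1) (hm 2 3))) ((secIdeal f).mul_mem_left (X 3) (hm 1 2))
    convert this using 1
    ring
  have hdeg : X 1 * lf (m 2 3) - X 2 * lf (m 1 3) + X 3 * lf (m 1 2) ∈ HZ k 2 :=
    add_mem (sub_mem (X_mul_mem_HZ 1 (lf_mem_HZ _)) (X_mul_mem_HZ 2 (lf_mem_HZ _)))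
      (X_mul_mem_HZ 3 (lf_mem_HZ _))
  obtain ⟨w, hw, hw2⟩ := exists_of_mem_secIdeal hf hdeg hq
  have heq := mem_span_eq_zero_of_lt hf (by norm_num)
    (sub_mem hdeg (by simpa using X_mul_mem_HZ 0 hw)) hw2
  have hev (x : Fin 4 → k) (hx : x 0 = 0) : x 1 * ∑ i, m 2 3 i * x i - x 2 * ∑ i, m 1 3 i * x i
      + x 3 * ∑ i, m 1 2 i * x i = 0 := by
    have := congrArg (eval x) heq
    simpa [eval_lf, hx] using this
  have e1 := hev ![0, 1, 0, 0] rfl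
  have e2 := hev ![0, 0, 1, 0] rfl
  have e3 := hev ![0, 0, 0, 1] rfl
  have e12 := hev ![0, 1, 1, 0] rfl
  have e13 := hev ![0, 1, 0, 1] rfl
  have e23 := hev ![0, 0, 1, 1] rfl
  simp [Fin.sum_univ_four] at e1 e2 e3 e12 e13 e23
  let γ : Fin 4 → k := ![0, -m 1 3 3, m 1 2 1, m 1 3 1]
  have h12 : lf (m 1 2) = X 0 * C (m 1 2 0) + (X 1 * C (γ 2) - X 2 * C (γ 1)) := by
    have : m 1 2 2 = m 1 3 3 := by linear_combination e23 + e2 - e3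
    simp [lf, Fin.sum_univ_four, γ, e3, this]
    ring
  have h13 : lf (m 1 3) = X 0 * C (m 1 3 0) + (X 1 * C (γ 3) - X 3 * C (γ 1)) := by
    simp [lf, Fin.sum_univ_four, γ, e2]
    ring
  have h23 : lf (m 2 3) = X 0 * C (m 2 3 0) + (X 2 * C (γ 3) - X 3 * C (γ 2)) := by
    have h1 : m 2 3 2 = m 1 3 1 := by linear_combination e12 - e1 + e2
    have h2 : m 2 3 3 = -m 1 2 1 := by linear_combination e13 - e1 - e3
    simp [lf, Fin.sum_univ_four, γ, e1, h1, h2]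
    ring
  have h0j (j : Fin 4) : X 0 * (h j - D * C (γ j)) - X j * (h 0 - D * C (γ 0)) ∈ secIdeal f := by
    have : γ 0 = 0 := rfl
    rw [this, C_0, mul_zero, sub_zero]
    exact sub_mem (X_zero_mul_mem_secIdeal _) (Ideal.mul_mem_left _ _ h0)
  have hij {i j : Fin 4} (H : lf (m i j) = X 0 * C (m i j 0) + (X i * C (γ j) - X j * C (γ i))) :
      X i * (h j - D * C (γ j)) - X j * (h i - D * C (γ i)) ∈ secIdeal f := by
    have := add_mem (hm i j) (X_zero_mul_mem_secIdeal (f := f) (D * C (m i j 0)))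
    rw [H] at this
    convert this using 1
    ring
  have hsymm {i j : Fin 4} (H : X i * (h j - D * C (γ j)) - X j * (h i - D * C (γ i)) ∈ secIdeal f) :
      X j * (h i - D * C (γ i)) - X i * (h j - D * C (γ j)) ∈ secIdeal f := by
    have := neg_mem H
    rwa [neg_sub] at this
  refine ⟨γ, rfl, fun i j => ?_⟩
  fin_cases i <;> fin_cases j
  · exact h0j 0
  · exact h0j 1
  · exact h0j 2
  · exact h0j 3
  · exact hsymm (h0j 1)
  · simp
  · exact hij h12
  · exact hij h13
  · exact hsymm (h0j 2)
  · exact hsymm (hij h12)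
  · simp
  · exact hij h23
  · exact hsymm (h0j 3)
  · exact hsymm (hij h13)
  · exact hsymm (hij h23)
  · simp

/-- Adding the points of a plane curve section and one more point of the plane. -/
theorem RadialOnly.step (hf : f ∈ HZ k 3) (hirr : Irreducible f) {b : ℕ} {κ : Type}
    {Y : κ → Fin 4 → k} (hY : ∀ y, eval (Y y) f = 0) (hY0 : ∀ y, Y y 0 ≠ 0)
    (hrad : RadialOnly f (b - 1) Y) {D : R4 k} {P : ι → Fin 4 → k} (hD : GoodDiv f b D P)
    {c : Fin 4 → k} (hcf : eval c f = 0) (hc : c 0 = 0) (hcD : eval c D ≠ 0)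
    (hbad : D ∉ badSub b Y c) (hc0 : c ≠ 0) :
    RadialOnly f b (Sum.elim Y (Sum.elim P fun _ : Unit => c)) := by
  intro h hh hpar
  have hparY (y i j) := hpar (.inl y) i j
  have hparP (p i j) := hpar (.inr (.inl p)) i j
  have hparc (i j) := hpar (.inr (.inr ())) i j
  simp only [Sum.elim_inl, Sum.elim_inr] at hparY hparP hparc
  obtain ⟨l, hl⟩ := Function.ne_iff.1 hc0
  have hch0 : eval c (h 0) = 0 := by
    have := hparc 0 l
    rw [hc, mul_zero] at this
    exact (mul_eq_zero.1 this).resolve_right hl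
  have h0 : h 0 ∈ secIdeal f := by
    obtain ⟨F, hF, hF2⟩ := hD.div b (h 0) (hh 0) (hD.eval_eq_zero hparP)
    have hF' := mem_HZ_zero (by simpa using hF)
    have := secIdeal_eval hF2 hcf hc
    rw [hF', map_sub, map_mul, hch0, eval_C, zero_sub, neg_eq_zero, mul_eq_zero] at this
    rw [hF', this.resolve_left hcD, C_0, mul_zero, sub_zero] at hF2
    exact hF2
  obtain ⟨γ, -, hγ⟩ := hD.exists_const hf hh hparP h0
  obtain ⟨w, hw, e, he, H⟩ := exists_of_secIdeal_minors hf hirr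
    (n := fun i => h i - D * C (γ i))
    (fun i => sub_mem (hh i) (by rw [mul_comm]; exact C_mul_mem_HZ _ hD.mem)) hγ
  have hev {x : Fin 4 → k} (hx : eval x f = 0) (i : Fin 4) :
      eval x (h i) = eval x D * γ i + x 0 * eval x (w i) + x i * eval x e := by
    have : eval x _ = 0 := not_not.1 fun hne => notMem_span_of_eval hx hne (H i)
    simp at this
    linear_combination this
  have hγc (i) : γ i = γ l / c l * c i := by
    have h1 := hparc i l
    rw [hev hcf, hev hcf, hc] at h1
    have h2 : γ i * c l = γ l * c i := mul_left_cancel₀ hcD (by linear_combination h1)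
    rw [div_mul_eq_mul_div, eq_div_iff hl, h2]
  generalize γ l / c l = lam at hγc
  obtain rfl : γ = lam • c := funext hγc
  by_cases hlam : lam = 0
  · subst hlam
    obtain ⟨e', he', H'⟩ := hrad w (by exact_mod_cast hw) fun y i j => by
      have h1 := hparY y i j
      rw [hev (hY y), hev (hY y)] at h1
      simp at h1
      exact mul_left_cancel₀ (hY0 y) (by linear_combination h1)
    refine ⟨X 0 * e' + e, add_mem (by simpa using X_mul_mem_HZ 0 he') he, fun i => ?_⟩
    have := add_mem (H i) (Ideal.mul_mem_left _ (X 0) (H' i))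
    simp at this
    convert this using 1
    ring
  · refine absurd ((mem_badSub hD.mem).2 ⟨fun i => C lam⁻¹ * w i,
      fun i => C_mul_mem_HZ _ (hw i), fun y i j => ?_⟩) hbad
    have h1 := hparY y i j
    rw [hev (hY y), hev (hY y)] at h1
    simp at h1 ⊢
    field_simp
    linear_combination h1

end RadialStep

section RadialExistence

variable {k : Type} [Field k] {f : R4 k} {ι : Type}

/-- Points separated by forms of a given degree. -/
theorem exists_evSur_of_finrank {v : ι → Fin 4 → k} (hv : ∀ p, eval (v p) f = 0) {d : ℤ} {n : ℕ}
    (h : n + Module.finrank k (vanGr hv d) ≤ Module.finrank k (gr f d)) :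
    ∃ x : Fin n → ι, EvSur d fun i => v (x i) := by
  let E : gr f d →ₗ[k] (ι → k) := ((evS hv).restrictScalars k).domRestrict (gr f d)
  have hker : Module.finrank k (LinearMap.ker E) = Module.finrank k (vanGr hv d) := by
    have : vanGr hv d = (LinearMap.ker E).map (gr f d).subtype := by
      change _ = Submodule.map _
        (LinearMap.ker (((evS hv).restrictScalars k).domRestrict (gr f d)))
      rw [LinearMap.ker_domRestrict, Submodule.map_comap_subtype]
      rfl
    rw [this, Submodule.finrank_map_subtype_eq]
  obtain ⟨x, hx⟩ := exists_independent_points E n (by rwa [hker])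
  refine ⟨x, fun c => ?_⟩
  obtain ⟨⟨_, p, hp, rfl⟩, h2⟩ := hx c
  exact ⟨p, hp, h2⟩

theorem exists_evSur [IsAlgClosed k] (hf : f ∈ HZ k 3) (hirr : Irreducible f) {d n : ℕ}
    (h : n ≤ Hs d) : ∃ v : Fin n → Fin 4 → k, (∀ p, eval (v p) f = 0) ∧ EvSur (d : ℤ) v := by
  obtain ⟨x, hx⟩ := exists_evSur_of_finrank (v := fun x : {x : Fin 4 → k // eval x f = 0} => x.1)
    (fun x => x.2) (d := d) (n := n) (by
      have : vanGr (v := fun x : {x : Fin 4 → k // eval x f = 0} => x.1) (fun x => x.2) (d : ℤ) =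
          ⊥ := by
        rw [eq_bot_iff]
        intro s hs
        obtain ⟨p, -, rfl, hp⟩ := mem_vanGr _ hs
        refine mkS_eq_zero.2 (not_not.1 fun hne => ?_)
        obtain ⟨x, hx, hx2⟩ := exists_cone_eval_ne_zero hirr hne
        exact hx2 (hp ⟨x, hx⟩)
      rw [this, finrank_bot, finrank_gr hf hirr.ne_zero]
      exact h)
  exact ⟨_, fun p => (x p).2, hx⟩

theorem RadialOnly.comp_equiv {κ : Type} {d : ℤ} {v : ι → Fin 4 → k} (h : RadialOnly f d v)
    (e : κ ≃ ι) : RadialOnly f d fun i => v (e i) := by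
  intro g hg hpar
  exact h g hg fun p => by simpa using hpar (e.symm p)

theorem RadialOnly.zero {v : Fin 2 → Fin 4 → k} (h : EvSur 1 v) : RadialOnly f 0 v := by
  intro g hg hpar
  obtain ⟨_, hm, h2⟩ := h ![1, 0]
  obtain ⟨m, rfl⟩ := exists_eq_lf hm
  obtain ⟨_, hm', h3⟩ := h ![0, 1]
  obtain ⟨m', rfl⟩ := exists_eq_lf hm'
  have hg' (i) := mem_HZ_zero (hg i)
  generalize hγ : (fun i => coeff 0 (g i)) = γ
  replace hγ (i) : g i = C (γ i) := by rw [hg' i, ← hγ]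
  simp only [hγ, eval_C] at hpar
  have hmul (c : Fin 4 → k) (p i) : γ i * eval (v p) (lf c) = (∑ j, γ j * c j) * v p i := by
    rw [eval_lf, Finset.mul_sum, Finset.sum_mul]
    exact Finset.sum_congr rfl fun j _ => by linear_combination c j * hpar p i j
  have h1 (i) : γ i = (∑ j, γ j * m j) * v 0 i := by
    rw [← hmul, h2]; simp
  have h4 : ∑ j, γ j * m j = 0 := by
    have h5 (i) : (∑ j, γ j * m j) * v 1 i = 0 := by rw [← hmul, h2]; simp
    by_contra hne
    have h6 : v 1 = 0 := funext fun i => (mul_eq_zero.1 (h5 i)).resolve_left hne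
    have := h3 1
    rw [h6, eval_lf] at this
    simp at this
  refine ⟨0, zero_mem _, fun i => ?_⟩
  rw [hγ, h1, h4]
  simp

theorem exists_notMem_badSub [Fintype ι] (hf : f ∈ HZ k 3) (hirr : Irreducible f) {b : ℕ}
    {Y : ι → Fin 4 → k} (hY : ∀ y, eval (Y y) f = 0) (hY0 : ∀ y, Y y 0 ≠ 0)
    (hev : EvSur ((b + 1 : ℕ) : ℤ) Y) (hcard : 2 * Fintype.card ι = 3 * ((b + 1) * b) + 2 * b + 4) :
    ∃ G ∈ HZ k ((b + 1 : ℕ) : ℤ), ∃ i ≠ 0, G ∉ badSub ((b + 1 : ℕ) : ℤ) Y (Pi.single i 1) := by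
  by_contra! hall
  let φ : gr f b →ₗ[k] (ι → k) := ((evS hY).restrictScalars k).domRestrict (gr f b)
  have hφ (p) (hp : p ∈ HZ k b) : φ ⟨mkS f p, mkS_mem_gr hp⟩ = fun y => eval (Y y) p := rfl
  let Φ : (Fin 4 → gr f b) →ₗ[k] (ι × Fin 3 → k) := LinearMap.pi fun q =>
    Y q.1 q.2.succ • (LinearMap.proj q.1 ∘ₗ φ ∘ₗ LinearMap.proj 0) -
      Y q.1 0 • (LinearMap.proj q.1 ∘ₗ φ ∘ₗ LinearMap.proj q.2.succ)
  have hΦ (s q) : Φ s q = Y q.1 q.2.succ * φ (s 0) q.1 - Y q.1 0 * φ (s q.2.succ) q.1 := rfl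
  have hsurj : LinearMap.range Φ = ⊤ := by
    refine eq_top_iff.2 fun ξ _ => ?_
    choose G hG hG2 using fun j : Fin 3 => hev fun y => ξ (y, j)
    choose h hh hh2 using fun j : Fin 3 => (mem_badSub (hG j)).1 (hall _ (hG j) j.succ (by simp))
    have hmem (i) : ∑ j, h j i ∈ HZ k b := sum_mem fun j _ => by simpa using hh j i
    refine ⟨fun i => ⟨mkS f (∑ j, h j i), mkS_mem_gr (hmem i)⟩, ?_⟩
    ext ⟨y, j⟩
    rw [hΦ, hφ _ (hmem _), hφ _ (hmem _)]
    have key (j') : (if j' = j then ξ (y, j) else 0) + Y y 0 * eval (Y y) (h j' j.succ) =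
        eval (Y y) (h j' 0) * Y y j.succ := by
      have := hh2 j' y j.succ 0
      rw [hG2, Pi.single_apply, Pi.single_apply] at this
      refine mul_left_cancel₀ (hY0 y) ?_
      simp only [Fin.succ_inj, eq_comm (a := j), (Fin.succ_ne_zero _).symm, if_false] at this
      by_cases hj : j' = j
      · subst hj
        rw [if_pos rfl] at this ⊢
        linear_combination this
      · rw [if_neg hj] at this ⊢
        linear_combination this
    have hs := Finset.sum_congr (rfl : (Finset.univ : Finset (Fin 3)) = _) fun j' _ => key j'
    rw [Finset.sum_add_distrib, Finset.sum_ite_eq', ← Finset.mul_sum, ← Finset.sum_mul] at hs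
    simp only [map_sum]
    simp at hs
    linear_combination -hs
  let ρ : gr f (b - 1) →ₗ[k] (Fin 4 → gr f b) :=
    { toFun := fun e i => ⟨(X i : R4 k) • e.1, by
        simpa using isGr_gr f _ _ _ (X_mem_HZ i) e.2⟩
      map_add' := fun e e' => by ext i; simp
      map_smul' := fun a e => funext fun i => Subtype.ext (smul_comm _ a e.1) }
  have hρ : Function.Injective ρ := by
    rw [← LinearMap.ker_eq_bot, eq_bot_iff]
    intro e he
    exact Subtype.ext (smul_X_eq_zero hf hirr (congrArg Subtype.val (congrFun he 0)))
  have hρΦ (e) : ρ e ∈ LinearMap.ker Φ := by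
    obtain ⟨_, p, hp, rfl⟩ := e
    ext ⟨y, j⟩
    have hρe (i) : ρ ⟨mkS f p, mkS_mem_gr hp⟩ i =
        ⟨mkS f (X i * p), mkS_mem_gr (by simpa using X_mul_mem_HZ i hp)⟩ :=
      Subtype.ext mkS_mul.symm
    rw [hΦ]
    erw [hρe, hρe, hφ _ (by simpa using X_mul_mem_HZ 0 hp),
      hφ _ (by simpa using X_mul_mem_HZ j.succ hp)]
    simp
    ring
  have h1 : Module.finrank k (gr f (b - 1)) ≤ Module.finrank k (LinearMap.ker Φ) :=
    LinearMap.finrank_le_finrank_of_injective (f := ρ.codRestrict _ hρΦ)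
      (Function.Injective.codRestrict _ hρ)
  have h2 := LinearMap.finrank_range_add_finrank_ker Φ
  rw [hsurj, finrank_top, Module.finrank_fintype_fun_eq_card, Fintype.card_prod, Fintype.card_fin,
    Module.finrank_pi_fintype, Finset.sum_const, Finset.card_univ, Fintype.card_fin,
    finrank_gr hf hirr.ne_zero, smul_eq_mul] at h2
  have h3 := two_mul_Hs b
  rcases b with _ | b
  · omega
  · have h4 : Module.finrank k (gr f (((b + 1 : ℕ) : ℤ) - 1)) = Hs b := by
      rw [← finrank_gr hf hirr.ne_zero b, Nat.cast_succ, add_sub_cancel_right]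
    have h5 := two_mul_Hs b
    rw [h4] at h1
    nlinarith

/-- Tuples of points of the cubic at which only multiples of the position vector are
proportional to it. -/
theorem exists_radialOnly [IsAlgClosed k] (hf : f ∈ HZ k 3) (hirr : Irreducible f)
    (hpl : TransPlane f) (b : ℕ) : ∀ n : ℕ, 2 * n = 3 * ((b + 1) * b) + 2 * b + 4 →
      ∃ v : Fin n → Fin 4 → k, (∀ p, eval (v p) f = 0) ∧ RadialOnly f b v := by
  induction b with
  | zero =>
    intro n hn
    obtain rfl : n = 2 := by omega
    obtain ⟨v, hv, h⟩ := exists_evSur hf hirr (d := 1) (n := 2) (by have := two_mul_Hs 1; omega)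
    exact ⟨v, hv, RadialOnly.zero h⟩
  | succ b ih =>
    intro n' hn'
    obtain ⟨n, rfl⟩ : ∃ n, n' = n + (3 * (b + 1) + 1) := Nat.exists_eq_add_of_le' (by nlinarith)
    have hn : 2 * n = 3 * ((b + 1) * b) + 2 * b + 4 := by nlinarith
    have hH := two_mul_Hs (b + 1)
    obtain ⟨Y, hY, hrad, hev, hY0⟩ := OpenOnCone.exists_and hirr (RadialOnly.openOnCone b)
      (OpenOnCone.and (EvSur.openOnCone ((b + 1 : ℕ) : ℤ)) (openOnCone_eval_ne_zero (X 0)))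
      (ih n hn) (OpenOnCone.exists_and hirr (EvSur.openOnCone _) (openOnCone_eval_ne_zero _)
        (exists_evSur hf hirr (by nlinarith)) (by
          obtain ⟨x, hx, hx2⟩ := exists_cone_eval_ne_zero hirr (X_notMem_span hf 0)
          exact ⟨fun _ => x, fun _ => hx, fun _ => hx2⟩))
    simp only [eval_X] at hY0
    obtain ⟨G, hG, i, hi, hGi⟩ := exists_notMem_badSub hf hirr hY hY0 hev (by simpa using hn)
    obtain ⟨ψ, hψi, hψ⟩ := Submodule.exists_le_ker_of_notMem (p := badVec _ Y hG) hGi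
    have hψz (c : Fin 4 → k) : eval c (lf fun j => ψ (Pi.single j 1)) = ψ c := by
      rw [eval_lf]
      conv_rhs => rw [pi_eq_sum_univ' c]
      simp [mul_comm]
    obtain ⟨c, hcf, hc, hcz⟩ := hpl.exists_cone_ne_zero hf
      (z := fun j => ψ (Pi.single j 1)) hi hψi
    rw [hψz] at hcz
    have hc0 : c ≠ 0 := fun h => hcz (by rw [h, map_zero])
    obtain ⟨D, ι, _, P, hcard, hD, hcD, hDB⟩ := hpl.exists_goodDiv hf
      (B := badSub ((b + 1 : ℕ) : ℤ) Y c) (X_zero_mul_mem_badSub _ Y c) hc hc0 hG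
      (fun h => hcz (hψ h))
    have hstep := RadialOnly.step hf hirr hY hY0 (by simpa using hrad) hD hcf hc hcD hDB hc0
    let e : Fin (n + (3 * (b + 1) + 1)) ≃ Fin n ⊕ (ι ⊕ Unit) :=
      Fintype.equivOfCardEq (by simp [hcard])
    refine ⟨_, fun p => ?_, hstep.comp_equiv e⟩
    rcases e p with p | p | p
    exacts [hY p, hD.cone p, hcf]

end RadialExistence

section SyzygyExistence

variable {k : Type} [Field k] {f : R4 k} {ι κ : Type}

theorem finrank_map_add_finrank_inf_ker {V W : Type} [AddCommGroup V] [Module k V]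
    [AddCommGroup W] [Module k W] (L : V →ₗ[k] W) (U : Submodule k V) [FiniteDimensional k U] :
    Module.finrank k (U.map L) + Module.finrank k (U ⊓ LinearMap.ker L : Submodule k V) =
      Module.finrank k U := by
  have h := LinearMap.finrank_range_add_finrank_ker (L.domRestrict U)
  rwa [LinearMap.range_domRestrict, LinearMap.ker_domRestrict,
    ← Submodule.finrank_map_subtype_eq U, Submodule.map_comap_subtype] at h

/-- A dimension count: if linear syzygies are determined by their values, all values occur. -/
theorem syzSur_of_eval_eq_zero [Fintype ι] (hf : f ∈ HZ k 3) (hf0 : f ≠ 0)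
    {v : ι → Fin 4 → k} (hv : ∀ p, eval (v p) f = 0) (hv0 : ∀ p, v p ≠ 0) {b : ℕ}
    (hcard : 3 * Fintype.card ι + Hs (b + 1) = 4 * Hs b)
    (h : ∀ g : Fin 4 → R4 k, (∀ i, g i ∈ HZ k b) → ∑ i, X i * g i ∈ Ideal.span {f} →
      (∀ p i, eval (v p) (g i) = 0) → ∀ i, g i ∈ Ideal.span {f}) : SyzSur f b v := by
  rw [syzSur_iff_rank hv hv0, LinearMap.range_domRestrict]
  let L1 : (Fin 4 → R4 k) →ₗ[k] SX f := (mkS f).restrictScalars k ∘ₗ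
    ∑ i, LinearMap.mulLeft k (X i : R4 k) ∘ₗ LinearMap.proj i
  let L2 : (Fin 4 → R4 k) →ₗ[k] (Fin 4 → SX f) :=
    LinearMap.pi fun i => (mkS f).restrictScalars k ∘ₗ LinearMap.proj i
  have hL1 (g) : L1 g = mkS f (∑ i, X i * g i) := by simp [L1]
  have hL2 (g i) : L2 g i = mkS f (g i) := rfl
  have e0 := finrank_map_add_finrank_inf_ker (evVec v) (syzVec f b)
  have e1 := finrank_map_add_finrank_inf_ker L1 (formVec k b)
  have e2 := finrank_map_add_finrank_inf_ker L2 (formVec k b)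
  have h1 : (formVec k b).map L1 ≤ gr f ((b + 1 : ℕ) : ℤ) := by
    rintro _ ⟨g, hg, rfl⟩
    rw [hL1]
    refine mkS_mem_gr (sum_mem fun i _ => ?_)
    simpa using X_mul_mem_HZ i (mem_formVec.1 hg i)
  have h2 : formVec k b ⊓ LinearMap.ker L1 = syzVec f b := by
    ext g
    rw [Submodule.mem_inf, mem_syzVec, mem_formVec, LinearMap.mem_ker, hL1, mkS_eq_zero]
  have h3 : syzVec f b ⊓ LinearMap.ker (evVec v) ≤ formVec k b ⊓ LinearMap.ker L2 := by
    rintro g ⟨hg, hg2⟩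
    rw [SetLike.mem_coe, mem_syzVec] at hg
    refine ⟨mem_formVec.2 hg.1, funext fun i => ?_⟩
    exact mkS_eq_zero.2 (h g hg.1 hg.2 (fun p i => congrFun hg2 (p, i)) i)
  let φ : (Fin 4 → gr f b) →ₗ[k] (Fin 4 → SX f) :=
    LinearMap.pi fun i => (gr f b).subtype ∘ₗ LinearMap.proj i
  have h4 : LinearMap.range φ ≤ (formVec k b).map L2 := by
    rintro _ ⟨s, rfl⟩
    choose p hp hp2 using fun i => mem_gr.1 (s i).2
    exact ⟨p, mem_formVec.2 hp, funext hp2⟩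
  have hφ : Function.Injective φ := fun s t hst => by
    ext i
    exact congrFun hst i
  have h5 := Submodule.finrank_mono h4
  rw [LinearMap.finrank_range_of_inj hφ, Module.finrank_pi_fintype] at h5
  simp only [finrank_gr hf hf0, Finset.sum_const, Finset.card_univ, Fintype.card_fin,
    smul_eq_mul] at h5
  have h6 := Submodule.finrank_mono h1
  have : FiniteDimensional k (formVec k b ⊓ LinearMap.ker L2 : Submodule k (Fin 4 → R4 k)) :=
    Submodule.finiteDimensional_of_le inf_le_left
  have h7 := Submodule.finrank_mono h3
  rw [finrank_gr hf hf0] at h6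
  rw [h2] at e1
  omega

/-- No linear syzygies occur among generators whose syzygies are all of degree two. -/
theorem Res3Body.mem_span_of_sum_X_mul (hf : f ∈ HZ k 3) {I : Ideal (R4 k)} {b n1 n2 n3 : ℕ}
    {d3 : Fin n3 → ℕ} {g : Fin n1 → R4 k} {M2 : Fin n2 → Fin n1 → R4 k}
    {M3 : Fin n3 → Fin n2 → R4 k}
    (H : Res3Body k (Ideal.span {f}) I (fun _ => b) (fun _ => b + 2) d3 g M2 M3)
    {G : Fin 4 → R4 k} (hG : ∀ i, G i ∈ HZ k b) (hGI : ∀ i, G i ∈ I)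
    (hG0 : ∑ i, X i * G i ∈ Ideal.span {f}) (i : Fin 4) : G i ∈ Ideal.span {f} := by
  obtain ⟨hg, hgen, hM, -, hsyz, -⟩ := H
  choose w hw using fun i => hgen (G i) (hGI i)
  have hg' (j) : g j ∈ HZ k b := mem_HZ_nat.2 (hg j).2
  generalize hc : (fun i j => coeff 0 (cZ k 0 (w i j))) = c
  have hcw (i j) : cZ k b (w i j * g j) = C (c i j) * g j := by
    rw [cZ_mul' _ (hg' j), sub_self, mem_HZ_zero (cZ_mem 0 (w i j)), ← hc]
  have h1 (i) : G i - ∑ j, C (c i j) * g j ∈ Ideal.span {f} := by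
    have := cZ_mem_span hf (hw i) b
    rwa [map_sub, map_sum, cZ_self (hG i), Finset.sum_congr rfl fun j _ => hcw i j] at this
  have h2 : ∑ j, lf (fun i => c i j) * g j ∈ Ideal.span {f} := by
    have h3 : ∑ j, lf (fun i => c i j) * g j =
        ∑ i, X i * G i - ∑ i, X i * (G i - ∑ j, C (c i j) * g j) := by
      rw [← Finset.sum_sub_distrib]
      simp only [mul_sub, sub_sub_cancel, lf, Finset.sum_mul, Finset.mul_sum]
      rw [Finset.sum_comm]
      exact Finset.sum_congr rfl fun i _ => Finset.sum_congr rfl fun j _ => by ring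
    rw [h3]
    exact sub_mem hG0 (sum_mem fun i _ => Ideal.mul_mem_left _ _ (h1 i))
  obtain ⟨u, hu⟩ := (hsyz _).1 h2
  have h3 (j) : lf (fun i => c i j) = 0 := by
    rw [← cZ_self (lf_mem_HZ _), hu, map_sum]
    refine Finset.sum_eq_zero fun l _ => ?_
    have hM2 : M2 l j ∈ HZ k 2 := by
      rcases (hM l j).1 with h | ⟨e, he, h⟩
      · rw [h]; exact zero_mem _
      · obtain rfl : e = 2 := by dsimp only at he; omega
        exact mem_HZ_nat.2 h
    rw [cZ_mul' _ hM2, cZ_neg (by norm_num), zero_mul]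
  have h4 (i j) : c i j = 0 := by
    have := congrArg (eval (Pi.single i 1)) (h3 j)
    simpa [eval_lf, Pi.single_apply] using this
  have := h1 i
  simpa [h4] using this

theorem SyzSur.comp_equiv {d : ℤ} {v : ι → Fin 4 → k} (h : SyzSur f d v) (e : κ ≃ ι) :
    SyzSur f d fun i => v (e i) := by
  intro ξ hξ
  obtain ⟨g, hg, h1, h2⟩ := h (fun p => ξ (e.symm p)) fun p => by simpa using hξ (e.symm p)
  exact ⟨g, hg, h1, fun p i => by simpa using h2 (e p) i⟩

theorem EvSur.ne_zero {b : ℕ} (hb : b ≠ 0) {v : ι → Fin 4 → k} (h : EvSur (b : ℤ) v) (p : ι) :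
    v p ≠ 0 := by
  intro h0
  obtain ⟨q, hq, hq2⟩ := h fun _ => 1
  have := eval_smul_of_mem_HZ hq 0 0
  rw [smul_zero, ← h0, hq2, zero_pow hb, zero_mul] at this
  exact one_ne_zero this

/-- Adding points of a plane section separated by forms to a set of points off the plane. -/
theorem SyzSur.sumElim {d : ℤ} {v : ι → Fin 4 → k} {P : κ → Fin 4 → k} (h : SyzSur f d v)
    (hv : ∀ p, v p 0 ≠ 0) (hP : ∀ p, P p 0 = 0) (hP0 : ∀ p, P p ≠ 0) (hev : EvSur d P) :
    SyzSur f (d + 1) (Sum.elim v P) := by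
  intro ξ hξ
  choose m hm using fun p => Function.ne_iff.1 (hP0 p)
  simp only [Pi.zero_apply] at hm
  choose A hA hA2 using fun q : Fin 4 × Fin 4 =>
    hev fun p => if q.2 = m p then ξ (.inr p) q.1 / P p (m p) else 0
  let w (i : Fin 4) : R4 k := ∑ j, X j * (A (i, j) - A (j, i))
  have hw (i) : w i ∈ HZ k (d + 1) :=
    sum_mem fun j _ => X_mul_mem_HZ j (by simpa using sub_mem (hA (i, j)) (hA (j, i)))
  have hw0 : ∑ i, X i * w i = 0 := by
    have h1 : ∑ i, X i * w i = ∑ i, ∑ j, X i * X j * A (i, j) - ∑ i, ∑ j, X i * X j * A (j, i) := by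
      rw [← Finset.sum_sub_distrib]
      refine Finset.sum_congr rfl fun i _ => ?_
      rw [← Finset.sum_sub_distrib, Finset.mul_sum]
      exact Finset.sum_congr rfl fun j _ => by ring
    rw [h1, sub_eq_zero, Finset.sum_comm]
    exact Finset.sum_congr rfl fun i _ => Finset.sum_congr rfl fun j _ => by ring
  have hwP (p i) : eval (P p) (w i) = ξ (.inr p) i := by
    have h1 := hξ (.inr p)
    rw [Sum.elim_inr] at h1
    have h2 : ∀ i, ∑ j, P p j * (if j = m p then ξ (.inr p) i / P p (m p) else 0) =
        ξ (.inr p) i := by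
      intro i
      simp only [mul_ite, mul_zero, Finset.sum_ite_eq', Finset.mem_univ, if_true]
      exact mul_div_cancel₀ _ (hm p)
    have h3 : ∑ j, P p j * (if i = m p then ξ (.inr p) j / P p (m p) else 0) = 0 := by
      split_ifs
      · have : ∑ j, P p j * (ξ (.inr p) j / P p (m p)) = (∑ j, ξ (.inr p) j * P p j) / P p (m p) := by
          rw [Finset.sum_div]
          exact Finset.sum_congr rfl fun j _ => by ring
        rw [this, h1, zero_div]
      · simp
    simp only [w, map_sum, map_mul, map_sub, eval_X, hA2, mul_sub, Finset.sum_sub_distrib]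
    rw [h2, h3, sub_zero]
  obtain ⟨g, hg, hg0, hgv⟩ := h (fun p i => (ξ (.inl p) i - eval (v p) (w i)) / v p 0) (by
    intro p
    have h1 := hξ (.inl p)
    have h2 := congrArg (eval (v p)) hw0
    simp only [map_sum, map_mul, eval_X, map_zero] at h2
    rw [Sum.elim_inl] at h1
    have h3 : ∑ i, (ξ (.inl p) i - eval (v p) (w i)) / v p 0 * v p i =
        (∑ i, ξ (.inl p) i * v p i - ∑ i, v p i * eval (v p) (w i)) / v p 0 := by
      rw [← Finset.sum_sub_distrib, Finset.sum_div]
      exact Finset.sum_congr rfl fun i _ => by ring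
    rw [h3, h1, h2]
    simp)
  refine ⟨fun i => w i + X 0 * g i, fun i => ?_, ?_, ?_⟩
  · exact add_mem (hw i) (X_mul_mem_HZ 0 (by simpa using hg i))
  · have h1 : ∑ i, X i * (w i + X 0 * g i) = X 0 * ∑ i, X i * g i := by
      rw [← zero_add (X 0 * _), ← hw0, Finset.mul_sum, ← Finset.sum_add_distrib]
      exact Finset.sum_congr rfl fun i _ => by ring
    rw [h1]
    exact Ideal.mul_mem_left _ _ hg0
  · rintro (p | p) i
    · have := hgv p i
      have hp := hv p
      simp only [Sum.elim_inl, map_add, map_mul, eval_X, this]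
      field_simp
      ring
    · simp [hP, hwP]

/-- A transversal plane section has enough points to be separated by forms. -/
theorem TransPlane.exists_evSur [IsAlgClosed k] (hf : f ∈ HZ k 3) (hirr : Irreducible f)
    (hpl : TransPlane f) {b n : ℕ} (hn : n ≤ 3 * (b + 1)) :
    ∃ P : Fin n → Fin 4 → k, (∀ p, eval (P p) f = 0) ∧ (∀ p, P p 0 = 0) ∧
      EvSur ((b + 1 : ℕ) : ℤ) P := by
  let V : {c : Fin 4 → k // eval c f = 0 ∧ c 0 = 0} → Fin 4 → k := fun c => c.1
  have hV (c) : eval (V c) f = 0 := c.2.1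
  have hle : vanGr hV ((b + 1 : ℕ) : ℤ) ≤
      (gr f b).map (((LinearMap.lsmul (R4 k) (SX f)) (X 0)).restrictScalars k) := by
    intro s hs
    obtain ⟨p, hp, rfl, hp0⟩ := mem_vanGr hV hs
    obtain ⟨w, hw, hw2⟩ := exists_of_mem_secIdeal hf hp
      (hpl.mem_secIdeal hf hp fun c hc hc0 => hp0 ⟨c, hc, hc0⟩)
    refine ⟨mkS f w, mkS_mem_gr (by simpa using hw), ?_⟩
    change (X 0 : R4 k) • mkS f w = mkS f p
    rw [← mkS_mul, eq_comm, mkS_eq_mkS]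
    exact hw2
  have h1 := (Submodule.finrank_mono hle).trans (Submodule.finrank_map_le _ _)
  obtain ⟨x, hx⟩ := exists_evSur_of_finrank hV (d := ((b + 1 : ℕ) : ℤ)) (n := n) (by
    rw [finrank_gr hf hirr.ne_zero] at h1 ⊢
    have e1 := two_mul_Hs b
    have e2 := two_mul_Hs (b + 1)
    nlinarith)
  exact ⟨_, fun p => (x p).2.1, fun p => (x p).2.2, hx⟩

theorem TransPlane.exists_syzSur [IsAlgClosed k] (hf : f ∈ HZ k 3) (hirr : Irreducible f)
    (hpl : TransPlane f) {b m n : ℕ} (hn : n ≤ 3 * (b + 1)) {v : Fin m → Fin 4 → k}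
    (hv : ∀ p, eval (v p) f = 0) (hv0 : ∀ p, v p ≠ 0) (h : SyzSur f ((b + 1 : ℕ) : ℤ) v) :
    ∃ w : Fin (m + n) → Fin 4 → k, (∀ p, eval (w p) f = 0) ∧
      SyzSur f ((b + 2 : ℕ) : ℤ) w ∧ ∀ p, w p ≠ 0 := by
  obtain ⟨w, hw, ⟨hw1, -⟩, hw2⟩ := OpenOnCone.exists_and hirr (SyzSur.openOnCone ((b + 1 : ℕ) : ℤ))
    (openOnCone_eval_ne_zero (X 0)) ⟨v, hv, h, hv0⟩ (by
      obtain ⟨x, hx, hx2⟩ := exists_cone_eval_ne_zero hirr (X_notMem_span hf 0)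
      exact ⟨fun _ => x, fun _ => hx, fun _ => hx2⟩)
  obtain ⟨P, hP, hP0, hev⟩ := hpl.exists_evSur hf hirr hn
  have hPn := hev.ne_zero (by omega)
  have := hw1.sumElim (by simpa using hw2) hP0 hPn hev
  refine ⟨_, fun p => ?_, by simpa [add_assoc] using this.comp_equiv finSumFinEquiv.symm,
    fun p => ?_⟩ <;> generalize finSumFinEquiv.symm p = q <;> rcases q with q | q
  · exact hw q
  · exact hP q
  · rintro h0
    rw [Sum.elim_inl] at h0
    exact hw2 q (by simp [h0])
  · exact hPn q

end SyzygyExistence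

section GeneralPoints

variable {k : Type} [Field k] {f : R4 k}

theorem mem_pointsIdeal_iff [Infinite k] {n : ℕ} {Z : Fin n → P3 k} {v : Fin n → Fin 4 → k}
    (hv : ∀ i, ∃ hv : v i ≠ 0, Projectivization.mk k (v i) hv = Z i) (x : R4 k) :
    x ∈ pointsIdeal k (Set.range Z) ↔ ∀ (d : ℕ) (p : Fin n), eval (v p) (cZ k d x) = 0 := by
  have hsum (c : k) (p : Fin n) : eval (c • v p) x =
      ∑ d ∈ Finset.range (x.totalDegree + 1), c ^ d * eval (v p) (cZ k d x) := by
    conv_lhs => rw [← sum_cZ x, map_sum]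
    exact Finset.sum_congr rfl fun d _ => eval_smul_of_mem_HZ (cZ_mem _ _) c _
  constructor
  · intro hx d p
    obtain ⟨h0, hp⟩ := hv p
    let q : Polynomial k := ∑ d ∈ Finset.range (x.totalDegree + 1),
      Polynomial.monomial d (eval (v p) (cZ k d x))
    have hq (c : k) (hc : c ≠ 0) : q.eval c = 0 := by
      have h1 := hx (Z p) ⟨p, rfl⟩ (c • v p) (smul_ne_zero hc h0) (by
        rw [← hp, Projectivization.mk_eq_mk_iff']
        exact ⟨c, rfl⟩)
      rw [hsum] at h1
      simpa [q, Polynomial.eval_finsetSum, mul_comm] using h1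
    have hq0 : q = 0 := by
      refine Polynomial.eq_zero_of_infinite_isRoot q
        (Set.Infinite.mono (fun c hc => hq c hc) (Set.finite_singleton (0 : k)).infinite_compl)
    have h2 := congrArg (Polynomial.coeff · d) hq0
    simp only [q, Polynomial.finsetSum_coeff, Polynomial.coeff_monomial, Finset.sum_ite_eq',
      Finset.mem_range, Polynomial.coeff_zero] at h2
    split_ifs at h2 with h3
    · exact h2
    · rw [cZ_nat, homogeneousComponent_eq_zero _ _ (by omega), map_zero]
  · rintro hx _ ⟨p, rfl⟩ w hw hwp
    obtain ⟨h0, hp⟩ := hv p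
    rw [← hp, Projectivization.mk_eq_mk_iff'] at hwp
    obtain ⟨c, rfl⟩ := hwp
    rw [hsum]
    exact Finset.sum_eq_zero fun d _ => by rw [hx, mul_zero]

theorem mem_pointsIdeal_of_mem_HZ [Infinite k] {n : ℕ} {Z : Fin n → P3 k}
    {v : Fin n → Fin 4 → k}
    (hv : ∀ i, ∃ hv : v i ≠ 0, Projectivization.mk k (v i) hv = Z i) {d : ℤ} {p : R4 k}
    (hp : p ∈ HZ k d) (h : ∀ i, eval (v i) p = 0) : p ∈ pointsIdeal k (Set.range Z) := by
  rw [mem_pointsIdeal_iff hv]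
  intro e i
  rw [cZ_of_mem hp]
  split_ifs
  · exact h i
  · exact map_zero _

/-- Points separated by forms are pairwise distinct. -/
theorem EvSur.injective_mk {b n : ℕ} {v : Fin n → Fin 4 → k} (h : EvSur (b : ℤ) v)
    (hv0 : ∀ p, v p ≠ 0) :
    Function.Injective fun p => Projectivization.mk k (v p) (hv0 p) := by
  intro p q hpq
  rw [Projectivization.mk_eq_mk_iff'] at hpq
  obtain ⟨c, hc⟩ := hpq
  by_contra hne
  obtain ⟨F, hF, hF2⟩ := h (Pi.single p 1)
  have h1 := hF2 p
  rw [← hc, eval_smul_of_mem_HZ hF, hF2 q, Pi.single_eq_same,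
    Pi.single_eq_of_ne (Ne.symm hne), mul_zero] at h1
  exact zero_ne_one h1

theorem vanishesAt_mk (hf : f ∈ HZ k 3) {x : Fin 4 → k} (hx0 : x ≠ 0) (hx : eval x f = 0) :
    VanishesAt k f (Projectivization.mk k x hx0) := by
  intro w hw hwx
  rw [Projectivization.mk_eq_mk_iff'] at hwx
  obtain ⟨c, rfl⟩ := hwx
  rw [eval_smul_of_mem_HZ (d := 3) hf, hx, mul_zero]

/-- Conditions which are open on configurations of points on the cone hold for general points. -/
theorem generalPointsSatisfy_of_openOnCone (S : SmoothCubicSurface k) {n b : ℕ}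
    {P : (Fin n → Fin 4 → k) → Prop} (hP : OpenOnCone S.f P)
    (hex : ∃ v, (∀ p, eval (v p) S.f = 0) ∧ P v) (hev : ∀ v, P v → EvSur (b : ℤ) v)
    (h0 : ∀ v, P v → ∀ p, v p ≠ 0) {Q : (Fin n → P3 k) → Prop}
    (hQ : ∀ Z v, (∀ i, ∃ hv : v i ≠ 0, Projectivization.mk k (v i) hv = Z i) →
      (∀ p, eval (v p) S.f = 0) → P v → Q Z) : GeneralPointsSatisfy k S n Q := by
  obtain ⟨v, hv, hPv⟩ := hex
  obtain ⟨G, hG, hG'⟩ := hP v hv hPv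
  refine ⟨G, ⟨fun p => Projectivization.mk k (v p) (h0 v hPv p),
    ⟨(hev v hPv).injective_mk _, fun p => vanishesAt_mk (mem_HZ_nat.2 S.homog) _ (hv p)⟩,
    v, fun p => ⟨h0 v hPv p, rfl⟩, hG⟩, ?_⟩
  rintro Z ⟨-, hZ⟩ ⟨w, hw, hw2⟩
  have hwf (p) : eval (w p) S.f = 0 := (hw p).elim fun h1 h2 => hZ p _ h1 h2
  exact hQ Z w hw hwf (hG' w hwf hw2)

/-- A minimal resolution without linear syzygies makes linear syzygies among forms take all
admissible values at the points. -/
theorem HasMinFreeRes3.syzSur [Infinite k] (hf : f ∈ HZ k 3) (hf0 : f ≠ 0) {n b n1 n2 n3 : ℕ}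
    {d3 : Fin n3 → ℕ} {Z : Fin n → P3 k} {v : Fin n → Fin 4 → k}
    (hvZ : ∀ i, ∃ hv : v i ≠ 0, Projectivization.mk k (v i) hv = Z i)
    (hv : ∀ p, eval (v p) f = 0) (hcard : 3 * n + Hs (b + 1) = 4 * Hs b)
    (H : HasMinFreeRes3 k (Ideal.span {f}) (pointsIdeal k (Set.range Z))
      (fun _ : Fin n1 => b) (fun _ : Fin n2 => b + 2) d3) : SyzSur f b v := by
  obtain ⟨g, M2, M3, H⟩ := H
  refine syzSur_of_eval_eq_zero hf hf0 hv (fun p => (hvZ p).elim fun h _ => h) (by simpa using hcard)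
    fun g hg hg0 hgv => ?_
  exact H.mem_span_of_sum_X_mul hf hg
    (fun i => mem_pointsIdeal_of_mem_HZ hvZ (hg i) fun p => hgv p i) hg0

/-- A point set with the given resolution exists only in degree at least three. -/
theorem HasMinFreeRes3.three_le (hirr : Irreducible f) {I : Ideal (R4 k)} {a n3 : ℕ}
    {d3 : Fin n3 → ℕ} (hI : a = 0 → I = ⊤)
    (H : HasMinFreeRes3 k (Ideal.span {f}) I (fun _ : Fin a => a - 1)
      (fun _ : Fin (3 * a - 3) => a + 1) d3) : 3 ≤ a := by
  obtain ⟨g, M2, M3, hg, hgen, hM, -, hsyz, -⟩ := H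
  match a, g, M2, hI, hg, hgen, hM, hsyz with
  | 0, g, M2, hI, hg, hgen, hM, hsyz =>
    obtain ⟨w, hw⟩ := hgen 1 (by rw [hI rfl]; trivial)
    rw [Finset.univ_eq_empty, Finset.sum_empty, sub_zero, Ideal.mem_span_singleton] at hw
    exact absurd (isUnit_of_dvd_one hw) hirr.not_isUnit
  | 1, g, M2, hI, hg, hgen, hM, hsyz =>
    obtain ⟨u, hu⟩ := (hsyz fun _ => f).1 (by
      rw [Fin.sum_univ_one]
      exact Ideal.mul_mem_right _ _ (Ideal.mem_span_singleton_self f))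
    have := hu 0
    rw [Finset.sum_eq_zero (fun i _ => i.elim0)] at this
    exact absurd this hirr.ne_zero
  | 2, g, M2, hI, hg, hgen, hM, hsyz =>
    have hg1 : g 1 = 0 := by
      obtain ⟨u, hu⟩ := (hsyz ![g 1, - g 0]).1 (by
        rw [Fin.sum_univ_two]
        simp [mul_comm])
      have h1 := hu 0
      have h2 : g 1 ∈ HZ k 1 := (mem_HZ_nat (n := 1)).2 (hg 1).2
      rw [Matrix.cons_val_zero] at h1
      rw [← cZ_self h2, h1, map_sum]
      refine Finset.sum_eq_zero fun l _ => ?_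
      have hM2 : M2 l 0 ∈ HZ k 2 := by
        rcases (hM l 0).1 with h | ⟨e, he, h⟩
        · rw [h]; exact zero_mem _
        · obtain rfl : e = 2 := by dsimp only at he; omega
          exact mem_HZ_nat.2 h
      rw [cZ_mul' _ hM2, cZ_neg (by norm_num), zero_mul]
    obtain ⟨u, hu⟩ := (hsyz ![0, 1]).1 (by
      rw [Fin.sum_univ_two, hg1]
      simp)
    have h1 := congrArg (coeff 0) (hu 1)
    rw [← constantCoeff_eq, map_sum] at h1
    have h2 (i) : constantCoeff (u i * M2 i 1) = 0 := by
      rw [map_mul, show constantCoeff (M2 i 1) = 0 from (hM i 1).2, mul_zero]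
    simp [h2] at h1
  | a + 3, _, _, _, _, _, _, _ => omega

theorem SmoothCubicSurface.exists_transPlane [IsAlgClosed k] (S : SmoothCubicSurface k) :
    ∃ A B : Matrix (Fin 4) (Fin 4) k, B * A = 1 ∧ TransPlane (linSub A S.f) := by
  obtain ⟨w, u, h⟩ := exists_transLine (mem_HZ_nat.2 S.homog) S.irred S.smooth
  obtain ⟨A, B, hAB, w', u', hw, hu, h'⟩ := exists_linSub_transLine (mem_HZ_nat.2 S.homog) h
  exact ⟨A, B, hAB, w', u', hw, hu, h'⟩

end GeneralPoints

/-- Second link.  If a general set of `n(a-1)` points on `X` has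
`0 → R(-a-2)^(2a-3) → R(-a-1)^(3a-3) → R(-a+1)^a → I_(Z,X) → 0` as graded minimal free
resolution over `R`, then a general set of `o(a)` points on `X` has graded minimal free
resolution `0 → R(-a-3)^a → R(-a-1)^(3a-3) ⊕ R(-a-2)^3 → R(-a)^(2a) → I_(Z,X) → 0`. -/
theorem second_link (k : Type) [Field k] [IsAlgClosed k]
    (S : SmoothCubicSurface k) (a : ℕ)
    (hyp : GeneralPointsSatisfy k S (3 * ((a - 1) * (a - 2) / 2) + 2 * (a - 1)) (fun Z =>
      HasMinFreeRes3 k (Ideal.span {S.f}) (pointsIdeal k (Set.range Z))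
        (fun _ : Fin (a) => a - 1) (fun _ : Fin (3 * a - 3) => a + 1) (fun _ : Fin (2 * a - 3) => a + 2))) :
    GeneralPointsSatisfy k S (3 * (a * (a - 1) / 2) + a + 1) (fun Z =>
      HasMinFreeRes3 k (Ideal.span {S.f}) (pointsIdeal k (Set.range Z))
        (fun _ : Fin (2 * a) => a)
        (Fin.append (fun _ : Fin (3 * a - 3) => a + 1) (fun _ : Fin (3) => a + 2))
        (fun _ : Fin (a) => a + 3)) := by
  have hinf : Infinite k := IsAlgClosed.instInfinite
  obtain ⟨g, ⟨Z, hZ, hZg⟩, hyp⟩ := hyp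
  replace hyp := hyp Z hZ hZg
  obtain ⟨v, hvZ, -⟩ := hZg
  have hv (p) : eval (v p) S.f = 0 := (hvZ p).elim fun h1 h2 => hZ.2 p _ h1 h2
  have ha := hyp.three_le S.irred (by
    rintro rfl
    rw [eq_top_iff]
    rintro x - _ ⟨i, -⟩
    exact i.elim0)
  obtain ⟨b, rfl⟩ := Nat.exists_eq_add_of_le' ha
  have hf : S.f ∈ HZ k 3 := mem_HZ_nat.2 S.homog
  have d1 : 2 * ((b + 2) * (b + 1) / 2) = (b + 2) * (b + 1) :=
    Nat.mul_div_cancel' (by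
      have := (Nat.even_mul_succ_self (b + 1)).two_dvd
      rwa [mul_comm] at this)
  have d2 : 2 * ((b + 3) * (b + 2) / 2) = (b + 3) * (b + 2) :=
    Nat.mul_div_cancel' (by
      have := (Nat.even_mul_succ_self (b + 2)).two_dvd
      rwa [mul_comm] at this)
  have e1 := two_mul_Hs (b + 2)
  have e2 := two_mul_Hs (b + 3)
  have hsyz : SyzSur S.f ((b + 2 : ℕ) : ℤ) v :=
    hyp.syzSur (b := b + 2) hf S.irred.ne_zero hvZ hv (by
      change 3 * (3 * ((b + 2) * (b + 1) / 2) + 2 * (b + 2)) + Hs (b + 3) = 4 * Hs (b + 2)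
      linarith)
  obtain ⟨A, B, hBA, hpl⟩ := S.exists_transPlane
  have hAB : A * B = 1 := mul_eq_one_comm.1 hBA
  have hfA := linSub_mem_HZ A hf
  have hirrA := linSub_irreducible hBA S.irred
  have hsyz' : ∃ w : Fin (3 * ((b + 3) * (b + 3 - 1) / 2) + (b + 3) + 1) → Fin 4 → k,
      (∀ p, eval (w p) S.f = 0) ∧ SyzSur S.f ((b + 3 : ℕ) : ℤ) w ∧ ∀ p, w p ≠ 0 := by
    have hBv (p) : A.mulVec (B.mulVec (v p)) = v p := by
      rw [Matrix.mulVec_mulVec, hAB, Matrix.one_mulVec]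
    obtain ⟨w, hw, hw2, hw0⟩ := hpl.exists_syzSur hfA hirrA (b := b + 1) (n := 2 * (b + 3)) (by omega)
      (v := fun p => B.mulVec (v p)) (fun p => by rw [eval_linSub, hBv, hv])
      (fun p h => (hvZ p).elim fun h0 _ => h0 (by rw [← hBv p, h, Matrix.mulVec_zero]))
      (SyzSur.linSub hAB (by rwa [linSub_linSub hAB]))
    have he : 3 * ((b + 3) * (b + 3 - 1) / 2) + (b + 3) + 1 =
        3 * ((b + 3 - 1) * (b + 3 - 2) / 2) + 2 * (b + 3 - 1) + 2 * (b + 3) := by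
      change 3 * ((b + 3) * (b + 2) / 2) + (b + 3) + 1 =
        3 * ((b + 2) * (b + 1) / 2) + 2 * (b + 2) + 2 * (b + 3)
      linarith
    rw [he]
    refine ⟨_, fun p => by rw [← eval_linSub]; exact hw p, hw2.linSub hBA, fun p h0 => hw0 p ?_⟩
    rw [← Matrix.one_mulVec (w p), ← hBA, ← Matrix.mulVec_mulVec, h0, Matrix.mulVec_zero]
  have hrad : ∃ w : Fin (3 * ((b + 3) * (b + 3 - 1) / 2) + (b + 3) + 1) → Fin 4 → k,
      (∀ p, eval (w p) S.f = 0) ∧ RadialOnly S.f ((b + 2 : ℕ) : ℤ) w := by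
    obtain ⟨w, hw, hw2⟩ := exists_radialOnly hfA hirrA hpl (b + 2)
      (3 * ((b + 3) * (b + 2) / 2) + (b + 3) + 1) (by linarith)
    exact ⟨_, fun p => by rw [← eval_linSub]; exact hw p, hw2.linSub hBA⟩
  have hev : ∃ w : Fin (3 * ((b + 3) * (b + 3 - 1) / 2) + (b + 3) + 1) → Fin 4 → k,
      (∀ p, eval (w p) S.f = 0) ∧ EvSur ((b + 3 : ℕ) : ℤ) w :=
    exists_evSur hf S.irred (by
      change 3 * ((b + 3) * (b + 2) / 2) + (b + 3) + 1 ≤ Hs (b + 3)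
      linarith)
  have hopen := OpenOnCone.and (EvSur.openOnCone ((b + 3 : ℕ) : ℤ)) (RadialOnly.openOnCone (f := S.f)
    (ι := Fin (3 * ((b + 3) * (b + 3 - 1) / 2) + (b + 3) + 1)) ((b + 2 : ℕ) : ℤ))
  refine generalPointsSatisfy_of_openOnCone (b := b + 3) S
    ((SyzSur.openOnCone ((b + 3 : ℕ) : ℤ)).and hopen)
    (OpenOnCone.exists_and S.irred (SyzSur.openOnCone _) hopen hsyz'
      (OpenOnCone.exists_and S.irred (EvSur.openOnCone _) (RadialOnly.openOnCone _) hev hrad))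
    (fun v hv => hv.2.1) (fun v hv => hv.1.2) ?_
  rintro Z v hvZ hv ⟨⟨h1, h2⟩, h3, h4⟩
  refine hasMinFreeRes3_of_conditions hf S.irred hv h2 (by omega) ?_ h3 h1 ?_
    (mem_pointsIdeal_iff hvZ)
  · rw [Fintype.card_fin]
    change 2 * (3 * ((b + 3) * (b + 2) / 2) + (b + 3) + 1) =
      3 * ((b + 3) * (b + 2)) + 2 * (b + 3) + 2
    linarith
  · have : ((b + 3 : ℕ) : ℤ) - 1 = ((b + 2 : ℕ) : ℤ) := by push_cast; ring
    rwa [this]
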